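/- arXiv:1212.6949 — 2 statements merged into one kernel-verified Lean document; each statement's English description precedes it below -/
import Mathlib

section
/- Let t > 0 and τ > 0 be fixed, and let x, y ∈ ℝ. Then lim_{N→∞} ∫∫ s_x(H + D) · s_y(H) dγ^N_t(H) dγ^N_τ(D) = 0. (This is the propagation of temporal chaos: the two-time spin–spin correlation function of the real Ginibre evolution at a fixed positive time lag τ vanishes in the large-N limit.) -/
open MeasureTheory Matrix

/-- The measurable space structure on real matrices (the product σ-algebra on entries). -/
noncomputable instance matrixMeasurableSpace (N : ℕ) :
    MeasurableSpace (Matrix (Fin N) (Fin N) ℝ) :=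
  inferInstanceAs (MeasurableSpace (Fin N → Fin N → ℝ))

/-- `ginibre N s` is the Gaussian probability measure `γ^N_s` on `N×N` real matrices under
which the `N²` entries are i.i.d. centered Gaussians of variance `s/2`. -/
noncomputable def ginibre (N : ℕ) (s : ℝ) : Measure (Matrix (Fin N) (Fin N) ℝ) :=
  (Measure.pi fun _ : Fin N => Measure.pi fun _ : Fin N =>
    ProbabilityTheory.gaussianReal 0 (Real.toNNReal (s / 2)) :
      Measure (Fin N → Fin N → ℝ))

/-- `spin x M = (-1)^{n_x(M)}` where `n_x(M)` is the number of real roots (with multiplicity)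
of the characteristic polynomial of `M` that are `< x`. -/
noncomputable def spin {N : ℕ} (x : ℝ) (M : Matrix (Fin N) (Fin N) ℝ) : ℝ :=
  (-1 : ℝ) ^ Multiset.card (M.charpoly.roots.filter (fun r => r < x))


lemma pi_withDensity_aux {ι : Type*} [Fintype ι] {E : ι → Type*} [∀ i, MeasurableSpace (E i)]
    (μ : ∀ i, Measure (E i)) [∀ i, SigmaFinite (μ i)] (g : ∀ i, E i → ℝ)
    (hm : ∀ i, Measurable (g i)) (h0 : ∀ i x, 0 ≤ g i x) (hi : ∀ i, Integrable (g i) (μ i)) :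
    Measure.pi (fun i => (μ i).withDensity (fun x => ENNReal.ofReal (g i x))) =
      (Measure.pi μ).withDensity (fun x => ENNReal.ofReal (∏ i, g i (x i))) := by
  have : ∀ i, IsFiniteMeasure ((μ i).withDensity (fun x => ENNReal.ofReal (g i x))) := fun i =>
    isFiniteMeasure_withDensity_ofReal (hi i).2
  refine Measure.pi_eq (fun s hs => ?_)
  rw [withDensity_apply _ (MeasurableSet.univ_pi hs)]
  have e1 : ∀ i, (μ i).withDensity (fun x => ENNReal.ofReal (g i x)) (s i)
      = ENNReal.ofReal (∫ x, (s i).indicator (g i) x ∂(μ i)) := by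
    intro i
    rw [withDensity_apply _ (hs i), integral_indicator (hs i),
      ofReal_integral_eq_lintegral_ofReal (hi i).integrableOn (ae_of_all _ (h0 i))]
  simp_rw [e1]
  rw [← ENNReal.ofReal_prod_of_nonneg
    (fun i _ => integral_nonneg (fun x => Set.indicator_nonneg (fun x _ => h0 i x) x)),
    ← integral_fintype_prod_eq_prod, ← lintegral_indicator (MeasurableSet.univ_pi hs),
    ofReal_integral_eq_lintegral_ofReal]
  · congr 1
    ext x
    by_cases hx : x ∈ Set.univ.pi s
    · rw [Set.indicator_of_mem hx]
      congr 1
      exact Finset.prod_congr rfl (fun i _ => (Set.indicator_of_mem (hx i trivial) _).symm)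
    · rw [Set.indicator_of_notMem hx]
      simp only [Set.mem_pi, Set.mem_univ, true_implies, not_forall] at hx
      obtain ⟨i, hxi⟩ := hx
      rw [Finset.prod_eq_zero (Finset.mem_univ i) (Set.indicator_of_notMem hxi _)]
      simp
  · exact Integrable.fintype_prod_dep (fun i => (hi i).indicator (hs i))
  · exact ae_of_all _ (fun x => Finset.prod_nonneg fun i _ =>
      Set.indicator_nonneg (fun x _ => h0 i x) _)

noncomputable def gam (N : ℕ) (s : ℝ) : Measure (Fin N → Fin N → ℝ) :=
  Measure.pi fun _ : Fin N => Measure.pi fun _ : Fin N =>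
    ProbabilityTheory.gaussianReal 0 (Real.toNNReal (s / 2))

instance (N : ℕ) (s : ℝ) : IsProbabilityMeasure (gam N s) := by unfold gam; infer_instance

noncomputable def gpdf (N : ℕ) (s : ℝ) (D : Fin N → Fin N → ℝ) : ℝ :=
  ∏ i, ∏ j, ProbabilityTheory.gaussianPDFReal 0 (Real.toNNReal (s / 2)) (D i j)

lemma gpdf_pos (N : ℕ) {s : ℝ} (hs : 0 < s) (D) : 0 < gpdf N s D :=
  Finset.prod_pos fun i _ => Finset.prod_pos fun j _ =>
    ProbabilityTheory.gaussianPDFReal_pos _ _ _ (by simpa using hs)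

lemma gpdf_meas (N : ℕ) (s : ℝ) : Measurable (gpdf N s) := by
  unfold gpdf
  have := ProbabilityTheory.measurable_gaussianPDFReal 0 (Real.toNNReal (s / 2))
  fun_prop

lemma gam_eq (N : ℕ) {s : ℝ} (hs : 0 < s) :
    gam N s = (volume : Measure (Fin N → Fin N → ℝ)).withDensity
      (fun D => ENNReal.ofReal (gpdf N s D)) := by
  have hv : Real.toNNReal (s / 2) ≠ 0 := by simpa using hs
  have hm := ProbabilityTheory.measurable_gaussianPDFReal 0 (Real.toNNReal (s / 2))
  have h0 := ProbabilityTheory.gaussianPDFReal_nonneg 0 (Real.toNNReal (s / 2))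
  unfold gam
  simp_rw [ProbabilityTheory.gaussianReal_of_var_ne_zero 0 hv, ProbabilityTheory.gaussianPDF_def]
  rw [pi_withDensity_aux (fun _ : Fin N => (volume : Measure ℝ)) _ (fun _ => hm) (fun _ => h0)
    (fun _ => ProbabilityTheory.integrable_gaussianPDFReal _ _)]
  rw [pi_withDensity_aux _ _ (fun i => by fun_prop)
    (fun _ _ => Finset.prod_nonneg fun i _ => h0 _)
    (fun _ => Integrable.fintype_prod_dep
      (fun _ => ProbabilityTheory.integrable_gaussianPDFReal _ _))]
  rfl

lemma gpdf_eq (N : ℕ) {s : ℝ} (hs : 0 < s) (D : Fin N → Fin N → ℝ) :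
    gpdf N s D = (∏ _i : Fin N, ∏ _j : Fin N, (√(2 * Real.pi * (s/2)))⁻¹) *
      Real.exp (-(∑ i, ∑ j, D i j ^ 2) / s) := by
  unfold gpdf
  simp only [ProbabilityTheory.gaussianPDFReal_def, Finset.prod_mul_distrib, ← Real.exp_sum]
  rw [Real.coe_toNNReal _ (by positivity)]
  congr 2
  simp only [neg_div, Finset.sum_neg_distrib, Finset.sum_div, sub_zero]
  congr 1
  refine Finset.sum_congr rfl fun i _ => Finset.sum_congr rfl fun j _ => ?_
  congr 1; ring

lemma gam_integral (N : ℕ) {s : ℝ} (hs : 0 < s) (G : (Fin N → Fin N → ℝ) → ℝ) :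
    ∫ D, G D ∂(gam N s) = ∫ D, gpdf N s D * G D := by
  rw [gam_eq N hs, integral_withDensity_eq_integral_toReal_smul
    (gpdf_meas N s).ennreal_ofReal (by simp)]
  refine integral_congr_ae (ae_of_all _ fun D => ?_)
  simp [ENNReal.toReal_ofReal (gpdf_pos N hs D).le]

lemma gam_integrable (N : ℕ) {s : ℝ} (hs : 0 < s) (G : (Fin N → Fin N → ℝ) → ℝ) :
    Integrable G (gam N s) ↔ Integrable (fun D => gpdf N s D * G D) := by
  rw [gam_eq N hs, integrable_withDensity_iff_integrable_smul' (gpdf_meas N s).ennreal_ofReal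
    (by simp)]
  refine integrable_congr (ae_of_all _ fun D => ?_)
  simp [ENNReal.toReal_ofReal (gpdf_pos N hs D).le]

noncomputable def ip {N : ℕ} (B C : Fin N → Fin N → ℝ) : ℝ := ∑ i, ∑ j, B i j * C i j

/-- Cameron-Martin weight -/
noncomputable def cmw {N : ℕ} (s : ℝ) (B D : Fin N → Fin N → ℝ) : ℝ :=
  Real.exp ((2 * ip B D - ip B B) / s)

lemma ip_add_left {N : ℕ} (A B C : Fin N → Fin N → ℝ) : ip (A + B) C = ip A C + ip B C := by
  simp [ip, add_mul, Finset.sum_add_distrib]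
lemma ip_comm {N : ℕ} (A B : Fin N → Fin N → ℝ) : ip A B = ip B A := by
  simp [ip, mul_comm]
lemma ip_add_right {N : ℕ} (A B C : Fin N → Fin N → ℝ) : ip C (A + B) = ip C A + ip C B := by
  rw [ip_comm, ip_add_left, ip_comm A, ip_comm B]
lemma ip_sub_left {N : ℕ} (A B C : Fin N → Fin N → ℝ) : ip (A - B) C = ip A C - ip B C := by
  simp [ip, sub_mul, Finset.sum_sub_distrib]
lemma ip_sub_right {N : ℕ} (A B C : Fin N → Fin N → ℝ) : ip C (A - B) = ip C A - ip C B := by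
  rw [ip_comm, ip_sub_left, ip_comm A, ip_comm B]

lemma gpdf_eq' (N : ℕ) {s : ℝ} (hs : 0 < s) (D : Fin N → Fin N → ℝ) :
    gpdf N s D = (∏ _i : Fin N, ∏ _j : Fin N, (√(2 * Real.pi * (s/2)))⁻¹) *
      Real.exp (-(ip D D) / s) := by
  rw [gpdf_eq N hs]; simp [ip, sq]

lemma gpdf_shift {N : ℕ} {s : ℝ} (hs : 0 < s) (B D : Fin N → Fin N → ℝ) :
    gpdf N s D * cmw s B D = gpdf N s (D - B) := by
  rw [gpdf_eq' N hs, gpdf_eq' N hs, cmw, mul_assoc, ← Real.exp_add]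
  congr 2
  rw [ip_sub_left, ip_sub_right, ip_sub_right, ip_comm D B]
  ring

lemma gpdf_integrable (N : ℕ) {s : ℝ} (hs : 0 < s) : Integrable (gpdf N s) := by
  have := (gam_integrable N hs (fun _ => 1)).1 (integrable_const 1)
  simpa using this

lemma gpdf_integral (N : ℕ) {s : ℝ} (hs : 0 < s) : ∫ D, gpdf N s D = 1 := by
  have := (gam_integral N hs (fun _ => 1))
  simpa using this.symm

lemma cmw_integrable {N : ℕ} {s : ℝ} (hs : 0 < s) (B : Fin N → Fin N → ℝ) :
    Integrable (cmw s B) (gam N s) := by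
  rw [gam_integrable N hs]
  simp_rw [gpdf_shift hs]
  exact (gpdf_integrable N hs).comp_sub_right B

lemma cmw_integral {N : ℕ} {s : ℝ} (hs : 0 < s) (B : Fin N → Fin N → ℝ) :
    ∫ D, cmw s B D ∂(gam N s) = 1 := by
  rw [gam_integral N hs]
  simp_rw [gpdf_shift hs]
  rw [integral_sub_right_eq_self (fun D => gpdf N s D) B, gpdf_integral N hs]

lemma cmw_mul {N : ℕ} (s : ℝ) (B C D : Fin N → Fin N → ℝ) :
    cmw s B D * cmw s C D = Real.exp (2 * ip B C / s) * cmw s (B + C) D := by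
  simp only [cmw, ← Real.exp_add]
  congr 1
  simp only [ip_add_left, ip_add_right, ip_comm C B]
  ring

lemma psi_integrable {N : ℕ} {s : ℝ} (hs : 0 < s) (B C : Fin N → Fin N → ℝ) :
    Integrable (fun D => (1 - cmw s B D) * (1 - cmw s C D)) (gam N s) := by
  have : (fun D => (1 - cmw s B D) * (1 - cmw s C D)) = fun D =>
      1 - cmw s B D - cmw s C D + Real.exp (2 * ip B C / s) * cmw s (B + C) D := by
    ext D; rw [← cmw_mul]; ring
  rw [this]
  exact (((integrable_const 1).sub (cmw_integrable hs B)).sub (cmw_integrable hs C)).add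
    ((cmw_integrable hs _).const_mul _)

lemma psi_integral {N : ℕ} {s : ℝ} (hs : 0 < s) (B C : Fin N → Fin N → ℝ) :
    ∫ D, (1 - cmw s B D) * (1 - cmw s C D) ∂(gam N s) = Real.exp (2 * ip B C / s) - 1 := by
  have : (fun D => (1 - cmw s B D) * (1 - cmw s C D)) = fun D =>
      1 - cmw s B D - cmw s C D + Real.exp (2 * ip B C / s) * cmw s (B + C) D := by
    ext D; rw [← cmw_mul]; ring
  rw [this, integral_add, integral_sub, integral_sub, integral_const_mul, cmw_integral hs,
    cmw_integral hs, cmw_integral hs]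
  · simp
    ring
  · exact integrable_const _
  · exact cmw_integrable hs _
  · exact (integrable_const 1).sub (cmw_integrable hs B)
  · exact cmw_integrable hs _
  · exact (((integrable_const 1).sub (cmw_integrable hs B)).sub (cmw_integrable hs C))
  · exact ((cmw_integrable hs _).const_mul _)

noncomputable def hh {N : ℕ} (v : Fin N → ℝ) :
    (Fin N → Fin N → ℝ) →ₗ[ℝ] (Fin N → Fin N → ℝ) where
  toFun D := fun i j => D i j - 2 * (∑ k, D i k * v k) * v j
  map_add' D E := by
    ext i j; simp [add_mul, Finset.sum_add_distrib]; ring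
  map_smul' c D := by
    ext i j; simp [mul_assoc, ← Finset.mul_sum]; ring

lemma hh_apply {N : ℕ} (v : Fin N → ℝ) (D : Fin N → Fin N → ℝ) (i j : Fin N) :
    hh v D i j = D i j - 2 * (∑ k, D i k * v k) * v j := rfl

lemma hh_invol {N : ℕ} {v : Fin N → ℝ} (hv : ∑ k, v k * v k = 1) (D : Fin N → Fin N → ℝ) :
    hh v (hh v D) = D := by
  ext i j
  simp only [hh_apply, sub_mul, Finset.sum_sub_distrib]
  have : ∑ x, 2 * (∑ k, D i k * v k) * v x * v x = 2 * (∑ k, D i k * v k) := by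
    simp_rw [mul_assoc _ (v _) (v _)]
    rw [← Finset.mul_sum, hv, mul_one]
  rw [this]; ring

lemma ip_hh {N : ℕ} {v : Fin N → ℝ} (hv : ∑ k, v k * v k = 1) (D : Fin N → Fin N → ℝ) :
    ip (hh v D) (hh v D) = ip D D := by
  unfold ip
  refine Finset.sum_congr rfl fun i _ => ?_
  simp only [hh_apply]
  set c := ∑ k, D i k * v k with hc
  have : ∀ j, (D i j - 2 * c * v j) * (D i j - 2 * c * v j) =
    D i j * D i j - 4 * c * (D i j * v j) + 4 * c^2 * (v j * v j) := fun j => by ring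
  simp_rw [this]
  rw [Finset.sum_add_distrib, Finset.sum_sub_distrib, ← Finset.mul_sum, ← Finset.mul_sum, hv, ← hc]
  ring

lemma hh_mp {N : ℕ} {v : Fin N → ℝ} (hv : ∑ k, v k * v k = 1) :
    MeasurePreserving (hh v) (volume : Measure (Fin N → Fin N → ℝ)) volume := by
  have h2 : LinearMap.det (hh v) * LinearMap.det (hh v) = 1 := by
    rw [← LinearMap.det_comp]
    have : hh v ∘ₗ hh v = LinearMap.id := by
      exact LinearMap.ext fun D => hh_invol hv D
    rw [this, LinearMap.det_id]
  have hd : LinearMap.det (hh v) ≠ 0 := by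
    intro h; rw [h] at h2; simp at h2
  refine ⟨(LinearMap.continuous_of_finiteDimensional _).measurable, ?_⟩
  rw [Measure.map_linearMap_addHaar_eq_smul_addHaar volume hd]
  have : |(LinearMap.det (hh v))⁻¹| = 1 := by
    rcases mul_self_eq_one_iff.1 h2 with h | h <;> simp [h]
  rw [this]; simp

lemma det_hh {N : ℕ} {v : Fin N → ℝ} (hv : ∑ k, v k * v k = 1) (D : Fin N → Fin N → ℝ) :
    Matrix.det (Matrix.of (hh v D)) = - Matrix.det (Matrix.of D) := by
  have : Matrix.of (hh v D) =
      Matrix.of D * (1 + Matrix.replicateCol Unit (-2 • v) * Matrix.replicateRow Unit v) := by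
    ext i j
    rw [Matrix.mul_add, Matrix.mul_one]
    simp [Matrix.mul_apply, hh_apply, Finset.sum_mul, Finset.mul_sum]
    rw [sub_eq_add_neg]
    congr 2
    exact Finset.sum_congr rfl fun k _ => by ring
  rw [this, Matrix.det_mul, Matrix.det_one_add_replicateCol_mul_replicateRow]
  have : v ⬝ᵥ (-2 • v) = -2 := by
    rw [dotProduct_smul, dotProduct, hv]; simp
  rw [this]; ring

noncomputable def sd {N : ℕ} (M : Fin N → Fin N → ℝ) : ℝ := Real.sign (Matrix.det (Matrix.of M))

lemma sd_meas {N : ℕ} : Measurable (sd (N := N)) := by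
  have h : Measurable fun M : Fin N → Fin N → ℝ => Matrix.det (Matrix.of M) := by
    simp only [Matrix.det_apply, Matrix.of_apply]
    fun_prop
  have h2 : Measurable Real.sign := by
    unfold Real.sign
    exact Measurable.ite measurableSet_Iio measurable_const
      (Measurable.ite measurableSet_Ioi measurable_const measurable_const)
  exact h2.comp h

lemma sd_abs {N : ℕ} (M : Fin N → Fin N → ℝ) : |sd M| ≤ 1 := by
  unfold sd
  rcases Real.sign_apply_eq (Matrix.det (Matrix.of M)) with h | h | h <;> simp [h]

lemma sd_hh {N : ℕ} {v : Fin N → ℝ} (hv : ∑ k, v k * v k = 1) (D : Fin N → Fin N → ℝ) :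
    sd (hh v D) = - sd D := by
  unfold sd; rw [det_hh hv, Real.sign_neg]

lemma sd_reflect {N : ℕ} {s : ℝ} (hs : 0 < s) {v : Fin N → ℝ} (hv : ∑ k, v k * v k = 1)
    (A B : Fin N → Fin N → ℝ) (hA : hh v A = A + B) :
    ∫ D, sd (A + D) ∂(gam N s) = - ∫ D, sd (A + D) * cmw s B D ∂(gam N s) := by
  have hB : hh v B = - B := by
    have : B = hh v A - A := by rw [hA]; simp
    rw [this, map_sub, hh_invol hv]; simp
  have he : MeasurableEmbedding (hh v) :=
    (hh_mp hv).measurable.measurableEmbedding (fun a b h => by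
      rw [← hh_invol hv a, h, hh_invol hv])
  rw [gam_integral N hs, gam_integral N hs, ← (hh_mp hv).integral_comp he,
    ← integral_sub_right_eq_self _ B, ← integral_neg]
  congr 1
  ext D
  have e1 : gpdf N s (hh v (D - B)) = gpdf N s D * cmw s B D := by
    rw [gpdf_shift hs, gpdf_eq' N hs, gpdf_eq' N hs, ip_hh hv]
  have e2 : A + hh v (D - B) = hh v (A + D) := by
    rw [map_sub, map_add, hA, hB]; abel
  rw [e1, e2, sd_hh hv]; ring

lemma sd_cmw_integrable {N : ℕ} {s : ℝ} (hs : 0 < s) (A B : Fin N → Fin N → ℝ) :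
    Integrable (fun D => sd (A + D) * cmw s B D) (gam N s) :=
  (cmw_integrable hs B).bdd_mul (c := 1) (sd_meas.comp (by fun_prop)).aestronglyMeasurable
    (ae_of_all _ fun D => sd_abs _)

lemma sd_integrable {N : ℕ} {s : ℝ} (A : Fin N → Fin N → ℝ) :
    Integrable (fun D => sd (A + D)) (gam N s) := 
  Integrable.of_bound (sd_meas.comp (by fun_prop)).aestronglyMeasurable 1
    (ae_of_all _ fun D => sd_abs _)

lemma key_bound {N : ℕ} {s : ℝ} (hs : 0 < s) (A : Fin N → Fin N → ℝ) (I : Finset (Fin N))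
    (v : Fin N → Fin N → ℝ) (hv : ∀ i ∈ I, ∑ k, v i k * v i k = 1)
    (ho : ∀ i ∈ I, ∀ k, k ≠ i → ∑ j, A k j * v i j = 0) (K : ℝ)
    (hK : ∀ i ∈ I, Real.exp (8 * (∑ j, A i j * v i j) ^ 2 / s) - 1 ≤ K) :
    4 * (I.card : ℝ) ^ 2 * (∫ D, sd (A + D) ∂(gam N s)) ^ 2 ≤ I.card * K := by
  set B : Fin N → Fin N → Fin N → ℝ := fun i k j =>
    if k = i then -2 * (∑ l, A i l * v i l) * v i j else 0 with hB
  have hip : ∀ i ∈ I, ip (B i) (B i) = 4 * (∑ j, A i j * v i j) ^ 2 := by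
    intro i hi
    simp only [ip, hB]
    rw [Finset.sum_eq_single i (by intro b _ hb; simp [hb]) (by simp)]
    simp only [if_true]
    have : ∀ j, -2 * (∑ l, A i l * v i l) * v i j * (-2 * (∑ l, A i l * v i l) * v i j)
      = 4 * (∑ l, A i l * v i l) ^ 2 * (v i j * v i j) := fun j => by ring
    simp_rw [this]
    rw [← Finset.mul_sum, hv i hi, mul_one]
  have hip0 : ∀ i j, i ≠ j → ip (B i) (B j) = 0 := by
    intro i j hij
    simp only [ip, hB]
    refine Finset.sum_eq_zero fun k _ => Finset.sum_eq_zero fun l _ => ?_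
    by_cases h : k = i
    · have : k ≠ j := by rw [h]; exact hij
      simp [this]
    · simp [h]
  have hrefl : ∀ i ∈ I, hh (v i) A = A + B i := by
    intro i hi
    ext k j
    simp only [hh_apply, hB, Pi.add_apply]
    by_cases h : k = i
    · subst h; simp; ring
    · simp [h, ho i hi k h]
  set f := ∫ D, sd (A + D) ∂(gam N s) with hf
  have h2 : ∀ i ∈ I, ∫ D, sd (A + D) * (1 - cmw s (B i) D) ∂(gam N s) = 2 * f := by
    intro i hi
    simp_rw [mul_sub, mul_one]
    rw [integral_sub (sd_integrable A) (sd_cmw_integrable hs A _)]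
    have := sd_reflect hs (hv i hi) A (B i) (hrefl i hi)
    linarith
  have hint1 : ∀ i, Integrable (fun D => sd (A + D) * (1 - cmw s (B i) D)) (gam N s) := by
    intro i
    simp_rw [mul_sub, mul_one]
    exact (sd_integrable A).sub (sd_cmw_integrable hs A _)
  set Ψ : (Fin N → Fin N → ℝ) → ℝ := fun D => ∑ i ∈ I, (1 - cmw s (B i) D) with hΨ
  have hsum : ∫ D, sd (A + D) * Ψ D ∂(gam N s) = 2 * I.card * f := by
    simp only [hΨ, Finset.mul_sum]
    rw [integral_finsetSum _ (fun i _ => hint1 i), Finset.sum_congr rfl h2]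
    simp; ring
  have hsq : ∀ D, Ψ D ^ 2 = ∑ i ∈ I, ∑ j ∈ I, (1 - cmw s (B i) D) * (1 - cmw s (B j) D) := by
    intro D; rw [sq, hΨ, Finset.sum_mul_sum]
  have hsqi : Integrable (fun D => Ψ D ^ 2) (gam N s) := by
    simp_rw [hsq]
    exact integrable_finsetSum _ fun i _ => integrable_finsetSum _ fun j _ =>
      psi_integrable hs _ _
  have hΨ2 : ∫ D, Ψ D ^ 2 ∂(gam N s) ≤ I.card * K := by
    simp_rw [hsq]
    rw [integral_finsetSum _ fun i _ => integrable_finsetSum _ fun j _ =>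
      psi_integrable hs _ _]
    rw [← nsmul_eq_mul]
    refine Finset.sum_le_card_nsmul _ _ _ fun i hi => ?_
    rw [integral_finsetSum _ fun j _ => psi_integrable hs _ _]
    simp_rw [psi_integral hs]
    rw [Finset.sum_eq_single i (by intro j _ hj; simp [hip0 i j hj.symm]) (by simp [hi])]
    rw [hip i hi]
    have := hK i hi
    rwa [show 2 * (4 * (∑ j, A i j * v i j) ^ 2) = 8 * (∑ j, A i j * v i j) ^ 2 by ring]
  have hint : Integrable (fun D => sd (A + D) * Ψ D) (gam N s) := by
    simp only [hΨ, Finset.mul_sum]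
    exact integrable_finsetSum _ fun i _ => hint1 i
  set m := ∫ D, sd (A + D) * Ψ D ∂(gam N s) with hm
  have hfin : 0 ≤ ∫ D, (Ψ D ^ 2 - 2 * m * (sd (A + D) * Ψ D) + m ^ 2) ∂(gam N s) := by
    refine integral_nonneg fun D => ?_
    have h1 : sd (A + D) ^ 2 ≤ 1 := (sq_le_one_iff_abs_le_one _).2 (sd_abs _)
    simp only [Pi.zero_apply]
    nlinarith [sq_nonneg (sd (A + D) * Ψ D - m), sq_nonneg (Ψ D)]
  have hi3 : Integrable (fun D => Ψ D ^ 2 - 2 * m * (sd (A + D) * Ψ D)) (gam N s) :=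
    hsqi.sub (hint.const_mul _)
  rw [integral_add hi3 (integrable_const _),
    integral_sub hsqi (hint.const_mul _), integral_const_mul, ← hm] at hfin
  simp at hfin
  have : m ^ 2 = 4 * (I.card : ℝ) ^ 2 * f ^ 2 := by rw [hsum]; ring
  nlinarith

lemma monic_noroot_pos (q : Polynomial ℝ) (hq : q.Monic) (h : ∀ x, q.eval x ≠ 0) (x : ℝ) :
    0 < q.eval x := by
  by_contra hx
  have hx : q.eval x < 0 := lt_of_le_of_ne (not_lt.1 hx) (h x)
  by_cases hd : 0 < q.degree
  · have ht := q.tendsto_atTop_of_leadingCoeff_nonneg hd (by rw [hq.leadingCoeff]; norm_num)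
    obtain ⟨y, hy1, hy2⟩ := ((ht.eventually_ge_atTop 0).and (Filter.eventually_ge_atTop x)).exists
    obtain ⟨z, -, hz⟩ := intermediate_value_Icc hy2 q.continuous.continuousOn ⟨hx.le, hy1⟩
    exact h z hz
  · have : q = 1 := by
      rw [Polynomial.eq_C_of_degree_le_zero (not_lt.1 hd)] at hq ⊢
      have := hq.leadingCoeff
      rw [Polynomial.leadingCoeff_C] at this
      rw [this]; simp
    rw [this] at hx; simp at hx; linarith

lemma monic_noroot_pos' (q : Polynomial ℝ) (hq : q.Monic) (h : ∀ x, q.eval x ≠ 0) (x : ℝ) :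
    0 < (-1) ^ q.natDegree * q.eval x := by
  have := monic_noroot_pos (Polynomial.C ((-1) ^ q.natDegree) * q.comp (-Polynomial.X)) ?_ ?_ (-x)
  · simpa using this
  · rw [Polynomial.Monic, Polynomial.leadingCoeff_mul, Polynomial.leadingCoeff_C,
      Polynomial.leadingCoeff_comp (by simp), hq.leadingCoeff]
    simp [← mul_pow]
  · intro y
    simp [h]

lemma prod_sign_pos (x : ℝ) (m : Multiset ℝ) (hm : x ∉ m) :
    0 < (-1 : ℝ) ^ Multiset.card (m.filter (fun r => r < x)) *
      (m.map (fun r => r - x)).prod := by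
  induction m using Multiset.induction_on with
  | empty => simp
  | cons a m ih =>
    simp only [Multiset.mem_cons, not_or] at hm
    have := ih hm.2
    rcases lt_or_gt_of_ne hm.1 with h | h
    · rw [Multiset.filter_cons_of_neg _ (by linarith), Multiset.map_cons, Multiset.prod_cons]
      nlinarith [mul_pos (sub_pos.2 h) this]
    · rw [Multiset.filter_cons_of_pos (p := fun r => r < x) _ h, Multiset.map_cons, Multiset.prod_cons,
        Multiset.card_cons, pow_succ]
      nlinarith [mul_pos (sub_pos.2 h) this]

lemma poly_sign (p : Polynomial ℝ) (hp : p.Monic) (x : ℝ) (hx : p.eval x ≠ 0) :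
    0 < (-1 : ℝ) ^ Multiset.card (p.roots.filter (fun r => r < x)) *
      ((-1) ^ p.natDegree * p.eval x) := by
  obtain ⟨q, hq, hdeg, hr⟩ := p.exists_prod_multiset_X_sub_C_mul
  have hmon : q.Monic := by
    refine Polynomial.Monic.of_mul_monic_left
      (Polynomial.monic_multiset_prod_of_monic p.roots _ fun a _ => Polynomial.monic_X_sub_C a) ?_
    rw [hq]; exact hp
  have hnr : ∀ y, q.eval y ≠ 0 := by
    intro y hy
    have : y ∈ q.roots := (Polynomial.mem_roots hmon.ne_zero).2 hy
    rw [hr] at this; simp at this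
  have h1 := monic_noroot_pos' q hmon hnr x
  have h2 := prod_sign_pos x p.roots (fun h => hx ((Polynomial.mem_roots hp.ne_zero).1 h))
  have h3 : (-1 : ℝ) ^ p.natDegree * p.eval x =
      (p.roots.map (fun r => r - x)).prod * ((-1) ^ q.natDegree * q.eval x) := by
    rw [← hdeg]
    have he : p.eval x = (p.roots.map (fun r => x - r)).prod * q.eval x := by
      conv_lhs => rw [← hq]
      rw [Polynomial.eval_mul, Polynomial.eval_multiset_prod, Multiset.map_map]
      simp only [Function.comp_def, Polynomial.eval_sub, Polynomial.eval_X, Polynomial.eval_C]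
    have : (p.roots.map (fun r => r - x)).prod = (-1) ^ Multiset.card p.roots *
        (p.roots.map (fun r => x - r)).prod := by
      have := Multiset.prod_map_neg (p.roots.map (fun r => x - r))
      rw [Multiset.map_map, Multiset.card_map] at this
      rw [← this]
      simp [Function.comp_def]
    rw [he, this, pow_add]
    ring
  rw [h3, ← mul_assoc]
  exact mul_pos h2 h1

/-- the scalar matrix as a plain function -/
noncomputable def sc (N : ℕ) (x : ℝ) : Fin N → Fin N → ℝ := fun i j => if i = j then x else 0

lemma of_sc (N : ℕ) (x : ℝ) : Matrix.of (sc N x) = Matrix.scalar (Fin N) x := by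
  ext i j; simp [sc, Matrix.diagonal_apply]

lemma eval_charpoly_sc {N : ℕ} (M : Fin N → Fin N → ℝ) (x : ℝ) :
    (-1) ^ N * (Matrix.of M).charpoly.eval x = Matrix.det (Matrix.of (M - sc N x)) := by
  have : Matrix.of (M - sc N x) = - (Matrix.scalar (Fin N) x - Matrix.of M) := by
    rw [← of_sc]; ext i j; simp
  rw [this, Matrix.det_neg, Matrix.eval_charpoly]; simp

lemma spin_eq {N : ℕ} (x : ℝ) (M : Fin N → Fin N → ℝ)
    (h : Matrix.det (Matrix.of (M - sc N x)) ≠ 0) :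
    (-1 : ℝ) ^ Multiset.card ((Matrix.of M).charpoly.roots.filter (fun r => r < x))
      = sd (M - sc N x) := by
  have h0 := poly_sign (Matrix.of M).charpoly (Matrix.charpoly_monic _) x (by
    intro h0; rw [← eval_charpoly_sc, h0] at h; simp at h)
  rw [Matrix.charpoly_natDegree_eq_dim, Fintype.card_fin, eval_charpoly_sc] at h0
  unfold sd
  rcases neg_one_pow_eq_or ℝ
    (Multiset.card ((Matrix.of M).charpoly.roots.filter (fun r => r < x))) with h1 | h1
  · rw [h1] at h0 ⊢
    rw [Real.sign_of_pos (by linarith)]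
  · rw [h1] at h0 ⊢
    rw [Real.sign_of_neg (by linarith)]

lemma det_meas {N : ℕ} : Measurable fun M : Fin N → Fin N → ℝ => Matrix.det (Matrix.of M) := by
  simp only [Matrix.det_apply, Matrix.of_apply]
  fun_prop

lemma det_ne_zero_ae (N : ℕ) :
    ∀ᵐ M ∂(volume : Measure (Fin N → Fin N → ℝ)), Matrix.det (Matrix.of M) ≠ 0 := by
  let L : ℝ →ₗ[ℝ] (Fin N → Fin N → ℝ) :=
    { toFun := fun c => sc N c
      map_add' := fun a b => by ext i j; simp [sc]; split_ifs <;> simp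
      map_smul' := fun a b => by ext i j; simp [sc] }
  have hs : MeasurableSet {M : Fin N → Fin N → ℝ | Matrix.det (Matrix.of M) ≠ 0} :=
    det_meas (measurableSet_singleton 0).compl
  refine (ae_ae_add_linearMap_mem_iff L (volume : Measure ℝ) volume hs).1
    (ae_of_all _ fun M => ?_)
  have hfin : {c : ℝ | (Matrix.of (-M)).charpoly.IsRoot c}.Finite :=
    Polynomial.finite_setOfPred_isRoot (Matrix.charpoly_monic _).ne_zero
  filter_upwards [hfin.countable.ae_notMem volume] with c hc
  intro h0
  apply hc
  change Polynomial.eval c _ = 0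
  rw [Matrix.eval_charpoly, ← h0]
  congr 1
  rw [← of_sc]; ext i j; simp [L]; ring

lemma gam_ac (N : ℕ) {s : ℝ} (hs : 0 < s) : gam N s ≪ volume := by
  rw [gam_eq N hs]; exact withDensity_absolutelyContinuous _ _

lemma det_ne_zero_gam (N : ℕ) {s : ℝ} (hs : 0 < s) (A : Fin N → Fin N → ℝ) :
    ∀ᵐ D ∂(gam N s), Matrix.det (Matrix.of (A + D)) ≠ 0 := by
  refine (gam_ac N hs).ae_le ?_
  exact (measurePreserving_add_left volume A).quasiMeasurePreserving.ae (det_ne_zero_ae N)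

lemma gauss_sq (N : ℕ) {t : ℝ} (ht : 0 < t) (c : Fin N → ℝ) :
    Integrable (fun h : Fin N → ℝ => (∑ j, h j * c j) ^ 2) (Measure.pi fun _ : Fin N =>
      ProbabilityTheory.gaussianReal 0 (Real.toNNReal (t / 2))) ∧
    ∫ h, (∑ j, h j * c j) ^ 2 ∂(Measure.pi fun _ : Fin N =>
      ProbabilityTheory.gaussianReal 0 (Real.toNNReal (t / 2))) = t / 2 * ∑ j, c j ^ 2 := by
  set g := ProbabilityTheory.gaussianReal 0 (Real.toNNReal (t / 2)) with hg
  have hid : MemLp (fun x : ℝ => x) 2 g := ProbabilityTheory.memLp_id_gaussianReal' 2 (by simp)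
  have hmem : ∀ j, MemLp (fun x : ℝ => x * c j) 2 g := fun j => by
    simpa [mul_comm] using hid.const_mul (c j)
  have hmem' : ∀ j, MemLp (fun h : Fin N → ℝ => h j * c j) 2 (Measure.pi fun _ : Fin N => g) :=
    fun j => (hmem j).comp_measurePreserving (measurePreserving_eval (fun _ : Fin N => g) j)
  have hmemS : MemLp (fun h : Fin N → ℝ => ∑ j, h j * c j) 2 (Measure.pi fun _ : Fin N => g) :=
    memLp_finsetSum _ fun j _ => hmem' j
  refine ⟨hmemS.integrable_sq, ?_⟩
  have h0 : ∫ h : Fin N → ℝ, (∑ j, h j * c j) ∂(Measure.pi fun _ : Fin N => g) = 0 := by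
    rw [integral_finsetSum _ fun j _ => (hmem' j).integrable (by norm_num)]
    refine Finset.sum_eq_zero fun j _ => ?_
    rw [integral_mul_const]
    have : ∫ h : Fin N → ℝ, h j ∂(Measure.pi fun _ : Fin N => g) = ∫ x, x ∂g :=
      integral_comp_eval (μ := fun _ : Fin N => g) (i := j) (f := fun x : ℝ => x)
        (by fun_prop)
    rw [this, hg, ProbabilityTheory.integral_id_gaussianReal, zero_mul]
  rw [← ProbabilityTheory.variance_of_integral_eq_zero hmemS.aestronglyMeasurable.aemeasurable h0]
  have := ProbabilityTheory.variance_sum_pi (μ := fun _ : Fin N => g)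
    (X := fun j x => x * c j) hmem
  have e : (∑ i, fun ω : Fin N → ℝ => ω i * c i) = fun h => ∑ j, h j * c j := by
    ext h; simp
  rw [e] at this
  rw [this, Finset.mul_sum]
  refine Finset.sum_congr rfl fun j _ => ?_
  have e2 : (fun x : ℝ => x * c j) = fun x => c j * x := by ext; ring
  rw [e2, ProbabilityTheory.variance_const_mul, hg, ProbabilityTheory.variance_fun_id_gaussianReal,
    Real.coe_toNNReal _ (by positivity)]
  ring

noncomputable def cf {N : ℕ} (A : Fin N → Fin N → ℝ) (i j : Fin N) : ℝ :=
  Matrix.adjugate (Matrix.of A) j i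

noncomputable def dsq {N : ℕ} (A : Fin N → Fin N → ℝ) (i : Fin N) : ℝ :=
  (Matrix.det (Matrix.of A)) ^ 2 / ∑ j, cf A i j ^ 2

lemma cf_eq {N : ℕ} (A : Fin N → Fin N → ℝ) (i j : Fin N) :
    cf A i j = Matrix.det (Matrix.of (Function.update A i (Pi.single j 1))) := by
  rw [cf, Matrix.adjugate_apply]; rfl

lemma cf_meas {N : ℕ} (i j : Fin N) : Measurable fun A : Fin N → Fin N → ℝ => cf A i j := by
  simp_rw [cf_eq]
  refine det_meas.comp ?_
  exact measurable_update_left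

lemma cf_update {N : ℕ} (A : Fin N → Fin N → ℝ) (i j : Fin N) (h : Fin N → ℝ) :
    cf (Function.update A i h) i j = cf A i j := by
  rw [cf_eq, cf_eq, Function.update_idem]

lemma cf_mul {N : ℕ} (A : Fin N → Fin N → ℝ) (i k : Fin N) :
    ∑ j, A k j * cf A i j = if k = i then Matrix.det (Matrix.of A) else 0 := by
  have := congrFun (congrFun (Matrix.mul_adjugate (Matrix.of A)) k) i
  rw [Matrix.mul_apply] at this
  simpa [cf, Matrix.one_apply] using this

lemma dsq_meas {N : ℕ} (i : Fin N) : Measurable fun A : Fin N → Fin N → ℝ => dsq A i := by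
  unfold dsq
  have := fun j => cf_meas (N := N) i j
  have := det_meas (N := N)
  fun_prop

lemma dsq_nonneg {N : ℕ} (A : Fin N → Fin N → ℝ) (i : Fin N) : 0 ≤ dsq A i := by
  unfold dsq; positivity

lemma dsq_bound {N : ℕ} (A : Fin N → Fin N → ℝ) (i : Fin N) (h : Fin N → ℝ) (x : ℝ) :
    dsq (Function.update A i h - sc N x) i ≤
      2 * (∑ j, h j * cf (A - sc N x) i j) ^ 2 / (∑ j, cf (A - sc N x) i j ^ 2) + 2 * x ^ 2 := by
  have e : Function.update A i h - sc N x = Function.update (A - sc N x) i (h - sc N x i) := by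
    ext k j
    by_cases hk : k = i
    · subst hk; simp
    · simp [hk]
  rw [e, dsq]
  simp_rw [cf_update]
  have hd := cf_mul (Function.update (A - sc N x) i (h - sc N x i)) i i
  simp_rw [cf_update] at hd
  simp only [Function.update_self, if_true, Pi.sub_apply, sub_mul, Finset.sum_sub_distrib] at hd
  rw [← hd]
  have hx : ∑ j, sc N x i j * cf (A - sc N x) i j = x * cf (A - sc N x) i i := by
    simp [sc]
  rw [hx]
  set c := cf (A - sc N x) i
  set u := ∑ j, h j * c j
  have hci : c i ^ 2 ≤ ∑ j, c j ^ 2 :=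
    Finset.single_le_sum (f := fun j => c j ^ 2) (fun j _ => sq_nonneg _) (Finset.mem_univ i)
  set S := ∑ j, c j ^ 2
  have hS : 0 ≤ S := le_trans (sq_nonneg _) hci
  rcases hS.eq_or_lt with h0 | h0
  · rw [← h0]; simp; positivity
  · rw [div_add' _ _ _ h0.ne']
    gcongr
    nlinarith [sq_nonneg (u + x * c i), mul_le_mul_of_nonneg_left hci (sq_nonneg x)]

lemma dsq_lint_inner {N : ℕ} {t : ℝ} (ht : 0 < t) (A : Fin N → Fin N → ℝ) (i : Fin N) (x : ℝ) :
    ∫⁻ h, ENNReal.ofReal (dsq (Function.update A i h - sc N x) i) ∂(Measure.pi fun _ : Fin N =>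
      ProbabilityTheory.gaussianReal 0 (Real.toNNReal (t / 2)))
      ≤ ENNReal.ofReal (t + 2 * x ^ 2) := by
  set c := cf (A - sc N x) i with hc
  obtain ⟨h1, h2⟩ := gauss_sq N ht c
  have hint : Integrable (fun h : Fin N → ℝ =>
      2 * (∑ j, h j * c j) ^ 2 / (∑ j, c j ^ 2) + 2 * x ^ 2) (Measure.pi fun _ : Fin N =>
      ProbabilityTheory.gaussianReal 0 (Real.toNNReal (t / 2))) :=
    ((h1.const_mul 2).div_const _).add (integrable_const _)
  refine (lintegral_mono fun h => ENNReal.ofReal_le_ofReal (dsq_bound A i h x)).trans ?_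
  rw [← ofReal_integral_eq_lintegral_ofReal hint (ae_of_all _ fun h => by
    simp only [Pi.zero_apply]; positivity)]
  refine ENNReal.ofReal_le_ofReal ?_
  rw [integral_add ((h1.const_mul 2).div_const _) (integrable_const _), integral_div,
    integral_const_mul, h2]
  simp only [integral_const, probReal_univ, one_smul]
  gcongr
  rw [show 2 * (t / 2 * ∑ j, c j ^ 2) = t * ∑ j, c j ^ 2 by ring, mul_div_assoc]
  exact mul_le_of_le_one_right ht.le (div_self_le_one _)

lemma dsq_lint {N : ℕ} {t : ℝ} (ht : 0 < t) (i : Fin N) (x : ℝ) :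
    ∫⁻ H, ENNReal.ofReal (dsq (H - sc N x) i) ∂(gam N t) ≤ ENNReal.ofReal (t + 2 * x ^ 2) := by
  have hm : Measurable fun H : Fin N → Fin N → ℝ => ENNReal.ofReal (dsq (H - sc N x) i) :=
    ((dsq_meas i).comp (by fun_prop)).ennreal_ofReal
  unfold gam
  rw [lintegral_eq_lmarginal_univ 0, lmarginal_erase' _ hm (Finset.mem_univ i)]
  refine (lmarginal_mono (fun A => dsq_lint_inner ht A i x) 0).trans ?_
  simp [lmarginal]

lemma dsq_int {N : ℕ} {t : ℝ} (ht : 0 < t) (i : Fin N) (x : ℝ) :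
    Integrable (fun H => dsq (H - sc N x) i) (gam N t) ∧
    ∫ H, dsq (H - sc N x) i ∂(gam N t) ≤ t + 2 * x ^ 2 := by
  have hm : Measurable fun H : Fin N → Fin N → ℝ => dsq (H - sc N x) i :=
    (dsq_meas i).comp (by fun_prop)
  have h := dsq_lint ht i x
  constructor
  · refine ⟨hm.aestronglyMeasurable, ?_⟩
    rw [hasFiniteIntegral_iff_ofReal (ae_of_all _ fun H => dsq_nonneg _ _)]
    exact h.trans_lt ENNReal.ofReal_lt_top
  · rw [integral_eq_lintegral_of_nonneg_ae (ae_of_all _ fun H => dsq_nonneg _ _)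
      hm.aestronglyMeasurable]
    exact ENNReal.toReal_le_of_le_ofReal (by positivity) h

lemma sd_int_abs {N : ℕ} {s : ℝ} (A : Fin N → Fin N → ℝ) :
    |∫ D, sd (A + D) ∂(gam N s)| ≤ 1 := by
  have := norm_integral_le_of_norm_le_const (μ := gam N s) (f := fun D => sd (A + D)) (C := 1)
    (ae_of_all _ fun D => sd_abs _)
  simpa using this

lemma f_bound {N : ℕ} (hN : 0 < N) {s C : ℝ} (hs : 0 < s) (hC : 0 < C)
    (A : Fin N → Fin N → ℝ) (hA : Matrix.det (Matrix.of A) ≠ 0) :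
    |∫ D, sd (A + D) ∂(gam N s)| ≤
      √((Real.exp (8 * C / s) - 1) / (2 * N)) + 2 / (N * C) * ∑ i, dsq A i := by
  set f := ∫ D, sd (A + D) ∂(gam N s) with hf
  set K := Real.exp (8 * C / s) - 1 with hK
  have hK0 : 0 ≤ K := by
    have : 1 ≤ Real.exp (8 * C / s) := Real.one_le_exp (by positivity)
    linarith
  have hN' : (0 : ℝ) < N := by exact_mod_cast hN
  set I : Finset (Fin N) := Finset.univ.filter (fun i => dsq A i ≤ C) with hI
  have hsum0 : 0 ≤ ∑ i, dsq A i := Finset.sum_nonneg fun i _ => dsq_nonneg _ _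
  by_cases hn : (N : ℝ) ≤ 2 * I.card
  · have hSpos : ∀ i, 0 < ∑ j, cf A i j ^ 2 := by
      intro i
      have h0 : 0 ≤ ∑ j, cf A i j ^ 2 := Finset.sum_nonneg fun j _ => sq_nonneg _
      refine h0.lt_of_ne' fun h => hA ?_
      rw [Finset.sum_eq_zero_iff_of_nonneg (fun j _ => sq_nonneg _)] at h
      have := cf_mul A i i
      rw [if_pos rfl] at this
      rw [← this]
      refine Finset.sum_eq_zero fun j hj => ?_
      rw [pow_eq_zero_iff two_ne_zero |>.1 (h j hj), mul_zero]
    have hS2 : ∀ i, √(∑ j, cf A i j ^ 2) ^ 2 = ∑ j, cf A i j ^ 2 := fun i =>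
      Real.sq_sqrt (hSpos i).le
    have hS1 : ∀ i, 0 < √(∑ j, cf A i j ^ 2) := fun i => Real.sqrt_pos.2 (hSpos i)
    have hmulv : ∀ i k, ∑ j, A k j * (cf A i j / √(∑ j, cf A i j ^ 2)) =
        (if k = i then Matrix.det (Matrix.of A) else 0) / √(∑ j, cf A i j ^ 2) := by
      intro i k
      rw [← cf_mul, Finset.sum_div]
      exact Finset.sum_congr rfl fun j _ => by ring
    have hkey := key_bound hs A I (fun i j => cf A i j / √(∑ j, cf A i j ^ 2)) ?_ ?_ K ?_
    · rw [← hf] at hkey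
      have hn0 : (0 : ℝ) < I.card := by linarith
      have h1 : 4 * (I.card : ℝ) * f ^ 2 ≤ K := by
        refine le_of_mul_le_mul_left ?_ hn0
        linarith
      have h2 : f ^ 2 ≤ K / (2 * N) := by
        rw [le_div_iff₀ (by positivity)]
        nlinarith [mul_le_mul_of_nonneg_right hn (sq_nonneg f)]
      have h3 := Real.abs_le_sqrt h2
      have : 0 ≤ 2 / (N * C) * ∑ i, dsq A i := by positivity
      linarith
    · intro i _
      have : ∀ k, cf A i k / √(∑ j, cf A i j ^ 2) * (cf A i k / √(∑ j, cf A i j ^ 2)) =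
          cf A i k ^ 2 / (∑ j, cf A i j ^ 2) := by
        intro k; rw [div_mul_div_comm, ← sq, ← sq, hS2]
      simp_rw [this]
      rw [← Finset.sum_div, div_self (hSpos i).ne']
    · intro i _ k hk
      rw [hmulv, if_neg hk, zero_div]
    · intro i hi
      have hd : dsq A i ≤ C := (Finset.mem_filter.1 hi).2
      rw [hmulv, if_pos rfl, div_pow, hS2]
      change Real.exp (8 * dsq A i / s) - 1 ≤ K
      rw [hK]
      gcongr
  · push Not at hn
    have h1 : C * (N / 2) ≤ ∑ i, dsq A i := by
      set J : Finset (Fin N) := Finset.univ.filter (fun i => ¬ dsq A i ≤ C) with hJ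
      have hcard : (I.card : ℝ) + J.card = N := by
        have := Finset.card_filter_add_card_filter_not (s := (Finset.univ : Finset (Fin N)))
          (fun i => dsq A i ≤ C)
        rw [Finset.card_univ, Fintype.card_fin] at this
        exact_mod_cast this
      have h2 : J.card • C ≤ ∑ i ∈ J, dsq A i :=
        Finset.card_nsmul_le_sum _ _ _ fun i hi => (not_le.1 (Finset.mem_filter.1 hi).2).le
      have h3 : ∑ i ∈ J, dsq A i ≤ ∑ i, dsq A i :=
        Finset.sum_le_sum_of_subset_of_nonneg (Finset.subset_univ _)
          fun i _ _ => dsq_nonneg _ _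
      rw [nsmul_eq_mul] at h2
      have : C * (N / 2) ≤ J.card * C := by
        rw [mul_comm]; gcongr; linarith
      linarith
    have h2 : 1 ≤ 2 / (N * C) * ∑ i, dsq A i := by
      calc (1 : ℝ) = 2 / (N * C) * (C * (N / 2)) := by field_simp
        _ ≤ _ := by gcongr
    have := sd_int_abs (s := s) A
    have := Real.sqrt_nonneg (K / (2 * N))
    linarith

noncomputable def spn {N : ℕ} (x : ℝ) (M : Fin N → Fin N → ℝ) : ℝ :=
  (-1 : ℝ) ^ Multiset.card ((Matrix.of M).charpoly.roots.filter (fun r => r < x))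

lemma corr_bound {N : ℕ} (hN : 0 < N) {t s C : ℝ} (ht : 0 < t) (hs : 0 < s) (hC : 0 < C)
    (x y : ℝ) :
    |∫ H, ∫ D, spn x (H + D) * spn y H ∂(gam N s) ∂(gam N t)| ≤
      √((Real.exp (8 * C / s) - 1) / (2 * N)) + 2 * (t + 2 * x ^ 2) / C := by
  have hN' : (0 : ℝ) < N := by exact_mod_cast hN
  have hinner : ∀ H : Fin N → Fin N → ℝ, ∫ D, spn x (H + D) * spn y H ∂(gam N s) =
      (∫ D, sd ((H - sc N x) + D) ∂(gam N s)) * spn y H := by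
    intro H
    rw [integral_mul_const]
    congr 1
    refine integral_congr_ae ?_
    filter_upwards [det_ne_zero_gam N hs (H - sc N x)] with D hD
    have e : H - sc N x + D = H + D - sc N x := by abel
    rw [e] at hD ⊢
    exact spin_eq x (H + D) hD
  have hdet : ∀ᵐ H ∂(gam N t), Matrix.det (Matrix.of (H - sc N x)) ≠ 0 := by
    filter_upwards [det_ne_zero_gam N ht (- sc N x)] with H hH
    rwa [neg_add_eq_sub] at hH
  have hgi : Integrable (fun H => √((Real.exp (8 * C / s) - 1) / (2 * N)) +
      2 / (N * C) * ∑ i, dsq (H - sc N x) i) (gam N t) :=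
    (integrable_const _).add
      ((integrable_finsetSum _ fun i _ => (dsq_int ht i x).1).const_mul _)
  have h1 := norm_integral_le_of_norm_le
    (f := fun H => ∫ D, spn x (H + D) * spn y H ∂(gam N s)) hgi (by
      filter_upwards [hdet] with H hH
      rw [hinner, norm_mul, Real.norm_eq_abs]
      have : ‖spn y H‖ = 1 := by simp [spn]
      rw [this, mul_one]
      exact f_bound hN hs hC _ hH)
  rw [Real.norm_eq_abs] at h1
  refine h1.trans ?_
  rw [integral_add (integrable_const _)
    ((integrable_finsetSum _ fun i _ => (dsq_int ht i x).1).const_mul _), integral_const_mul,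
    integral_finsetSum _ fun i _ => (dsq_int ht i x).1]
  simp only [integral_const, probReal_univ, one_smul]
  gcongr
  have h2 : ∑ i, ∫ H, dsq (H - sc N x) i ∂(gam N t) ≤ N * (t + 2 * x ^ 2) := by
    have := Finset.sum_le_card_nsmul Finset.univ
      (fun i : Fin N => ∫ H, dsq (H - sc N x) i ∂(gam N t)) _ (fun i _ => (dsq_int ht i x).2)
    simpa [mul_add] using this
  calc _ ≤ 2 / (N * C) * (N * (t + 2 * x ^ 2)) := by gcongr
    _ = _ := by field_simp

lemma corr_tendsto {t s : ℝ} (ht : 0 < t) (hs : 0 < s) (x y : ℝ) :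
    Filter.Tendsto (fun N : ℕ =>
      ∫ H, ∫ D, spn x (H + D) * spn y H ∂(gam N s) ∂(gam N t)) Filter.atTop (nhds 0) := by
  rw [Metric.tendsto_atTop']
  intro ε hε
  set C := 4 * (t + 2 * x ^ 2) / ε with hCdef
  have hC : 0 < C := by positivity
  have hCe : 2 * (t + 2 * x ^ 2) / C = ε / 2 := by
    rw [hCdef]; field_simp; norm_num
  have hlim : Filter.Tendsto (fun N : ℕ => √((Real.exp (8 * C / s) - 1) / (2 * N)))
      Filter.atTop (nhds 0) := by
    rw [← Real.sqrt_zero]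
    refine (Real.continuous_sqrt.tendsto 0).comp ?_
    refine Filter.Tendsto.const_div_atTop ?_ _
    exact tendsto_natCast_atTop_atTop.const_mul_atTop (by norm_num)
  obtain ⟨n, hn⟩ := (Filter.eventually_atTop.1 (hlim.eventually_lt_const (half_pos hε)))
  refine ⟨n, fun N hN => ?_⟩
  rw [Real.dist_eq, sub_zero]
  have h1 := corr_bound (N := N) (by omega) ht hs hC x y
  have h2 := hn N hN.le
  rw [hCe] at h1
  linarith

/-- Propagation of temporal chaos: the two-time spin-spin correlation function of the real
Ginibre evolution at fixed positive time lag `τ` vanishes as `N → ∞`. -/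
theorem propagation_of_temporal_chaos (t τ : ℝ) (ht : 0 < t) (hτ : 0 < τ) (x y : ℝ) :
    Filter.Tendsto
      (fun N : ℕ =>
        ∫ H, ∫ D, spin x (H + D) * spin y H ∂(ginibre N τ) ∂(ginibre N t))
      Filter.atTop (nhds 0) := by
  exact corr_tendsto ht hτ x y
end

section
/- Let t > 0, T > 0 and x, y ∈ ℝ. Then lim_{N→∞} ∫∫ s_x(H + D) · s_y(H) dγ^N_t(H) dγ^N_{T/N}(D) = erfc(√((x−y)²/t + T/(2t))). (This is the decay of temporal correlations: the two-time spin–spin correlation function of the real Ginibre evolution at time lag T/N converges to a complementary error function.) -/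
open MeasureTheory Matrix

/-- The complementary error function `erfc u = (2/√π) ∫_u^∞ e^{−v²} dv`. -/
noncomputable def erfc (u : ℝ) : ℝ :=
  2 / Real.sqrt Real.pi * ∫ v in Set.Ioi u, Real.exp (-v ^ 2)

open MeasureTheory Matrix

theorem aux_pos {q : Polynomial ℝ} (hq : q.Monic) (hr : q.roots = 0) (x : ℝ) : 0 < q.eval x := by
  have hne : ∀ z, q.eval z ≠ 0 := by
    intro z hz
    have : z ∈ q.roots := (Polynomial.mem_roots hq.ne_zero).2 hz
    simp [hr] at this
  by_contra hneg
  have hx : q.eval x ≤ 0 := not_lt.1 hneg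
  by_cases hd : q.natDegree = 0
  · have : q = 1 := by
      exact hq.natDegree_eq_zero.1 hd
    rw [this] at hx; simp at hx; linarith
  · have ht : Filter.Tendsto (fun z => q.eval z) Filter.atTop Filter.atTop := by
      apply Polynomial.tendsto_atTop_of_leadingCoeff_nonneg
      · rw [Polynomial.degree_eq_natDegree hq.ne_zero]
        exact_mod_cast Nat.pos_of_ne_zero hd
      · rw [hq.leadingCoeff]; norm_num
    obtain ⟨w, hw1, hw2⟩ := ((ht.eventually_ge_atTop 1).and (Filter.eventually_ge_atTop x)).exists
    have hc : ContinuousOn (fun z => q.eval z) (Set.Icc x w) := q.continuous.continuousOn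
    have := intermediate_value_Icc hw2 hc
    obtain ⟨z, -, hz⟩ := this (show (0:ℝ) ∈ Set.Icc _ _ from ⟨hx, by linarith⟩)
    exact hne z hz

theorem aux_even {q : Polynomial ℝ} (hq : q.Monic) (hr : q.roots = 0) : (-1 : ℝ) ^ q.natDegree = 1 := by
  rcases neg_one_pow_eq_or ℝ q.natDegree with h | h
  · exact h
  exfalso
  have h0 := aux_pos hq hr 0
  have hm : ((-1 : ℝ) ^ q.natDegree • q.comp (-Polynomial.X)).Monic := by
    rw [h, neg_one_smul]
    unfold Polynomial.Monic
    rw [Polynomial.leadingCoeff_neg, Polynomial.leadingCoeff_comp (by simp), hq.leadingCoeff]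
    simp [h]
  have hne : ∀ z, q.eval z ≠ 0 := fun z => (aux_pos hq hr z).ne'
  have hr2 : ((-1 : ℝ) ^ q.natDegree • q.comp (-Polynomial.X)).roots = 0 := by
    apply Multiset.eq_zero_of_forall_notMem
    intro z hz
    have := Polynomial.isRoot_of_mem_roots hz
    simp [Polynomial.IsRoot, h] at this
    exact hne _ this
  have h1 := aux_pos hm hr2 0
  simp [h] at h1
  linarith

theorem sign_prod (x : ℝ) (s : Multiset ℝ) (hs : x ∉ s) :
    ((SignType.sign ((s.map (fun r => r - x)).prod) : SignType) : ℝ)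
      = (-1 : ℝ) ^ Multiset.card (s.filter (fun r => r < x)) := by
  induction s using Multiset.induction_on with
  | empty => simp
  | cons a s ih =>
    simp only [Multiset.mem_cons, not_or] at hs
    rw [Multiset.map_cons, Multiset.prod_cons, sign_mul]
    push_cast
    rw [ih hs.2]
    rcases lt_or_gt_of_ne hs.1 with h | h
    · rw [Multiset.filter_cons_of_neg _ (by linarith), sign_pos (by linarith)]; simp
    · rw [Multiset.filter_cons_of_pos _ (by linarith), sign_neg (by linarith)]
      simp [pow_succ]

theorem spin_eq_sign {N : ℕ} (x : ℝ) (M : Matrix (Fin N) (Fin N) ℝ) (h : (M - x • 1).det ≠ 0) :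
    spin x M = ((SignType.sign (M - x • (1 : Matrix (Fin N) (Fin N) ℝ)).det : SignType) : ℝ) := by
  have hev : (M - x • (1 : Matrix (Fin N) (Fin N) ℝ)).det = (-1) ^ N * M.charpoly.eval x := by
    rw [Matrix.eval_charpoly, ← neg_sub, Matrix.det_neg]
    simp [Matrix.smul_one_eq_diagonal, Matrix.scalar]
    rfl
  obtain ⟨q, hq1, hq2, hq3⟩ := Polynomial.exists_prod_multiset_X_sub_C_mul M.charpoly
  have hqm : q.Monic := by
    have h1 := M.charpoly_monic
    rw [← hq1] at h1
    exact Polynomial.Monic.of_mul_monic_left (Polynomial.monic_multiset_prod_of_monic _ _ (fun a _ => Polynomial.monic_X_sub_C a)) h1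
  have hN : M.charpoly.natDegree = N := by simp [Matrix.charpoly_natDegree_eq_dim]
  have hdet : (M - x • (1 : Matrix (Fin N) (Fin N) ℝ)).det
      = (M.charpoly.roots.map (fun r => r - x)).prod * q.eval x := by
    rw [hev]
    conv_lhs => rw [← hq1]
    rw [Polynomial.eval_mul, Polynomial.eval_multiset_prod, Multiset.map_map, ← mul_assoc]
    congr 1
    have : (fun r : ℝ => r - x) = fun r => (-1) * (x - r) := by ext; ring
    rw [this, Multiset.prod_map_mul]
    simp only [Multiset.map_const', Multiset.prod_replicate]
    congr 1
    · conv_lhs => rw [← hN, ← hq2, pow_add, aux_even hqm hq3, mul_one]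
    · congr 1
      apply Multiset.map_congr rfl
      intros; simp
  have hx : x ∉ M.charpoly.roots := by
    intro hx
    have := Polynomial.isRoot_of_mem_roots hx
    rw [Polynomial.IsRoot] at this
    rw [hev, this] at h; simp at h
  rw [hdet, sign_mul, sign_pos (aux_pos hqm hq3 x), mul_one, sign_prod x _ hx]
  rfl

open MeasureTheory Matrix

theorem pi_dens {E : Type*} [MeasurableSpace E] {μ : Measure E} [SigmaFinite μ] (N : ℕ) (g : E → ℝ)
    (hg0 : ∀ e, 0 ≤ g e) (hgi : Integrable g μ) :
    Measure.pi (fun _ : Fin N => μ.withDensity (fun e => ENNReal.ofReal (g e)))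
      = (Measure.pi (fun _ : Fin N => μ)).withDensity (fun h => ENNReal.ofReal (∏ i, g (h i))) := by
  have : IsFiniteMeasure (μ.withDensity (fun e => ENNReal.ofReal (g e))) :=
    isFiniteMeasure_withDensity_ofReal hgi.2
  apply Measure.pi_eq
  intro s hs
  rw [withDensity_apply _ (MeasurableSet.univ_pi hs), Measure.restrict_pi_pi]
  have hi : Integrable (fun h : Fin N → E => ∏ i, g (h i)) (Measure.pi fun i => μ.restrict (s i)) :=
    Integrable.fintype_prod (fun i => hgi.restrict)
  rw [← ofReal_integral_eq_lintegral_ofReal hi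
    (Filter.Eventually.of_forall fun h => Finset.prod_nonneg fun i _ => hg0 _)]
  rw [integral_fintype_prod_eq_prod (fun _ => g), ENNReal.ofReal_prod_of_nonneg
    (fun i _ => integral_nonneg hg0)]
  refine Finset.prod_congr rfl fun i _ => ?_
  rw [ofReal_integral_eq_lintegral_ofReal hgi.restrict (Filter.Eventually.of_forall hg0),
    withDensity_apply _ (hs i)]

/-- normalised row measure -/
noncomputable def rowG (N : ℕ) : Measure (Fin N → ℝ) :=
  Measure.pi fun _ : Fin N => ProbabilityTheory.gaussianReal 0 (1/2)

noncomputable def matG (N : ℕ) : Measure (Fin N → Fin N → ℝ) :=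
  Measure.pi fun _ : Fin N => rowG N

instance (N : ℕ) : IsProbabilityMeasure (rowG N) := by unfold rowG; infer_instance
instance (N : ℕ) : IsProbabilityMeasure (matG N) := by unfold matG; infer_instance

theorem rowG_eq (N : ℕ) : rowG N = (volume : Measure (Fin N → ℝ)).withDensity
    (fun h => ENNReal.ofReal ((√Real.pi)⁻¹ ^ N * Real.exp (-(h ⬝ᵥ h)))) := by
  unfold rowG
  have h2 : (1/2 : NNReal) ≠ 0 := by norm_num
  rw [ProbabilityTheory.gaussianReal_of_var_ne_zero _ h2, ProbabilityTheory.gaussianPDF_def,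
    pi_dens N (ProbabilityTheory.gaussianPDFReal 0 (1/2))
      (ProbabilityTheory.gaussianPDFReal_nonneg _ _)
      (ProbabilityTheory.integrable_gaussianPDFReal _ _)]
  congr 1
  funext h
  congr 1
  have : ∀ z, ProbabilityTheory.gaussianPDFReal 0 (1/2) z = (√Real.pi)⁻¹ * Real.exp (-(z*z)) := by
    intro z
    rw [ProbabilityTheory.gaussianPDFReal]
    congr 2
    · congr 1
      push_cast; ring
    · push_cast; ring_nf
  simp only [this, Finset.prod_mul_distrib, Finset.prod_const, Finset.card_univ, Fintype.card_fin,
    ← Real.exp_sum, dotProduct, Finset.sum_neg_distrib]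

theorem integral_exp_neg_dot (N : ℕ) (b : ℝ) :
    ∫ h : Fin N → ℝ, Real.exp (-(b * (h ⬝ᵥ h))) = √(Real.pi / b) ^ N := by
  have := integral_fintype_prod_volume_eq_pow (ι := Fin N) (fun z : ℝ => Real.exp (-b * z^2))
  rw [integral_gaussian] at this
  simp only [Fintype.card_fin] at this
  rw [← this]
  congr 1; funext h
  rw [← Real.exp_sum, dotProduct, ← Finset.mul_sum]
  congr 1
  rw [neg_mul]; congr 3; funext i; ring

theorem integrable_exp_neg_dot (N : ℕ) {b : ℝ} (hb : 0 < b) :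
    Integrable (fun h : Fin N → ℝ => Real.exp (-(b * (h ⬝ᵥ h)))) := by
  have := Integrable.fintype_prod (ι := Fin N) (f := fun _ => fun z : ℝ => Real.exp (-b * z^2))
    (μ := fun _ => volume) (fun _ => integrable_exp_neg_mul_sq hb)
  refine (integrable_congr (Filter.Eventually.of_forall fun h => ?_)).1 this
  show ∏ i, Real.exp (-b * h i ^ 2) = _
  rw [← Real.exp_sum, dotProduct, ← Finset.mul_sum]
  congr 1
  rw [neg_mul]; congr 3; funext i; ring

theorem integral_rowG (N : ℕ) (f : (Fin N → ℝ) → ℝ) :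
    ∫ h, f h ∂(rowG N) = (√Real.pi)⁻¹ ^ N * ∫ h, Real.exp (-(h ⬝ᵥ h)) * f h := by
  rw [rowG_eq, integral_withDensity_eq_integral_toReal_smul (by fun_prop)
    (Filter.Eventually.of_forall fun _ => ENNReal.ofReal_lt_top),
    ← integral_const_mul]
  congr 1; funext h
  rw [ENNReal.toReal_ofReal (by positivity), smul_eq_mul, mul_assoc]

theorem integrable_rowG_iff (N : ℕ) (f : (Fin N → ℝ) → ℝ) :
    Integrable f (rowG N) ↔ Integrable (fun h => Real.exp (-(h ⬝ᵥ h)) * f h) := by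
  rw [rowG_eq, integrable_withDensity_iff_integrable_smul' (by fun_prop)
    (Filter.Eventually.of_forall fun _ => ENNReal.ofReal_lt_top)]
  have : (fun h : Fin N → ℝ => (ENNReal.ofReal ((√Real.pi)⁻¹ ^ N * Real.exp (-(h ⬝ᵥ h)))).toReal • f h)
     = fun h => ((√Real.pi)⁻¹ ^ N) * (Real.exp (-(h ⬝ᵥ h)) * f h) := by
    funext h
    rw [ENNReal.toReal_ofReal (by positivity), smul_eq_mul, mul_assoc]
  rw [this, integrable_const_mul_iff]
  exact IsUnit.mk0 _ (by positivity)

theorem matG_ac (N : ℕ) : matG N ≪ (volume : Measure (Fin N → Fin N → ℝ)) := by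
  unfold matG
  rw [rowG_eq, pi_dens]
  · exact withDensity_absolutelyContinuous _ _
  · intro e; positivity
  · have := (integrable_exp_neg_dot N one_pos).const_mul ((√Real.pi)⁻¹ ^ N)
    simpa using this

theorem matG_det_ne (N : ℕ) (M : Matrix (Fin N) (Fin N) ℝ) {c : ℝ} (hc : c ≠ 0) :
    ∀ᵐ D ∂(matG N), (M + c • (Matrix.of D)).det ≠ 0 := by
  apply (matG_ac N).ae_le
  let L : ℝ →ₗ[ℝ] (Fin N → Fin N → ℝ) := LinearMap.toSpanSingleton ℝ _ ((1 : Matrix (Fin N) (Fin N) ℝ) : Fin N → Fin N → ℝ)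
  refine ae_mem_of_ae_add_linearMap_mem L volume volume (s := {D | (M + c • (Matrix.of D)).det ≠ 0}) ?_ ?_
  · apply IsOpen.measurableSet
    apply isOpen_ne.preimage
    fun_prop
  · intro D
    have : {l : ℝ | (M + c • (Matrix.of (D + L l))).det = 0}.Finite := by
      have h2 : {l : ℝ | (M + c • (Matrix.of (D + L l))).det = 0} ⊆
         {l | (-(c⁻¹ • M + Matrix.of D)).charpoly.eval l = 0} := by
        intro l hl
        simp only [Set.mem_ofPred_eq] at hl ⊢
        rw [Matrix.eval_charpoly]
        have : M + c • (Matrix.of (D + L l)) = c • (Matrix.scalar (Fin N) l - -(c⁻¹ • M + Matrix.of D)) := by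
          ext i j
          have hL : L l i j = l * (1 : Matrix (Fin N) (Fin N) ℝ) i j := rfl
          simp only [Matrix.add_apply, Matrix.smul_apply, Matrix.of_apply, Pi.add_apply, hL,
            Matrix.sub_apply, Matrix.neg_apply, Matrix.scalar_apply, Matrix.diagonal_apply,
            Matrix.one_apply, smul_eq_mul]
          by_cases h : i = j <;> simp only [h, if_true, if_false] <;> field_simp <;> ring
        rw [this, Matrix.det_smul] at hl
        have := pow_ne_zero (Fintype.card (Fin N)) hc
        exact (mul_eq_zero.1 hl).resolve_left this
      refine Set.Finite.subset ?_ h2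
      have h3 := (-(c⁻¹ • M + Matrix.of D)).charpoly_monic.ne_zero
      refine Set.Finite.subset (Polynomial.rootSet_finite (-(c⁻¹ • M + Matrix.of D)).charpoly ℝ) ?_
      intro l hl
      rw [Polynomial.mem_rootSet]
      exact ⟨h3, by simpa using hl⟩
    have h4 := this.measure_zero (volume : Measure ℝ)
    rw [ae_iff]
    simpa using h4

theorem matG_det_ne0 (N : ℕ) (M : Matrix (Fin N) (Fin N) ℝ) :
    ∀ᵐ D ∂(matG N), (Matrix.of D - M).det ≠ 0 := by
  filter_upwards [matG_det_ne N (-M) one_ne_zero] with D hD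
  convert hD using 2
  rw [one_smul, neg_add_eq_sub]

theorem ginibre_map (N : ℕ) {s : ℝ} (hs : 0 < s) :
    ginibre N s = (matG N).map (fun D : Fin N → Fin N → ℝ => fun i j => √s * D i j) := by
  unfold ginibre matG rowG
  have h0 : (ProbabilityTheory.gaussianReal 0 (1/2)).map (fun z => √s * z) =
      ProbabilityTheory.gaussianReal 0 (Real.toNNReal (s/2)) := by
    rw [ProbabilityTheory.gaussianReal_map_const_mul, mul_zero]
    congr 1
    ext
    push_cast
    rw [Real.sq_sqrt hs.le, Real.coe_toNNReal _ (by positivity)]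
    ring
  rw [← h0]
  have h1 : (Measure.pi fun _ : Fin N => (ProbabilityTheory.gaussianReal 0 (1/2)).map (fun z => √s * z))
     = (Measure.pi fun _ : Fin N => ProbabilityTheory.gaussianReal 0 (1/2)).map
        (fun h : Fin N → ℝ => fun j => √s * h j) := by
    have : IsProbabilityMeasure ((ProbabilityTheory.gaussianReal 0 (1/2)).map (fun z => √s * z)) := by
      rw [h0]; infer_instance
    rw [Measure.pi_map_pi (fun _ => by fun_prop)]
  rw [h1]
  have hm : Measurable (fun h : Fin N → ℝ => fun j => √s * h j) := by fun_prop
  have : IsProbabilityMeasure ((Measure.pi fun _ : Fin N => ProbabilityTheory.gaussianReal 0 (1/2)).map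
        (fun h : Fin N → ℝ => fun j => √s * h j)) := Measure.isProbabilityMeasure_map hm.aemeasurable
  exact (Measure.pi_map_pi (μ := fun _ : Fin N => Measure.pi fun _ : Fin N =>
    ProbabilityTheory.gaussianReal 0 (1/2)) (f := fun _ => fun h : Fin N → ℝ => fun j => √s * h j)
    (fun _ => hm.aemeasurable)).symm

open MeasureTheory Matrix

theorem gr_int1 : Integrable (fun z : ℝ => z) (ProbabilityTheory.gaussianReal 0 (1/2)) := by
  have := ProbabilityTheory.memLp_id_gaussianReal (μ := 0) (v := 1/2) 1
  exact memLp_one_iff_integrable.1 this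

theorem gr_int2 : Integrable (fun z : ℝ => z * z) (ProbabilityTheory.gaussianReal 0 (1/2)) := by
  have := ProbabilityTheory.memLp_id_gaussianReal (μ := 0) (v := 1/2) 2
  have h := this.integrable_sq
  simpa [sq] using h

theorem gr_mom1 : ∫ z : ℝ, z ∂(ProbabilityTheory.gaussianReal 0 (1/2)) = 0 :=
  ProbabilityTheory.integral_id_gaussianReal

theorem gr_mom2 : ∫ z : ℝ, z * z ∂(ProbabilityTheory.gaussianReal 0 (1/2)) = 1/2 := by
  have h1 := ProbabilityTheory.variance_fun_id_gaussianReal (μ := 0) (v := 1/2)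
  rw [ProbabilityTheory.variance_of_integral_eq_zero (by fun_prop) gr_mom1] at h1
  simpa [sq] using h1

theorem rowG_int1 {N : ℕ} (i : Fin N) : Integrable (fun h : Fin N → ℝ => h i) (rowG N) :=
  integrable_comp_eval (X := fun _ : Fin N => ℝ)
    (μ := fun _ => ProbabilityTheory.gaussianReal 0 (1/2)) (i := i) (f := fun z : ℝ => z) gr_int1

theorem rowG_mom1 {N : ℕ} (i : Fin N) : ∫ h : Fin N → ℝ, h i ∂(rowG N) = 0 := by
  unfold rowG
  rw [integral_comp_eval (X := fun _ : Fin N => ℝ)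
    (μ := fun _ => ProbabilityTheory.gaussianReal 0 (1/2)) (i := i) (f := fun z : ℝ => z) gr_int1.aestronglyMeasurable]
  exact gr_mom1

theorem rowG_mom2 {N : ℕ} (i j : Fin N) : Integrable (fun h : Fin N → ℝ => h i * h j) (rowG N) ∧
    ∫ h : Fin N → ℝ, h i * h j ∂(rowG N) = if i = j then 1/2 else 0 := by
  have e : ∀ h : Fin N → ℝ, h i * h j =
      ∏ k, ((if k = i then h k else 1) * (if k = j then h k else 1)) := by
    intro h
    rw [Finset.prod_mul_distrib, Finset.prod_ite_eq', Finset.prod_ite_eq']; simp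
  let f : Fin N → ℝ → ℝ := fun k z => (if k = i then z else 1) * (if k = j then z else 1)
  have hfi : ∀ k, Integrable (f k) (ProbabilityTheory.gaussianReal 0 (1/2)) := by
    intro k
    by_cases h1 : k = i <;> by_cases h2 : k = j <;> simp only [f, h1, h2, if_true, if_false, one_mul, mul_one]
    · by_cases h3 : i = j <;> simp only [h3, if_true, if_false, mul_one]
      · exact gr_int2
      · exact gr_int1
    · by_cases h3 : i = j <;> simp only [h3, if_true, if_false, mul_one]
      · exact gr_int2
      · exact gr_int1
    · by_cases h3 : j = i <;> simp only [h3, if_true, if_false, one_mul]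
      · exact gr_int2
      · exact gr_int1
    · exact integrable_const _
  constructor
  · simp_rw [e]
    exact Integrable.fintype_prod (f := f) hfi
  · simp_rw [e]
    unfold rowG
    rw [integral_fintype_prod_eq_prod f]
    by_cases hij : i = j
    · subst hij
      rw [if_pos rfl, Finset.prod_eq_single i]
      · simp only [f, if_true]; exact gr_mom2
      · intro k _ hk; simp [f, hk]
      · simp
    · rw [if_neg hij]
      apply Finset.prod_eq_zero (Finset.mem_univ i)
      simp only [f, if_true, hij, if_false, mul_one]; exact gr_mom1

theorem rowG_dot1 {N : ℕ} (p : Fin N → ℝ) : Integrable (fun h : Fin N → ℝ => h ⬝ᵥ p) (rowG N) ∧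
    ∫ h : Fin N → ℝ, h ⬝ᵥ p ∂(rowG N) = 0 := by
  simp only [dotProduct]
  have hi : ∀ i, Integrable (fun h : Fin N → ℝ => h i * p i) (rowG N) := fun i => (rowG_int1 i).mul_const _
  refine ⟨integrable_finsetSum _ fun i _ => hi i, ?_⟩
  rw [integral_finsetSum _ fun i _ => hi i]
  simp [integral_mul_const, rowG_mom1]

theorem rowG_dot2 {N : ℕ} (p q : Fin N → ℝ) : Integrable (fun h : Fin N → ℝ => (h ⬝ᵥ p) * (h ⬝ᵥ q)) (rowG N) ∧
    ∫ h : Fin N → ℝ, (h ⬝ᵥ p) * (h ⬝ᵥ q) ∂(rowG N) = 1/2 * (p ⬝ᵥ q) := by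
  simp only [dotProduct, Finset.sum_mul_sum]
  have hi : ∀ i j, Integrable (fun h : Fin N → ℝ => h i * p i * (h j * q j)) (rowG N) := by
    intro i j
    convert (rowG_mom2 i j).1.mul_const (p i * q j) using 2
    ring
  have hi2 : ∀ i, Integrable (fun h : Fin N → ℝ => ∑ j, h i * p i * (h j * q j)) (rowG N) :=
    fun i => integrable_finsetSum _ fun j _ => hi i j
  refine ⟨integrable_finsetSum _ fun i _ => hi2 i, ?_⟩
  rw [integral_finsetSum _ fun i _ => hi2 i, Finset.mul_sum]
  refine Finset.sum_congr rfl fun i _ => ?_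
  rw [integral_finsetSum _ fun j _ => hi i j]
  have : ∀ j, ∫ h : Fin N → ℝ, h i * p i * (h j * q j) ∂(rowG N) = (if i = j then 1/2 else 0) * (p i * q j) := by
    intro j
    rw [← (rowG_mom2 i j).2, ← integral_mul_const]
    congr 1; funext h; ring
  simp only [this, ite_mul, zero_mul, Finset.sum_ite_eq, Finset.mem_univ, if_true]

theorem rowG_aff {N : ℕ} (p q : Fin N → ℝ) (α β : ℝ) :
    Integrable (fun h : Fin N → ℝ => (h ⬝ᵥ p + α) * (h ⬝ᵥ q + β)) (rowG N) ∧
    ∫ h : Fin N → ℝ, (h ⬝ᵥ p + α) * (h ⬝ᵥ q + β) ∂(rowG N) = 1/2 * (p ⬝ᵥ q) + α * β := by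
  have e : ∀ h : Fin N → ℝ, (h ⬝ᵥ p + α) * (h ⬝ᵥ q + β) =
     ((h ⬝ᵥ p) * (h ⬝ᵥ q) + (h ⬝ᵥ p) * β) + ((h ⬝ᵥ q) * α + α * β) := by intro h; ring
  simp_rw [e]
  have h1 := rowG_dot2 p q
  have h2 := (rowG_dot1 p).1.mul_const β
  have h3 := (rowG_dot1 q).1.mul_const α
  have h4 : Integrable (fun _ : Fin N → ℝ => α * β) (rowG N) := integrable_const _
  have h12 : Integrable (fun h : Fin N → ℝ => (h ⬝ᵥ p) * (h ⬝ᵥ q) + (h ⬝ᵥ p) * β) (rowG N) := h1.1.add h2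
  have h34 : Integrable (fun h : Fin N → ℝ => (h ⬝ᵥ q) * α + α * β) (rowG N) := h3.add h4
  refine ⟨h12.add h34, ?_⟩
  rw [integral_add h12 h34, integral_add h1.1 h2, integral_add h3 h4, h1.2,
    integral_mul_const, integral_mul_const, (rowG_dot1 p).2, (rowG_dot1 q).2]
  simp

/-- linear change of variables -/
theorem integral_lin {N : ℕ} (B : Matrix (Fin N) (Fin N) ℝ) (hB : B.det ≠ 0) (f : (Fin N → ℝ) → ℝ) :
    ∫ k, f (B *ᵥ k) = |B.det|⁻¹ * ∫ h, f h := by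
  have h1 := Real.map_matrix_volume_pi_eq_smul_volume_pi hB
  let e : (Fin N → ℝ) ≃L[ℝ] (Fin N → ℝ) :=
    (LinearEquiv.ofIsUnitDet (f := Matrix.toLin' B) (v := Pi.basisFun ℝ (Fin N)) (v' := Pi.basisFun ℝ (Fin N)) (by
      simpa [LinearMap.toMatrix_eq_toMatrix'] using hB)).toContinuousLinearEquiv
  have he : ∀ k, e k = B *ᵥ k := fun k => rfl
  have h2 : Measure.map e (volume : Measure (Fin N → ℝ)) = ENNReal.ofReal |(B.det)⁻¹| • volume := h1
  have h3 := integral_map_equiv (μ := (volume : Measure (Fin N → ℝ))) e.toHomeomorph.toMeasurableEquiv f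
  have h4 : Measure.map (e.toHomeomorph.toMeasurableEquiv) (volume : Measure (Fin N → ℝ)) = ENNReal.ofReal |(B.det)⁻¹| • volume := h1
  rw [h4, integral_smul_measure] at h3
  rw [ENNReal.toReal_ofReal (abs_nonneg _), abs_inv, smul_eq_mul] at h3
  rw [h3]; rfl

theorem integrable_lin {N : ℕ} (B : Matrix (Fin N) (Fin N) ℝ) (hB : B.det ≠ 0) (f : (Fin N → ℝ) → ℝ)
    (hf : Integrable f) : Integrable (fun k => f (B *ᵥ k)) := by
  have h1 := Real.map_matrix_volume_pi_eq_smul_volume_pi hB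
  let e : (Fin N → ℝ) ≃L[ℝ] (Fin N → ℝ) :=
    (LinearEquiv.ofIsUnitDet (f := Matrix.toLin' B) (v := Pi.basisFun ℝ (Fin N)) (v' := Pi.basisFun ℝ (Fin N)) (by
      simpa [LinearMap.toMatrix_eq_toMatrix'] using hB)).toContinuousLinearEquiv
  have h4 : Measure.map (e.toHomeomorph.toMeasurableEquiv) (volume : Measure (Fin N → ℝ)) = ENNReal.ofReal |(B.det)⁻¹| • volume := h1
  have h3 := integrable_map_equiv (μ := (volume : Measure (Fin N → ℝ))) e.toHomeomorph.toMeasurableEquiv f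
  rw [h4] at h3
  exact h3.1 (hf.smul_measure ENNReal.ofReal_ne_top)

theorem signdet {N : ℕ} (A : Matrix (Fin N) (Fin N) ℝ) :
    ∫ φ : Fin N → ℝ, A.det * Real.exp (-((A *ᵥ φ) ⬝ᵥ (A *ᵥ φ))) = √Real.pi ^ N * ((SignType.sign A.det : SignType) : ℝ) := by
  by_cases h : A.det = 0
  · simp [h]
  rw [integral_const_mul, integral_lin A h (fun v => Real.exp (-(v ⬝ᵥ v)))]
  have := integral_exp_neg_dot N 1
  simp only [one_mul, div_one] at this
  rw [this]
  have h2 : ((SignType.sign A.det : SignType) : ℝ) = A.det * |A.det|⁻¹ := by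
    rcases lt_or_gt_of_ne h with h1 | h1
    · rw [sign_neg h1, abs_of_neg h1]; simp; field_simp
    · rw [sign_pos h1, abs_of_pos h1]; simp; field_simp
  rw [h2]; ring

theorem signdet_int {N : ℕ} (A : Matrix (Fin N) (Fin N) ℝ) :
    Integrable (fun φ : Fin N → ℝ => A.det * Real.exp (-((A *ᵥ φ) ⬝ᵥ (A *ᵥ φ)))) := by
  by_cases h : A.det = 0
  · simp [h]
  apply Integrable.const_mul
  apply integrable_lin A h (fun v => Real.exp (-(v ⬝ᵥ v)))
  simpa using integrable_exp_neg_dot N one_pos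

theorem signdet_abs {N : ℕ} (A : Matrix (Fin N) (Fin N) ℝ) :
    ∫ φ : Fin N → ℝ, |A.det * Real.exp (-((A *ᵥ φ) ⬝ᵥ (A *ᵥ φ)))| ≤ √Real.pi ^ N := by
  by_cases h : A.det = 0
  · simp [h]
  simp only [abs_mul, Real.abs_exp]
  rw [integral_const_mul, integral_lin A h (fun v => Real.exp (-(v ⬝ᵥ v)))]
  have := integral_exp_neg_dot N 1
  simp only [one_mul, div_one] at this
  rw [this, ← mul_assoc, mul_inv_cancel₀ (by simpa using h), one_mul]

open scoped MatrixOrder Matrix.Norms.L2Operator in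
theorem posdef_factor {N : ℕ} {Q : Matrix (Fin N) (Fin N) ℝ} (hQ : Q.PosDef) :
    ∃ B : Matrix (Fin N) (Fin N) ℝ, Q = Bᵀ * B := by
  obtain ⟨B, hB⟩ := CStarAlgebra.nonneg_iff_eq_star_mul_self.mp hQ.posSemidef.nonneg
  exact ⟨B, by simpa [Matrix.star_eq_conjTranspose] using hB⟩

/-- Gaussian lemma, `Q = Bᵀ B` -/
theorem gauss_quad {N : ℕ} (Q : Matrix (Fin N) (Fin N) ℝ) (hQ : Q.PosDef)
    (b m : Fin N → ℝ) (hm : Q *ᵥ m = b) (c : ℝ) (j k : Fin N) (α β : ℝ) :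
    Integrable (fun h : Fin N → ℝ => Real.exp (-(h ⬝ᵥ (Q *ᵥ h)) + 2 * (h ⬝ᵥ b) - c) * ((h j + α) * (h k + β))) ∧
    ∫ h : Fin N → ℝ, Real.exp (-(h ⬝ᵥ (Q *ᵥ h)) + 2 * (h ⬝ᵥ b) - c) * ((h j + α) * (h k + β)) =
      √Real.pi ^ N * (√Q.det)⁻¹ * (Real.exp (-(c - m ⬝ᵥ b)) * (1/2 * Q⁻¹ j k + (m j + α) * (m k + β))) := by
  obtain ⟨B, hB⟩ : ∃ B : Matrix (Fin N) (Fin N) ℝ, Q = Bᵀ * B := by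
    exact posdef_factor hQ
  have hdet : Q.det = B.det ^ 2 := by rw [hB, Matrix.det_mul, Matrix.det_transpose, sq]
  have hB0 : B.det ≠ 0 := by
    intro h0
    have := hQ.det_pos
    rw [hdet, h0] at this; simp at this
  have hsym : Qᵀ = Q := by rw [hB]; simp
  have hBi : B⁻¹ * B = 1 := Matrix.nonsing_inv_mul _ (isUnit_iff_ne_zero.2 hB0)
  let f : (Fin N → ℝ) → ℝ := fun v => Real.exp (-(v ⬝ᵥ v)) * ((v ⬝ᵥ (B⁻¹ j) + (m j + α)) * (v ⬝ᵥ (B⁻¹ k) + (m k + β)))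
  have haff := rowG_aff (B⁻¹ j) (B⁻¹ k) (m j + α) (m k + β)
  have hfi : Integrable f := (integrable_rowG_iff N _).1 haff.1
  have hpt : ∀ h : Fin N → ℝ, Real.exp (-((h + m) ⬝ᵥ (Q *ᵥ (h + m))) + 2 * ((h + m) ⬝ᵥ b) - c) * (((h + m) j + α) * ((h + m) k + β))
      = Real.exp (-(c - m ⬝ᵥ b)) * f (B *ᵥ h) := by
    intro h
    have e1 : ∀ l, (B *ᵥ h) ⬝ᵥ (B⁻¹ l) = h l := by
      intro l
      rw [dotProduct_comm]
      change (B⁻¹ *ᵥ (B *ᵥ h)) l = h l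
      rw [Matrix.mulVec_mulVec, hBi, Matrix.one_mulVec]
    have e2 : (B *ᵥ h) ⬝ᵥ (B *ᵥ h) = h ⬝ᵥ (Q *ᵥ h) := by
      rw [hB, ← Matrix.mulVec_mulVec, Matrix.dotProduct_mulVec h, Matrix.vecMul_transpose]
    have e3 : m ⬝ᵥ (Q *ᵥ h) = h ⬝ᵥ b := by
      rw [← hm, Matrix.dotProduct_mulVec, ← Matrix.mulVec_transpose, hsym, dotProduct_comm]
    simp only [f, e1, e2]
    rw [← mul_assoc (Real.exp (-(c - m ⬝ᵥ b))), ← Real.exp_add]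
    congr 1
    · congr 1
      rw [Matrix.mulVec_add, add_dotProduct, dotProduct_add, dotProduct_add, hm, e3, add_dotProduct]
      ring
    · simp only [Pi.add_apply]; ring
  constructor
  · have h1 : Integrable (fun h => Real.exp (-(c - m ⬝ᵥ b)) * f (B *ᵥ h)) :=
      (integrable_lin B hB0 f hfi).const_mul _
    have h2 := h1.comp_sub_right m
    refine (integrable_congr (Filter.Eventually.of_forall fun h => ?_)).1 h2
    have := hpt (h - m)
    simp only [sub_add_cancel] at this
    exact this.symm
  · rw [← integral_add_right_eq_self _ m]
    simp_rw [hpt]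
    rw [integral_const_mul, integral_lin B hB0 f]
    have h3 := integral_rowG N (fun v => ((v ⬝ᵥ (B⁻¹ j) + (m j + α)) * (v ⬝ᵥ (B⁻¹ k) + (m k + β))))
    rw [haff.2] at h3
    have h4 : ∫ v, f v = √Real.pi ^ N * (1 / 2 * B⁻¹ j ⬝ᵥ B⁻¹ k + (m j + α) * (m k + β)) := by
      rw [h3, ← mul_assoc, inv_pow, mul_inv_cancel₀ (by positivity), one_mul]
    rw [h4, hdet, Real.sqrt_sq_eq_abs]
    have h5 : B⁻¹ j ⬝ᵥ B⁻¹ k = Q⁻¹ j k := by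
      rw [hB, Matrix.mul_inv_rev, Matrix.mul_apply, ← Matrix.transpose_nonsing_inv]
      rfl
    rw [h5]; ring

open MeasureTheory Matrix

theorem gauss_lin {N : ℕ} (Q : Matrix (Fin N) (Fin N) ℝ) (hQ : Q.PosDef)
    (b m : Fin N → ℝ) (hm : Q *ᵥ m = b) (c : ℝ) (j : Fin N) (α : ℝ) :
    Integrable (fun h : Fin N → ℝ => Real.exp (-(h ⬝ᵥ (Q *ᵥ h)) + 2 * (h ⬝ᵥ b) - c) * (h j + α)) ∧
    ∫ h : Fin N → ℝ, Real.exp (-(h ⬝ᵥ (Q *ᵥ h)) + 2 * (h ⬝ᵥ b) - c) * (h j + α) =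
      √Real.pi ^ N * (√Q.det)⁻¹ * (Real.exp (-(c - m ⬝ᵥ b)) * (m j + α)) := by
  have h1 := gauss_quad Q hQ b m hm c j j α 1
  have h0 := gauss_quad Q hQ b m hm c j j α 0
  have e : ∀ h : Fin N → ℝ, Real.exp (-(h ⬝ᵥ (Q *ᵥ h)) + 2 * (h ⬝ᵥ b) - c) * (h j + α) =
    Real.exp (-(h ⬝ᵥ (Q *ᵥ h)) + 2 * (h ⬝ᵥ b) - c) * ((h j + α) * (h j + 1))
    - Real.exp (-(h ⬝ᵥ (Q *ᵥ h)) + 2 * (h ⬝ᵥ b) - c) * ((h j + α) * (h j + 0)) := by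
    intro h; ring
  simp_rw [e]
  refine ⟨h1.1.sub h0.1, ?_⟩
  rw [integral_sub h1.1 h0.1, h1.2, h0.2]
  ring

theorem vmv_mulVec {N : ℕ} (p q h : Fin N → ℝ) : vecMulVec p q *ᵥ h = (q ⬝ᵥ h) • p := by
  ext i
  simp only [Matrix.mulVec, vecMulVec_apply, dotProduct, Pi.smul_apply, smul_eq_mul, Finset.sum_mul]
  exact Finset.sum_congr rfl fun k _ => by ring

theorem det_one_add_vmv {N : ℕ} (p q : Fin N → ℝ) :
    (1 + vecMulVec p q).det = 1 + q ⬝ᵥ p := by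
  rw [vecMulVec_eq Unit, Matrix.det_one_add_replicateCol_mul_replicateRow]

theorem vmv_psd {N : ℕ} (p : Fin N → ℝ) : (vecMulVec p p).PosSemidef := by
  have := Matrix.posSemidef_vecMulVec_self_star p
  simpa using this

theorem rowD {N : ℕ} (φ r : Fin N → ℝ) {σ : ℝ} (hσ : σ ≠ 0) (j : Fin N) :
    Integrable (fun d : Fin N → ℝ => Real.exp (-((σ • d + r) ⬝ᵥ φ) ^ 2) * (σ * d j + r j)) (rowG N) ∧
    ∫ d : Fin N → ℝ, Real.exp (-((σ • d + r) ⬝ᵥ φ) ^ 2) * (σ * d j + r j) ∂(rowG N) =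
      √((1 + σ^2 * (φ ⬝ᵥ φ))⁻¹) * Real.exp (-((1 + σ^2 * (φ ⬝ᵥ φ))⁻¹ * (r ⬝ᵥ φ) ^ 2)) *
        (r j - σ^2 * (1 + σ^2 * (φ ⬝ᵥ φ))⁻¹ * (r ⬝ᵥ φ) * φ j) := by
  set u := φ ⬝ᵥ φ with hu
  set c := r ⬝ᵥ φ with hc
  have hu0 : 0 ≤ u := by
    rw [hu]; exact Finset.sum_nonneg fun i _ => mul_self_nonneg _
  have hk : 0 < 1 + σ^2 * u := by positivity
  let Q : Matrix (Fin N) (Fin N) ℝ := 1 + vecMulVec (σ • φ) (σ • φ)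
  have hQ : Q.PosDef := Matrix.PosDef.one.add_posSemidef (vmv_psd _)
  have hdet : Q.det = 1 + σ^2 * u := by
    simp only [Q, det_one_add_vmv, smul_dotProduct, dotProduct_smul, smul_eq_mul, ← hu]; ring
  let b : Fin N → ℝ := (-(σ * c)) • φ
  let m : Fin N → ℝ := (-(σ * c) * (1 + σ^2 * u)⁻¹) • φ
  have hm : Q *ᵥ m = b := by
    simp only [Q, m, b, Matrix.add_mulVec, Matrix.one_mulVec, vmv_mulVec, smul_dotProduct, dotProduct_smul, ← hu, smul_smul, ← add_smul, smul_eq_mul]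
    congr 1
    field_simp
    ring
  have hg := gauss_lin Q hQ b m hm (c^2) j (r j / σ)
  have e : ∀ d : Fin N → ℝ, Real.exp (-(d ⬝ᵥ d)) * (Real.exp (-((σ • d + r) ⬝ᵥ φ) ^ 2) * (σ * d j + r j)) =
     σ * (Real.exp (-(d ⬝ᵥ (Q *ᵥ d)) + 2 * (d ⬝ᵥ b) - c^2) * (d j + r j / σ)) := by
    intro d
    rw [← mul_assoc, ← Real.exp_add]
    have : -(d ⬝ᵥ d) + -((σ • d + r) ⬝ᵥ φ) ^ 2 = -(d ⬝ᵥ (Q *ᵥ d)) + 2 * (d ⬝ᵥ b) - c^2 := by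
      simp only [Q, b, Matrix.add_mulVec, Matrix.one_mulVec, vmv_mulVec, add_dotProduct, smul_dotProduct, dotProduct_smul, dotProduct_add, ← hc, smul_eq_mul, dotProduct_comm φ d]
      ring
    rw [this]; field_simp
  constructor
  · rw [integrable_rowG_iff]
    simp_rw [e]
    exact hg.1.const_mul _
  · rw [integral_rowG]
    simp_rw [e]
    rw [integral_const_mul, hg.2, hdet, Real.sqrt_inv]
    have h5 : c^2 - m ⬝ᵥ b = (1 + σ^2 * u)⁻¹ * c^2 := by
      simp only [m, b, smul_dotProduct, dotProduct_smul, smul_eq_mul, ← hu]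
      field_simp
      ring
    rw [h5]
    simp only [m, Pi.smul_apply, smul_eq_mul]
    rw [inv_pow]
    have : √Real.pi ^ N ≠ 0 := by positivity
    field_simp
    ring

theorem det_rows {N : ℕ} (F : Fin N → (Fin N → ℝ) → Fin N → ℝ)
    (hF : ∀ i j, Integrable (fun h => F i h j) (rowG N)) :
    Integrable (fun D => (Matrix.of fun i j => F i (D i) j).det) (matG N) ∧
    ∫ D, (Matrix.of fun i j => F i (D i) j).det ∂(matG N) =
      (Matrix.of fun i j => ∫ h, F i h j ∂(rowG N)).det := by
  have e : ∀ A : Matrix (Fin N) (Fin N) ℝ, A.det = ∑ s : Equiv.Perm (Fin N), ((Equiv.Perm.sign s : ℤ) : ℝ) * ∏ i, A i (s i) := by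
    intro A; rw [← Matrix.det_transpose, Matrix.det_apply']; rfl
  simp_rw [e, Matrix.of_apply]
  have hi : ∀ s : Equiv.Perm (Fin N), Integrable (fun D : Fin N → Fin N → ℝ => ∏ i, F i (D i) (s i)) (matG N) := by
    intro s
    exact Integrable.fintype_prod (f := fun i h => F i h (s i)) (fun i => hF i (s i))
  refine ⟨integrable_finsetSum _ fun s _ => (hi s).const_mul _, ?_⟩
  rw [integral_finsetSum _ fun s _ => (hi s).const_mul _]
  refine Finset.sum_congr rfl fun s _ => ?_
  rw [integral_const_mul]
  congr 1
  exact integral_fintype_prod_eq_prod (fun i h => F i h (s i))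

/-- mixed discriminant -/
noncomputable def MD {N : ℕ} (T : Fin N → Matrix (Fin N) (Fin N) ℝ) : ℝ :=
  ∑ s : Equiv.Perm (Fin N), ∑ t : Equiv.Perm (Fin N),
    ((Equiv.Perm.sign s : ℤ) : ℝ) * ((Equiv.Perm.sign t : ℤ) : ℝ) * ∏ i, T i (s i) (t i)

theorem det_rows2 {N : ℕ} (F G : Fin N → (Fin N → ℝ) → Fin N → ℝ)
    (hF : ∀ i j k, Integrable (fun h => F i h j * G i h k) (rowG N)) :
    Integrable (fun D => (Matrix.of fun i j => F i (D i) j).det * (Matrix.of fun i j => G i (D i) j).det) (matG N) ∧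
    ∫ D, (Matrix.of fun i j => F i (D i) j).det * (Matrix.of fun i j => G i (D i) j).det ∂(matG N) =
      MD (fun i => Matrix.of fun j k => ∫ h, F i h j * G i h k ∂(rowG N)) := by
  have e : ∀ A : Matrix (Fin N) (Fin N) ℝ, A.det = ∑ s : Equiv.Perm (Fin N), ((Equiv.Perm.sign s : ℤ) : ℝ) * ∏ i, A i (s i) := by
    intro A; rw [← Matrix.det_transpose, Matrix.det_apply']; rfl
  have e2 : ∀ D : Fin N → Fin N → ℝ, (Matrix.of fun i j => F i (D i) j).det * (Matrix.of fun i j => G i (D i) j).det =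
     ∑ s : Equiv.Perm (Fin N), ∑ t : Equiv.Perm (Fin N),
    ((Equiv.Perm.sign s : ℤ) : ℝ) * ((Equiv.Perm.sign t : ℤ) : ℝ) * ∏ i, (F i (D i) (s i) * G i (D i) (t i)) := by
    intro D
    rw [e, e, Finset.sum_mul_sum]
    refine Finset.sum_congr rfl fun s _ => Finset.sum_congr rfl fun t _ => ?_
    rw [Finset.prod_mul_distrib]
    simp only [Matrix.of_apply]; ring
  simp_rw [e2]
  have hi : ∀ s t : Equiv.Perm (Fin N), Integrable (fun D : Fin N → Fin N → ℝ => ∏ i, (F i (D i) (s i) * G i (D i) (t i))) (matG N) := by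
    intro s t
    exact Integrable.fintype_prod (f := fun i h => F i h (s i) * G i h (t i)) (fun i => hF i (s i) (t i))
  have hi2 := fun s : Equiv.Perm (Fin N) => integrable_finsetSum Finset.univ fun (t : Equiv.Perm (Fin N)) _ => (hi s t).const_mul (((Equiv.Perm.sign s : ℤ) : ℝ) * ((Equiv.Perm.sign t : ℤ) : ℝ))
  refine ⟨integrable_finsetSum _ fun s _ => hi2 s, ?_⟩
  rw [integral_finsetSum _ fun s _ => hi2 s]
  refine Finset.sum_congr rfl fun s _ => ?_
  rw [integral_finsetSum _ fun t _ => (hi s t).const_mul _]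
  refine Finset.sum_congr rfl fun t _ => ?_
  rw [integral_const_mul]
  congr 1
  exact integral_fintype_prod_eq_prod (fun i h => F i h (s i) * G i h (t i))

theorem exp_neg_sum_sq {N : ℕ} (A : Matrix (Fin N) (Fin N) ℝ) (φ : Fin N → ℝ) :
    Real.exp (-((A *ᵥ φ) ⬝ᵥ (A *ᵥ φ))) = ∏ i, Real.exp (-(A i ⬝ᵥ φ) ^ 2) := by
  rw [← Real.exp_sum]
  congr 1
  rw [Finset.sum_neg_distrib]
  congr 1
  simp only [dotProduct, Matrix.mulVec, sq]

theorem ED {N : ℕ} (M : Matrix (Fin N) (Fin N) ℝ) (φ : Fin N → ℝ) {σ : ℝ} (hσ : σ ≠ 0) :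
    ∫ D, (M + σ • Matrix.of D).det * Real.exp (-(((M + σ • Matrix.of D) *ᵥ φ) ⬝ᵥ ((M + σ • Matrix.of D) *ᵥ φ))) ∂(matG N)
    = √((1 + σ^2 * (φ ⬝ᵥ φ))⁻¹) ^ N * (1 + σ^2 * (φ ⬝ᵥ φ))⁻¹ * (M.det * Real.exp (-((1 + σ^2 * (φ ⬝ᵥ φ))⁻¹ * ((M *ᵥ φ) ⬝ᵥ (M *ᵥ φ))))) := by
  have hr := det_rows (N := N) (fun i d j => Real.exp (-((σ • d + M i) ⬝ᵥ φ) ^ 2) * (σ * d j + M i j))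
    (fun i j => (rowD φ (M i) hσ j).1)
  have e : ∀ D : Fin N → Fin N → ℝ, (M + σ • Matrix.of D).det * Real.exp (-(((M + σ • Matrix.of D) *ᵥ φ) ⬝ᵥ ((M + σ • Matrix.of D) *ᵥ φ)))
      = (Matrix.of fun i j => Real.exp (-((σ • D i + M i) ⬝ᵥ φ) ^ 2) * (σ * D i j + M i j)).det := by
    intro D
    rw [exp_neg_sum_sq, mul_comm, ← Matrix.det_mul_column]
    congr 1
    ext i j
    simp only [Matrix.of_apply, Matrix.add_apply, Matrix.smul_apply, smul_eq_mul]
    congr 1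
    · rw [add_comm]; rfl
    · ring
  simp_rw [e]
  rw [hr.2]
  set u := φ ⬝ᵥ φ with hu
  have hu0 : 0 ≤ u := by
    rw [hu]; exact Finset.sum_nonneg fun i _ => mul_self_nonneg _
  have hk : 0 < 1 + σ^2 * u := by positivity
  set κ := (1 + σ^2 * u)⁻¹ with hκ
  have e2 : (Matrix.of fun i j => ∫ d : Fin N → ℝ, Real.exp (-((σ • d + M i) ⬝ᵥ φ) ^ 2) * (σ * d j + M i j) ∂(rowG N)) =
     Matrix.of fun i j => (√κ * Real.exp (-(κ * (M i ⬝ᵥ φ)^2))) * (M * (1 + vecMulVec ((-(σ^2*κ)) • φ) φ)) i j := by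
    ext i j
    simp only [Matrix.of_apply]
    rw [(rowD φ (M i) hσ j).2, ← hu, ← hκ]
    congr 1
    rw [Matrix.mul_add, Matrix.mul_one, Matrix.mul_vecMulVec, Matrix.add_apply, vecMulVec_apply, Matrix.mulVec_smul]
    simp only [Pi.smul_apply, smul_eq_mul]
    have : (M *ᵥ φ) i = M i ⬝ᵥ φ := rfl
    rw [this]; ring
  rw [e2, Matrix.det_mul_column, Matrix.det_mul, det_one_add_vmv, Finset.prod_mul_distrib, Finset.prod_const,
    ← Real.exp_sum]
  simp only [Finset.card_univ, Fintype.card_fin, Finset.sum_neg_distrib, ← Finset.mul_sum, dotProduct_smul, ← hu, smul_eq_mul]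
  have e3 : ∑ i, (M i ⬝ᵥ φ)^2 = (M *ᵥ φ) ⬝ᵥ (M *ᵥ φ) := by
    simp only [dotProduct, Matrix.mulVec, sq]
  have e4 : 1 + -(σ^2 * κ) * u = κ := by
    rw [hκ]; field_simp; ring
  rw [e3, e4]; ring

open MeasureTheory Matrix

noncomputable def CL {N : ℕ} (a b : Fin N → ℝ) : ℝ :=
  ∑ S ∈ (Finset.univ : Finset (Fin N)).powerset, ((S.card.factorial : ℕ) : ℝ) * ((∏ i ∈ S, a i) * ∏ i ∈ Finset.univ \ S, b i)

theorem int_pow_exp (n : ℕ) : IntegrableOn (fun s : ℝ => Real.exp (-s) * s ^ n) (Set.Ioi 0) ∧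
    ∫ s in Set.Ioi (0:ℝ), Real.exp (-s) * s ^ n = n.factorial := by
  have h1 := Real.GammaIntegral_convergent (s := (n:ℝ) + 1) (by positivity)
  have h2 := Real.Gamma_eq_integral (s := (n:ℝ) + 1) (by positivity)
  rw [Real.Gamma_nat_eq_factorial] at h2
  simp only [add_sub_cancel_right, Real.rpow_natCast] at h1 h2
  exact ⟨h1, h2.symm⟩

theorem CL_integral {N : ℕ} (a b : Fin N → ℝ) :
    IntegrableOn (fun s : ℝ => Real.exp (-s) * ∏ i, (s * a i + b i)) (Set.Ioi 0) ∧
    ∫ s in Set.Ioi (0:ℝ), Real.exp (-s) * ∏ i, (s * a i + b i) = CL a b := by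
  have e : ∀ s : ℝ, Real.exp (-s) * ∏ i, (s * a i + b i) =
    ∑ S ∈ (Finset.univ : Finset (Fin N)).powerset, (Real.exp (-s) * s ^ S.card) * ((∏ i ∈ S, a i) * ∏ i ∈ Finset.univ \ S, b i) := by
    intro s
    rw [Finset.prod_add, Finset.mul_sum]
    refine Finset.sum_congr rfl fun S _ => ?_
    rw [Finset.prod_mul_distrib, Finset.prod_const]; ring
  simp_rw [e]
  have hi : ∀ S : Finset (Fin N), IntegrableOn (fun s : ℝ => (Real.exp (-s) * s ^ S.card) * ((∏ i ∈ S, a i) * ∏ i ∈ Finset.univ \ S, b i)) (Set.Ioi 0) :=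
    fun S => (int_pow_exp _).1.mul_const _
  refine ⟨integrable_finsetSum _ fun S _ => hi S, ?_⟩
  rw [integral_finsetSum _ fun S _ => hi S]
  refine Finset.sum_congr rfl fun S _ => ?_
  rw [integral_mul_const, (int_pow_exp _).2]

theorem card_fix {N : ℕ} (S : Finset (Fin N)) :
    ∑ t : Equiv.Perm (Fin N), ∏ i ∈ Finset.univ \ S, (if t i = i then (1:ℝ) else 0) = ((S.card.factorial : ℕ) : ℝ) := by
  have e : ∀ t : Equiv.Perm (Fin N), ∏ i ∈ Finset.univ \ S, (if t i = i then (1:ℝ) else 0) = if (∀ i, ¬ (i ∈ S) → t i = i) then 1 else 0 := by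
    intro t
    rw [Finset.prod_ite_zero]
    simp
  simp_rw [e]
  rw [Finset.sum_boole]
  congr 1
  have h1 := Fintype.card_congr (Equiv.Perm.subtypeEquivSubtypePerm (fun i => i ∈ S))
  rw [Fintype.card_perm, Fintype.card_coe, Fintype.card_subtype] at h1
  exact h1.symm

theorem CL_count {N : ℕ} (a b : Fin N → ℝ) :
    ∑ t : Equiv.Perm (Fin N), ∏ i, (a i + b i * (if t i = i then (1:ℝ) else 0)) = CL a b := by
  simp_rw [Finset.prod_add, Finset.prod_mul_distrib]
  rw [Finset.sum_comm]
  refine Finset.sum_congr rfl fun S _ => ?_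
  rw [← card_fix S, Finset.sum_mul]
  refine Finset.sum_congr rfl fun t _ => ?_
  ring

theorem det_leib {N : ℕ} (A : Matrix (Fin N) (Fin N) ℝ) : A.det = ∑ s : Equiv.Perm (Fin N), ((Equiv.Perm.sign s : ℤ) : ℝ) * ∏ i, A (s i) i :=
  Matrix.det_apply' A

theorem int_det {N : ℕ} (K A : Matrix (Fin N) (Fin N) ℝ) :
    ∫ s in Set.Ioi (0:ℝ), Real.exp (-s) * (s • K + A).det =
      ∑ p : Equiv.Perm (Fin N), ((Equiv.Perm.sign p : ℤ) : ℝ) * CL (fun i => K (p i) i) (fun i => A (p i) i) := by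
  have e : ∀ s : ℝ, Real.exp (-s) * (s • K + A).det = ∑ p : Equiv.Perm (Fin N), ((Equiv.Perm.sign p : ℤ) : ℝ) * (Real.exp (-s) * ∏ i, (s * K (p i) i + A (p i) i)) := by
    intro s
    rw [det_leib, Finset.mul_sum]
    refine Finset.sum_congr rfl fun p _ => ?_
    simp only [Matrix.add_apply, Matrix.smul_apply, smul_eq_mul]; ring
  simp_rw [e]
  rw [integral_finsetSum _ fun p _ => (CL_integral (fun i => K (p i) i) (fun i => A (p i) i)).1.const_mul _]
  refine Finset.sum_congr rfl fun p _ => ?_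
  rw [integral_const_mul, (CL_integral (fun i => K (p i) i) (fun i => A (p i) i)).2]

theorem MD_eq {N : ℕ} (T : Fin N → Matrix (Fin N) (Fin N) ℝ) :
    MD T = ∑ t : Equiv.Perm (Fin N), ((Equiv.Perm.sign t : ℤ) : ℝ) * (Matrix.of fun j i => T i j (t i)).det := by
  unfold MD
  rw [Finset.sum_comm]
  refine Finset.sum_congr rfl fun t _ => ?_
  rw [det_leib, Finset.mul_sum]
  refine Finset.sum_congr rfl fun s _ => ?_
  simp only [Matrix.of_apply]; ring

theorem MD_transpose {N : ℕ} (T : Fin N → Matrix (Fin N) (Fin N) ℝ) : MD (fun i => (T i)ᵀ) = MD T := by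
  unfold MD
  rw [Finset.sum_comm]
  refine Finset.sum_congr rfl fun t _ => Finset.sum_congr rfl fun s _ => ?_
  simp only [Matrix.transpose_apply]; ring

theorem MD_left {N : ℕ} (C : Matrix (Fin N) (Fin N) ℝ) (T : Fin N → Matrix (Fin N) (Fin N) ℝ) :
    MD (fun i => C * T i) = C.det * MD T := by
  rw [MD_eq, MD_eq, Finset.mul_sum]
  refine Finset.sum_congr rfl fun t _ => ?_
  have : (Matrix.of fun j i => (C * T i) j (t i)) = C * (Matrix.of fun j i => T i j (t i)) := by
    ext j i
    simp [Matrix.mul_apply]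
  rw [this, Matrix.det_mul]; ring

theorem MD_right {N : ℕ} (C : Matrix (Fin N) (Fin N) ℝ) (T : Fin N → Matrix (Fin N) (Fin N) ℝ) :
    MD (fun i => T i * C) = C.det * MD T := by
  rw [← MD_transpose]
  simp only [Matrix.transpose_mul]
  rw [MD_left, MD_transpose, Matrix.det_transpose]

theorem MD_scale {N : ℕ} (c : Fin N → ℝ) (T : Fin N → Matrix (Fin N) (Fin N) ℝ) :
    MD (fun i => c i • T i) = (∏ i, c i) * MD T := by
  unfold MD
  simp only [Finset.mul_sum]
  refine Finset.sum_congr rfl fun t _ => Finset.sum_congr rfl fun s _ => ?_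
  simp only [Matrix.smul_apply, smul_eq_mul, Finset.prod_mul_distrib]; ring

theorem MD_one {N : ℕ} (W : Matrix (Fin N) (Fin N) ℝ) :
    MD (fun i => 1 + vecMulVec (fun j => W j i) (Pi.single i 1)) = ∫ s in Set.Ioi (0:ℝ), Real.exp (-s) * (s • (1 : Matrix (Fin N) (Fin N) ℝ) + W).det := by
  rw [int_det, MD_eq]
  have e : ∀ t : Equiv.Perm (Fin N), ((Equiv.Perm.sign t : ℤ) : ℝ) * (Matrix.of fun j i => (1 + vecMulVec (fun j => W j i) (Pi.single i 1)) j (t i)).det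
      = ∑ p : Equiv.Perm (Fin N), ((Equiv.Perm.sign p : ℤ) : ℝ) * ∏ i, ((1 : Matrix (Fin N) (Fin N) ℝ) (p i) i + W (p i) i * (if t i = i then (1:ℝ) else 0)) := by
    intro t
    have h1 : (Matrix.of fun j i => ((1 : Matrix (Fin N) (Fin N) ℝ) + vecMulVec (fun j => W j i) (Pi.single i 1)) j (t i))
      = (Matrix.of fun j i => (1 : Matrix (Fin N) (Fin N) ℝ) j i + W j i * (if t i = i then (1:ℝ) else 0)).submatrix id t := by
      ext j i
      simp only [Matrix.of_apply, Matrix.add_apply, vecMulVec_apply, Matrix.submatrix_apply, id]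
      by_cases h : t i = i
      · rw [h, if_pos h]; simp
      · have : t (t i) ≠ t i := fun h' => h (t.injective h')
        simp [h, this, Pi.single_apply]
    rw [h1, Matrix.det_permute', ← mul_assoc, det_leib]
    have h2 : ((Equiv.Perm.sign t : ℤ) : ℝ) * ((Equiv.Perm.sign t : ℤ) : ℝ) = 1 := by
      rcases Int.units_eq_one_or (Equiv.Perm.sign t) with h | h <;> simp [h]
    rw [h2, one_mul]
    rfl
  simp_rw [e]
  rw [Finset.sum_comm]
  refine Finset.sum_congr rfl fun p _ => ?_
  rw [← Finset.mul_sum, CL_count (fun i => (1 : Matrix (Fin N) (Fin N) ℝ) (p i) i) (fun i => W (p i) i)]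

theorem MD_inv {N : ℕ} (K P R : Matrix (Fin N) (Fin N) ℝ) (hK : K.det ≠ 0) (hR : R.det ≠ 0) :
    MD (fun i => K + vecMulVec (fun j => P j i) (R i)) = ∫ s in Set.Ioi (0:ℝ), Real.exp (-s) * (s • K + P * R).det := by
  have hK1 : K⁻¹ * K = 1 := Matrix.nonsing_inv_mul _ (isUnit_iff_ne_zero.2 hK)
  have hK2 : K * K⁻¹ = 1 := Matrix.mul_nonsing_inv _ (isUnit_iff_ne_zero.2 hK)
  have hR1 : R * R⁻¹ = 1 := Matrix.mul_nonsing_inv _ (isUnit_iff_ne_zero.2 hR)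
  have hR2 : R⁻¹ * R = 1 := Matrix.nonsing_inv_mul _ (isUnit_iff_ne_zero.2 hR)
  have hdK : K⁻¹.det * K.det = 1 := by rw [← Matrix.det_mul, hK1, Matrix.det_one]
  have hdR : R⁻¹.det * R.det = 1 := by rw [← Matrix.det_mul, hR2, Matrix.det_one]
  have h1 := MD_one (R * K⁻¹ * P)
  have h2 : (fun i => (1 : Matrix (Fin N) (Fin N) ℝ) + vecMulVec (fun j => (R * K⁻¹ * P) j i) (Pi.single i 1))
     = fun i => (R * K⁻¹) * (K + vecMulVec (fun j => P j i) (R i)) * R⁻¹ := by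
    funext i
    have e1 : (fun j => (R * K⁻¹ * P) j i) = (R * K⁻¹) *ᵥ (fun j => P j i) := by
      ext j; rfl
    have e2 : (Pi.single i 1 : Fin N → ℝ) = (R i) ᵥ* R⁻¹ := by
      ext k
      have := congrFun (congrFun hR1 i) k
      rw [Matrix.one_apply] at this
      rw [Pi.single_apply]
      simp only [eq_comm (a := k)]
      rw [← this]; rfl
    rw [e1, e2, Matrix.mul_add, Matrix.add_mul, Matrix.mul_vecMulVec, Matrix.vecMulVec_mul, Matrix.mul_assoc R, hK1, Matrix.mul_one, hR1]
  rw [h2] at h1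
  rw [MD_right R⁻¹ (fun i => (R * K⁻¹) * (K + vecMulVec (fun j => P j i) (R i))), MD_left, Matrix.det_mul] at h1
  have h3 : MD (fun i => K + vecMulVec (fun j => P j i) (R i)) = K.det * ∫ s in Set.Ioi (0:ℝ), Real.exp (-s) * (s • (1 : Matrix (Fin N) (Fin N) ℝ) + R * K⁻¹ * P).det := by
    rw [← h1]
    linear_combination (-(MD fun i => K + vecMulVec (fun j => P j i) (R i))) * (K⁻¹.det * K.det) * hdR - (MD fun i => K + vecMulVec (fun j => P j i) (R i)) * hdK
  rw [h3, ← integral_const_mul]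
  congr 1; funext s
  have h4 : s • K + P * R = K * (R⁻¹ * ((s • (1 : Matrix (Fin N) (Fin N) ℝ) + R * K⁻¹ * P) * R)) := by
    rw [Matrix.add_mul, Matrix.mul_add, Matrix.mul_add]
    congr 1
    · rw [Matrix.smul_mul, Matrix.one_mul, Matrix.mul_smul, hR2, Matrix.mul_smul, Matrix.mul_one]
    · simp only [← Matrix.mul_assoc]
      rw [Matrix.mul_assoc K, hR2, Matrix.mul_one, hK2, Matrix.one_mul]
  rw [h4, Matrix.det_mul, Matrix.det_mul, Matrix.det_mul]
  linear_combination (-Real.exp (-s) * K.det * (s • (1 : Matrix (Fin N) (Fin N) ℝ) + R * K⁻¹ * P).det) * hdR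

theorem MD_main {N : ℕ} (K P R : Matrix (Fin N) (Fin N) ℝ) (hK : K.det ≠ 0) :
    MD (fun i => K + vecMulVec (fun j => P j i) (R i)) = ∫ s in Set.Ioi (0:ℝ), Real.exp (-s) * (s • K + P * R).det := by
  let Re : ℝ → Matrix (Fin N) (Fin N) ℝ := fun ε => R + ε • 1
  let f : ℝ → ℝ := fun ε => MD (fun i => K + vecMulVec (fun j => P j i) (Re ε i))
  let g : ℝ → ℝ := fun ε => ∑ p : Equiv.Perm (Fin N), ((Equiv.Perm.sign p : ℤ) : ℝ) * CL (fun i => K (p i) i) (fun i => (P * Re ε) (p i) i)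
  have hRe : ∀ i j, Continuous (fun ε => Re ε i j) := by
    intro i j
    simp only [Re, Matrix.add_apply, Matrix.smul_apply, smul_eq_mul]; fun_prop
  have hf : Continuous f := by
    simp only [f, MD, Matrix.add_apply, vecMulVec_apply]
    fun_prop
  have hg : Continuous g := by
    simp only [g, CL, Matrix.mul_apply]
    fun_prop
  have hdense : Dense {ε : ℝ | (Re ε).det ≠ 0} := by
    have hfin : {ε : ℝ | (Re ε).det = 0}.Finite := by
      refine Set.Finite.subset (Polynomial.rootSet_finite (-R).charpoly ℝ) ?_
      intro l hl
      rw [Polynomial.mem_rootSet]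
      refine ⟨(-R).charpoly_monic.ne_zero, ?_⟩
      rw [Polynomial.coe_aeval_eq_eval, Matrix.eval_charpoly]
      have : Matrix.scalar (Fin N) l - -R = Re l := by
        simp only [Re, sub_neg_eq_add]
        rw [add_comm, Matrix.smul_one_eq_diagonal]; rfl
      rw [this]; exact hl
    have := hfin.countable.dense_compl ℝ
    simpa [Set.compl_def] using this
  have hfg : f = g := by
    apply hf.ext_on hdense hg
    intro ε hε
    show f ε = g ε
    simp only [f, g]
    rw [MD_inv K P (Re ε) hK hε, int_det]
  have := congrFun hfg 0
  simp only [f, g, Re, zero_smul, add_zero] at this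
  rw [this, int_det]

open MeasureTheory Matrix

noncomputable def LL (c : ℝ) (j : ℕ) : ℝ := ∫ s in Set.Ioi (0:ℝ), Real.exp (-s) * (s / 2 + c) ^ j

noncomputable def ell (c : ℝ) (j : ℕ) : ℝ := ∑ m ∈ Finset.range (j + 1), (2 * c) ^ m / (m.factorial : ℝ)

theorem LL_eq (c : ℝ) (j : ℕ) : IntegrableOn (fun s : ℝ => Real.exp (-s) * (s / 2 + c) ^ j) (Set.Ioi 0) ∧
    LL c j = (j.factorial : ℝ) / 2 ^ j * ell c j := by
  have e : ∀ s : ℝ, Real.exp (-s) * (s / 2 + c) ^ j = ∑ m ∈ Finset.range (j + 1),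
      (Real.exp (-s) * s ^ (j - m)) * (c ^ m * (1/2) ^ (j - m) * (j.choose m : ℝ)) := by
    intro s
    rw [add_comm, add_pow, Finset.mul_sum]
    refine Finset.sum_congr rfl fun m _ => ?_
    rw [div_pow, one_div, inv_pow]; ring
  unfold LL
  simp_rw [e]
  have hi : ∀ m, IntegrableOn (fun s : ℝ => (Real.exp (-s) * s ^ (j - m)) * (c ^ m * (1/2) ^ (j - m) * (j.choose m : ℝ))) (Set.Ioi 0) :=
    fun m => (int_pow_exp _).1.mul_const _
  refine ⟨integrable_finsetSum _ fun m _ => hi m, ?_⟩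
  rw [integral_finsetSum _ fun m _ => hi m, ell, Finset.mul_sum]
  refine Finset.sum_congr rfl fun m hm => ?_
  have hm' : m ≤ j := by simpa [Nat.lt_succ_iff] using hm
  rw [integral_mul_const, (int_pow_exp _).2]
  have h1 : ((j.choose m : ℕ) : ℝ) * (m.factorial : ℝ) * ((j - m).factorial : ℝ) = (j.factorial : ℝ) := by
    exact_mod_cast Nat.choose_mul_factorial_mul_factorial hm'
  have h2 : (2:ℝ) ^ j = 2 ^ m * 2 ^ (j - m) := by rw [← pow_add]; congr 1; omega
  rw [← h1, h2, mul_pow, one_div, inv_pow]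
  have : (m.factorial : ℝ) ≠ 0 := by positivity
  field_simp

theorem det_rank2_one {N : ℕ} (p q a b : Fin N → ℝ) :
    (1 + vecMulVec p a + vecMulVec q b).det = (1 + a ⬝ᵥ p) * (1 + b ⬝ᵥ q) - (a ⬝ᵥ q) * (b ⬝ᵥ p) := by
  let U : Matrix (Fin N) (Fin 2) ℝ := Matrix.of fun i => ![p i, q i]
  let V : Matrix (Fin 2) (Fin N) ℝ := Matrix.of ![a, b]
  have h : (1 : Matrix (Fin N) (Fin N) ℝ) + vecMulVec p a + vecMulVec q b = 1 + U * V := by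
    ext i j
    simp [U, V, Matrix.mul_apply, Fin.sum_univ_two, vecMulVec_apply, add_assoc]
  have e00 : (V * U) 0 0 = a ⬝ᵥ p := rfl
  have e01 : (V * U) 0 1 = a ⬝ᵥ q := rfl
  have e10 : (V * U) 1 0 = b ⬝ᵥ p := rfl
  have e11 : (V * U) 1 1 = b ⬝ᵥ q := rfl
  rw [h, Matrix.det_one_add_mul_comm, Matrix.det_fin_two]
  simp only [Matrix.add_apply, e00, e01, e10, e11]
  simp

theorem det_rank2 {k : ℕ} (p q a b : Fin (k+2) → ℝ) (l : ℝ) :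
    (l • 1 + vecMulVec p a + vecMulVec q b).det = l ^ k * ((l + a ⬝ᵥ p) * (l + b ⬝ᵥ q) - (a ⬝ᵥ q) * (b ⬝ᵥ p)) := by
  have hf : Continuous fun l : ℝ => (l • (1 : Matrix (Fin (k+2)) (Fin (k+2)) ℝ) + vecMulVec p a + vecMulVec q b).det := by
    fun_prop
  have hg : Continuous fun l : ℝ => l ^ k * ((l + a ⬝ᵥ p) * (l + b ⬝ᵥ q) - (a ⬝ᵥ q) * (b ⬝ᵥ p)) := by
    fun_prop
  have := hf.ext_on (dense_compl_singleton (0:ℝ)) hg (by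
    intro l hl
    have hl : l ≠ 0 := hl
    have h : l • (1 : Matrix (Fin (k+2)) (Fin (k+2)) ℝ) + vecMulVec p a + vecMulVec q b
      = l • (1 + vecMulVec p (l⁻¹ • a) + vecMulVec q (l⁻¹ • b)) := by
      ext i j
      simp only [Matrix.add_apply, Matrix.smul_apply, vecMulVec_apply, Pi.smul_apply, smul_eq_mul]
      field_simp
    show (l • (1 : Matrix (Fin (k+2)) (Fin (k+2)) ℝ) + vecMulVec p a + vecMulVec q b).det = _
    rw [h, Matrix.det_smul, det_rank2_one]
    simp only [smul_dotProduct, smul_eq_mul, Fintype.card_fin]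
    field_simp
    ring)
  exact congrFun this l

theorem dot_self_nonneg' {N : ℕ} (φ : Fin N → ℝ) : 0 ≤ φ ⬝ᵥ φ :=
  Finset.sum_nonneg fun i _ => mul_self_nonneg _

theorem dot_cs {N : ℕ} (φ ψ : Fin N → ℝ) : (φ ⬝ᵥ ψ) ^ 2 ≤ (φ ⬝ᵥ φ) * (ψ ⬝ᵥ ψ) := by
  have := Finset.sum_mul_sq_le_sq_mul_sq Finset.univ φ ψ
  simpa [dotProduct, sq] using this

noncomputable def Del (u v w : ℝ) : ℝ := (1 + u) * (1 + v) - w ^ 2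

noncomputable def EE (x y u v w : ℝ) : ℝ := (x^2 * u * (1 + v) + y^2 * v * (1 + u) - 2 * x * y * w^2) / Del u v w

theorem Del_pos {u v w : ℝ} (hu : 0 ≤ u) (hv : 0 ≤ v) (hw : w ^ 2 ≤ u * v) : 0 < Del u v w := by
  unfold Del; nlinarith

theorem rowH {N : ℕ} (φ ψ : Fin N → ℝ) (x y : ℝ) (i j k : Fin N) :
    Integrable (fun h : Fin N → ℝ => (Real.exp (-((h - x • Pi.single i 1) ⬝ᵥ φ) ^ 2) * (h - x • (Pi.single i 1 : Fin N → ℝ)) j)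
      * (Real.exp (-((h - y • Pi.single i 1) ⬝ᵥ ψ) ^ 2) * (h - y • (Pi.single i 1 : Fin N → ℝ)) k)) (rowG N) ∧
    ∫ h : Fin N → ℝ, (Real.exp (-((h - x • Pi.single i 1) ⬝ᵥ φ) ^ 2) * (h - x • (Pi.single i 1 : Fin N → ℝ)) j)
      * (Real.exp (-((h - y • Pi.single i 1) ⬝ᵥ ψ) ^ 2) * (h - y • (Pi.single i 1 : Fin N → ℝ)) k) ∂(rowG N) =
      ((√(Del (φ ⬝ᵥ φ) (ψ ⬝ᵥ ψ) (φ ⬝ᵥ ψ)))⁻¹ * Real.exp (-((x^2 * (φ i)^2 * (1 + ψ ⬝ᵥ ψ) + y^2 * (ψ i)^2 * (1 + φ ⬝ᵥ φ) - 2 * x * y * (φ i * ψ i) * (φ ⬝ᵥ ψ)) / Del (φ ⬝ᵥ φ) (ψ ⬝ᵥ ψ) (φ ⬝ᵥ ψ)))) *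
       (1/2 * (1 + vecMulVec φ φ + vecMulVec ψ ψ)⁻¹ j k + ((1 + vecMulVec φ φ + vecMulVec ψ ψ)⁻¹ * (x • 1 + (x - y) • vecMulVec ψ ψ)) j i * ((y • 1 - (x - y) • vecMulVec φ φ) * (1 + vecMulVec φ φ + vecMulVec ψ ψ)⁻¹) i k) := by
  set u := φ ⬝ᵥ φ with hu
  set v := ψ ⬝ᵥ ψ with hv
  set w := φ ⬝ᵥ ψ with hw
  have hw' : ψ ⬝ᵥ φ = w := dotProduct_comm _ _
  have hD : 0 < Del u v w := Del_pos (dot_self_nonneg' φ) (dot_self_nonneg' ψ) (dot_cs φ ψ)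
  set Q : Matrix (Fin N) (Fin N) ℝ := 1 + vecMulVec φ φ + vecMulVec ψ ψ with hQdef
  have hQ : Q.PosDef := (Matrix.PosDef.one.add_posSemidef (vmv_psd _)).add_posSemidef (vmv_psd _)
  have hdet : Q.det = Del u v w := by
    rw [hQdef, det_rank2_one, hw', ← hu, ← hv, ← hw, Del]; ring
  have hQ1 : Q⁻¹ * Q = 1 := Matrix.nonsing_inv_mul _ (isUnit_iff_ne_zero.2 (by rw [hdet]; exact hD.ne'))
  have hsym : Qᵀ = Q := by
    rw [hQdef]; ext a b
    simp only [Matrix.transpose_apply, Matrix.add_apply, vecMulVec_apply, Matrix.one_apply, eq_comm (a := a)]; ring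
  have hsymi : (Q⁻¹)ᵀ = Q⁻¹ := by rw [Matrix.transpose_nonsing_inv, hsym]
  have hQv : ∀ h : Fin N → ℝ, Q *ᵥ h = h + (φ ⬝ᵥ h) • φ + (ψ ⬝ᵥ h) • ψ := by
    intro h
    rw [hQdef, Matrix.add_mulVec, Matrix.add_mulVec, Matrix.one_mulVec, vmv_mulVec, vmv_mulVec]
  let b : Fin N → ℝ := (x * φ i) • φ + (y * ψ i) • ψ
  let m : Fin N → ℝ := (x * φ i / Del u v w) • ((1 + v) • φ - w • ψ) + (y * ψ i / Del u v w) • ((1 + u) • ψ - w • φ)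
  have hm : Q *ᵥ m = b := by
    rw [hQv]
    simp only [m, b, dotProduct_add, dotProduct_smul, dotProduct_sub, smul_eq_mul, ← hu, ← hv, ← hw, hw']
    ext l
    simp only [Pi.add_apply, Pi.smul_apply, Pi.sub_apply, smul_eq_mul]
    field_simp
    unfold Del
    ring
  have hmi : m = Q⁻¹ *ᵥ b := by
    rw [← hm, Matrix.mulVec_mulVec, hQ1, Matrix.one_mulVec]
  have hg := gauss_quad Q hQ b m hm (x^2 * (φ i)^2 + y^2 * (ψ i)^2) j k (-(x * (Pi.single i 1 : Fin N → ℝ) j)) (-(y * (Pi.single i 1 : Fin N → ℝ) k))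
  have hE : x^2 * (φ i)^2 + y^2 * (ψ i)^2 - m ⬝ᵥ b = (x^2 * (φ i)^2 * (1 + v) + y^2 * (ψ i)^2 * (1 + u) - 2 * x * y * (φ i * ψ i) * w) / Del u v w := by
    simp only [m, b, dotProduct_add, add_dotProduct, sub_dotProduct, smul_dotProduct, dotProduct_smul, dotProduct_sub, smul_eq_mul, ← hu, ← hv, ← hw, hw']
    rw [eq_div_iff hD.ne']
    field_simp
    unfold Del
    ring
  have e : ∀ h : Fin N → ℝ, Real.exp (-(h ⬝ᵥ h)) * ((Real.exp (-((h - x • Pi.single i 1) ⬝ᵥ φ) ^ 2) * (h - x • (Pi.single i 1 : Fin N → ℝ)) j)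
      * (Real.exp (-((h - y • Pi.single i 1) ⬝ᵥ ψ) ^ 2) * (h - y • (Pi.single i 1 : Fin N → ℝ)) k)) =
     Real.exp (-(h ⬝ᵥ (Q *ᵥ h)) + 2 * (h ⬝ᵥ b) - (x^2 * (φ i)^2 + y^2 * (ψ i)^2)) * ((h j + -(x * (Pi.single i 1 : Fin N → ℝ) j)) * (h k + -(y * (Pi.single i 1 : Fin N → ℝ) k))) := by
    intro h
    have h1 : -(h ⬝ᵥ (Q *ᵥ h)) + 2 * (h ⬝ᵥ b) - (x^2 * (φ i)^2 + y^2 * (ψ i)^2) =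
      -(h ⬝ᵥ h) + (-((h - x • Pi.single i 1) ⬝ᵥ φ) ^ 2 + -((h - y • Pi.single i 1) ⬝ᵥ ψ) ^ 2) := by
      rw [hQv]
      simp only [b, dotProduct_add, dotProduct_smul, sub_dotProduct, smul_dotProduct, single_one_dotProduct, smul_eq_mul, dotProduct_comm φ h, dotProduct_comm ψ h]
      ring
    rw [h1, Real.exp_add, Real.exp_add]
    simp only [Pi.sub_apply, Pi.smul_apply, smul_eq_mul]
    ring
  have hP : m j + -(x * (Pi.single i 1 : Fin N → ℝ) j) = -(Q⁻¹ * (x • 1 + (x - y) • vecMulVec ψ ψ)) j i := by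
    have h1 : m - x • Pi.single i 1 = -((Q⁻¹ * (x • 1 + (x - y) • vecMulVec ψ ψ)) *ᵥ Pi.single i 1) := by
      have h2 : (Pi.single i 1 : Fin N → ℝ) = Q⁻¹ *ᵥ (Q *ᵥ Pi.single i 1) := by
        rw [Matrix.mulVec_mulVec, hQ1, Matrix.one_mulVec]
      rw [← Matrix.mulVec_mulVec, hmi]
      nth_rewrite 1 [h2]
      rw [← Matrix.mulVec_smul, ← Matrix.mulVec_sub, ← Matrix.mulVec_neg]
      congr 1
      rw [hQv, Matrix.add_mulVec, Matrix.smul_mulVec, Matrix.smul_mulVec, vmv_mulVec, Matrix.one_mulVec]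
      simp only [b, dotProduct_single_one]
      ext l
      simp only [Pi.add_apply, Pi.smul_apply, Pi.sub_apply, Pi.neg_apply, smul_eq_mul]
      ring
    have := congrFun h1 j
    rw [Matrix.mulVec_single_one] at this
    simpa [sub_eq_add_neg] using this
  have hR : m k + -(y * (Pi.single i 1 : Fin N → ℝ) k) = -((y • 1 - (x - y) • vecMulVec φ φ) * Q⁻¹) i k := by
    have h1 : m - y • Pi.single i 1 = -((Q⁻¹ * (y • 1 - (x - y) • vecMulVec φ φ)) *ᵥ Pi.single i 1) := by
      have h2 : (Pi.single i 1 : Fin N → ℝ) = Q⁻¹ *ᵥ (Q *ᵥ Pi.single i 1) := by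
        rw [Matrix.mulVec_mulVec, hQ1, Matrix.one_mulVec]
      rw [← Matrix.mulVec_mulVec, hmi]
      nth_rewrite 1 [h2]
      rw [← Matrix.mulVec_smul, ← Matrix.mulVec_sub, ← Matrix.mulVec_neg]
      congr 1
      rw [hQv, Matrix.sub_mulVec, Matrix.smul_mulVec, Matrix.smul_mulVec, vmv_mulVec, Matrix.one_mulVec]
      simp only [b, dotProduct_single_one]
      ext l
      simp only [Pi.add_apply, Pi.smul_apply, Pi.sub_apply, Pi.neg_apply, smul_eq_mul]
      ring
    have := congrFun h1 k
    rw [Matrix.mulVec_single_one] at this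
    have h3 : (y • 1 - (x - y) • vecMulVec φ φ) * Q⁻¹ = (Q⁻¹ * (y • 1 - (x - y) • vecMulVec φ φ))ᵀ := by
      rw [Matrix.transpose_mul, hsymi, Matrix.transpose_sub, Matrix.transpose_smul, Matrix.transpose_smul, Matrix.transpose_one, Matrix.transpose_vecMulVec]
    rw [h3, Matrix.transpose_apply]
    simpa [sub_eq_add_neg] using this
  constructor
  · rw [integrable_rowG_iff]
    simp_rw [e]
    exact hg.1
  · rw [integral_rowG]
    simp_rw [e]
    rw [hg.2, hdet, hE, hP, hR, inv_pow]
    have : √Real.pi ^ N ≠ 0 := by positivity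
    field_simp
    
theorem PhiF {k : ℕ} (φ ψ : Fin (k+2) → ℝ) (x y : ℝ) :
    ∫ H, ((Matrix.of H - x • 1).det * Real.exp (-(((Matrix.of H - x • 1) *ᵥ φ) ⬝ᵥ ((Matrix.of H - x • 1) *ᵥ φ)))) *
      ((Matrix.of H - y • 1).det * Real.exp (-(((Matrix.of H - y • 1) *ᵥ ψ) ⬝ᵥ ((Matrix.of H - y • 1) *ᵥ ψ)))) ∂(matG (k+2)) =
    (√(Del (φ ⬝ᵥ φ) (ψ ⬝ᵥ ψ) (φ ⬝ᵥ ψ)))⁻¹ ^ (k+2) * Real.exp (-EE x y (φ ⬝ᵥ φ) (ψ ⬝ᵥ ψ) (φ ⬝ᵥ ψ)) *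
     (Del (φ ⬝ᵥ φ) (ψ ⬝ᵥ ψ) (φ ⬝ᵥ ψ))⁻¹ * (LL (x*y) (k+2) - EE x y (φ ⬝ᵥ φ) (ψ ⬝ᵥ ψ) (φ ⬝ᵥ ψ) * LL (x*y) (k+1)
       + x^2 * y^2 * (((φ ⬝ᵥ φ) * (ψ ⬝ᵥ ψ) - (φ ⬝ᵥ ψ)^2) / (Del (φ ⬝ᵥ φ) (ψ ⬝ᵥ ψ) (φ ⬝ᵥ ψ))) * LL (x*y) k) := by
  have hr := det_rows2 (N := k+2) (fun i h j => Real.exp (-((h - x • Pi.single i 1) ⬝ᵥ φ) ^ 2) * (h - x • (Pi.single i 1 : Fin (k+2) → ℝ)) j)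
    (fun i h j => Real.exp (-((h - y • Pi.single i 1) ⬝ᵥ ψ) ^ 2) * (h - y • (Pi.single i 1 : Fin (k+2) → ℝ)) j)
    (fun i j l => (rowH φ ψ x y i j l).1)
  have e : ∀ (x : ℝ) (φ : Fin (k+2) → ℝ) (H : Fin (k+2) → Fin (k+2) → ℝ), ((Matrix.of H - x • 1).det * Real.exp (-(((Matrix.of H - x • 1) *ᵥ φ) ⬝ᵥ ((Matrix.of H - x • 1) *ᵥ φ))))
    = (Matrix.of fun i j => Real.exp (-((H i - x • Pi.single i 1) ⬝ᵥ φ) ^ 2) * (H i - x • (Pi.single i 1 : Fin (k+2) → ℝ)) j).det := by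
    intro x φ H
    rw [exp_neg_sum_sq, mul_comm, ← Matrix.det_mul_column]
    have h1 : ∀ i, (Matrix.of H - x • (1 : Matrix (Fin (k+2)) (Fin (k+2)) ℝ)) i = H i - x • (Pi.single i 1 : Fin (k+2) → ℝ) := by
      intro i
      ext j
      simp [Matrix.one_apply, Pi.single_apply, eq_comm]
    congr 1
    ext i j
    simp only [Matrix.of_apply]
    rw [← h1]
  simp_rw [e]
  rw [hr.2]
  simp_rw [(rowH φ ψ x y _ _ _).2]
  set u := φ ⬝ᵥ φ with hu
  set v := ψ ⬝ᵥ ψ with hv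
  set w := φ ⬝ᵥ ψ with hw
  have hw' : ψ ⬝ᵥ φ = w := dotProduct_comm _ _
  have hD : 0 < Del u v w := Del_pos (dot_self_nonneg' φ) (dot_self_nonneg' ψ) (dot_cs φ ψ)
  set Q : Matrix (Fin (k+2)) (Fin (k+2)) ℝ := 1 + vecMulVec φ φ + vecMulVec ψ ψ with hQdef
  have hdet : Q.det = Del u v w := by
    rw [hQdef, det_rank2_one, hw', ← hu, ← hv, ← hw, Del]; ring
  have hQ1 : Q⁻¹ * Q = 1 := Matrix.nonsing_inv_mul _ (isUnit_iff_ne_zero.2 (by rw [hdet]; exact hD.ne'))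
  have hQ2 : Q * Q⁻¹ = 1 := Matrix.mul_nonsing_inv _ (isUnit_iff_ne_zero.2 (by rw [hdet]; exact hD.ne'))
  have hdi : Q⁻¹.det = (Del u v w)⁻¹ := by
    rw [Matrix.det_nonsing_inv, hdet, Ring.inverse_eq_inv']
  have hT : (fun i => Matrix.of fun j l => ((√(Del u v w))⁻¹ * Real.exp (-((x^2 * (φ i)^2 * (1 + v) + y^2 * (ψ i)^2 * (1 + u) - 2 * x * y * (φ i * ψ i) * w) / Del u v w))) *
       (1/2 * Q⁻¹ j l + (Q⁻¹ * (x • 1 + (x - y) • vecMulVec ψ ψ)) j i * ((y • 1 - (x - y) • vecMulVec φ φ) * Q⁻¹) i l))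
    = fun i => ((√(Del u v w))⁻¹ * Real.exp (-((x^2 * (φ i)^2 * (1 + v) + y^2 * (ψ i)^2 * (1 + u) - 2 * x * y * (φ i * ψ i) * w) / Del u v w))) •
       ((1/2 : ℝ) • Q⁻¹ + vecMulVec (fun j => (Q⁻¹ * (x • 1 + (x - y) • vecMulVec ψ ψ)) j i) (((y • 1 - (x - y) • vecMulVec φ φ) * Q⁻¹) i)) := by
    funext i; ext j l
    simp only [Matrix.of_apply, Matrix.smul_apply, Matrix.add_apply, vecMulVec_apply, smul_eq_mul]
  rw [hT, MD_scale, MD_main]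
  · have hprod : ∏ i, ((√(Del u v w))⁻¹ * Real.exp (-((x^2 * (φ i)^2 * (1 + v) + y^2 * (ψ i)^2 * (1 + u) - 2 * x * y * (φ i * ψ i) * w) / Del u v w)))
      = (√(Del u v w))⁻¹ ^ (k+2) * Real.exp (-EE x y u v w) := by
      rw [Finset.prod_mul_distrib, Finset.prod_const, ← Real.exp_sum, Finset.card_univ, Fintype.card_fin,
        Finset.sum_neg_distrib, ← Finset.sum_div]
      congr 3
      unfold EE
      congr 1
      rw [Finset.sum_sub_distrib, Finset.sum_add_distrib]
      simp only [← Finset.sum_mul, ← Finset.mul_sum]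
      have a1 : ∑ i, (φ i)^2 = u := by rw [hu]; simp [dotProduct, sq]
      have a2 : ∑ i, (ψ i)^2 = v := by rw [hv]; simp [dotProduct, sq]
      have a3 : ∑ i, φ i * ψ i = w := by rw [hw]; simp [dotProduct]
      rw [a1, a2, a3]; ring
    rw [hprod, mul_assoc ((√(Del u v w))⁻¹ ^ (k+2) * Real.exp (-EE x y u v w))]
    congr 1
    have hint : ∀ s : ℝ, Real.exp (-s) * (s • ((1/2 : ℝ) • Q⁻¹) + (Q⁻¹ * (x • 1 + (x - y) • vecMulVec ψ ψ)) * ((y • 1 - (x - y) • vecMulVec φ φ) * Q⁻¹)).det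
      = (Del u v w)⁻¹ * (Real.exp (-s) * (s/2 + x*y)^(k+2)) - (Del u v w)⁻¹ * EE x y u v w * (Real.exp (-s) * (s/2 + x*y)^(k+1))
        + (Del u v w)⁻¹ * (x^2 * y^2 * ((u * v - w^2) / Del u v w)) * (Real.exp (-s) * (s/2 + x*y)^k) := by
      intro s
      set l := s/2 + x*y with hl
      have h1 : s • ((1/2 : ℝ) • Q⁻¹) + (Q⁻¹ * (x • 1 + (x - y) • vecMulVec ψ ψ)) * ((y • 1 - (x - y) • vecMulVec φ φ) * Q⁻¹)
        = Q⁻¹ * (((s/2) • Q + (x • 1 + (x - y) • vecMulVec ψ ψ) * (y • 1 - (x - y) • vecMulVec φ φ)) * Q⁻¹) := by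
        generalize (x • (1 : Matrix (Fin (k+2)) (Fin (k+2)) ℝ) + (x - y) • vecMulVec ψ ψ) = P
        generalize (y • (1 : Matrix (Fin (k+2)) (Fin (k+2)) ℝ) - (x - y) • vecMulVec φ φ) = R
        rw [Matrix.add_mul ((s/2) • Q), Matrix.mul_add Q⁻¹]
        congr 1
        · rw [Matrix.smul_mul, hQ2, Matrix.mul_smul, Matrix.mul_one, smul_smul]; congr 1; ring
        · simp only [Matrix.mul_assoc]
      have h2 : (s/2) • Q + (x • 1 + (x - y) • vecMulVec ψ ψ) * (y • 1 - (x - y) • vecMulVec φ φ)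
        = l • 1 + vecMulVec φ ((l - x^2) • φ) + vecMulVec ψ ((l - y^2) • ψ - ((x-y)^2 * w) • φ) := by
        have h3 : vecMulVec ψ ψ * vecMulVec φ φ = w • vecMulVec ψ φ := by
          rw [Matrix.vecMulVec_mul_vecMulVec, hw']
          ext a b; simp [vecMulVec_apply]; try ring
        have h4 : (x • 1 + (x - y) • vecMulVec ψ ψ) * (y • 1 - (x - y) • vecMulVec φ φ) = (x * y) • (1 : Matrix (Fin (k+2)) (Fin (k+2)) ℝ) - (x * (x - y)) • vecMulVec φ φ + ((x-y) * y) • vecMulVec ψ ψ - ((x-y)^2 * w) • vecMulVec ψ φ := by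
          rw [Matrix.add_mul, Matrix.mul_sub, Matrix.mul_sub]
          simp only [Matrix.smul_mul, Matrix.mul_smul, Matrix.one_mul, Matrix.mul_one, h3, smul_smul]
          rw [sub_add_eq_add_sub, ← add_sub_assoc]
          ext a b
          simp only [Matrix.add_apply, Matrix.sub_apply, Matrix.smul_apply, smul_eq_mul]
          ring
        rw [h4, hQdef]
        ext a b
        simp only [Matrix.add_apply, Matrix.sub_apply, Matrix.smul_apply, vecMulVec_apply, Pi.sub_apply, Pi.smul_apply, smul_eq_mul, hl]
        ring
      rw [h1, h2, Matrix.det_mul, Matrix.det_mul, hdi, det_rank2]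
      simp only [smul_dotProduct, sub_dotProduct, smul_eq_mul, ← hu, ← hv, ← hw, hw']
      unfold EE
      field_simp
      unfold Del
      ring
    simp_rw [hint]
    have i0 := (LL_eq (x*y) k).1
    have i1 := (LL_eq (x*y) (k+1)).1
    have i2 := (LL_eq (x*y) (k+2)).1
    have i12 := (i2.const_mul (Del u v w)⁻¹).sub (i1.const_mul ((Del u v w)⁻¹ * EE x y u v w))
    have h5 := integral_add i12 (i0.const_mul ((Del u v w)⁻¹ * (x^2 * y^2 * ((u * v - w^2) / Del u v w))))
    have h6 := integral_sub (i2.const_mul (Del u v w)⁻¹) (i1.const_mul ((Del u v w)⁻¹ * EE x y u v w))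
    simp only [Pi.sub_apply] at h5
    rw [h5, h6, integral_const_mul, integral_const_mul, integral_const_mul]
    unfold LL
    ring
  · rw [Matrix.det_smul, hdi]
    positivity

open MeasureTheory Matrix

noncomputable def gd {N : ℕ} (A : Matrix (Fin N) (Fin N) ℝ) (φ : Fin N → ℝ) : ℝ :=
  A.det * Real.exp (-((A *ᵥ φ) ⬝ᵥ (A *ᵥ φ)))

noncomputable def PP (x y : ℝ) (k : ℕ) (u v w : ℝ) : ℝ :=
    (√(Del u v w))⁻¹ ^ (k+2) * Real.exp (-EE x y u v w) *
     (Del u v w)⁻¹ * (LL (x*y) (k+2) - EE x y u v w * LL (x*y) (k+1)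
       + x^2 * y^2 * ((u * v - w^2) / (Del u v w)) * LL (x*y) k)

noncomputable def GG (x y σ : ℝ) (k : ℕ) (u v w : ℝ) : ℝ :=
  √((1 + σ^2 * u)⁻¹) ^ (k+2) * (1 + σ^2 * u)⁻¹ * PP x y k ((1 + σ^2 * u)⁻¹ * u) v (√((1 + σ^2 * u)⁻¹) * w)

theorem GG_eq {k : ℕ} (x y : ℝ) {σ : ℝ} (hσ : σ ≠ 0) (φ ψ : Fin (k+2) → ℝ) :
    ∫ H, ∫ D, gd (Matrix.of H - x • 1 + σ • Matrix.of D) φ * gd (Matrix.of H - y • 1) ψ ∂(matG (k+2)) ∂(matG (k+2)) =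
     GG x y σ k (φ ⬝ᵥ φ) (ψ ⬝ᵥ ψ) (φ ⬝ᵥ ψ) := by
  set κ := (1 + σ^2 * (φ ⬝ᵥ φ))⁻¹ with hκ
  have hκ0 : 0 ≤ κ := by
    have := dot_self_nonneg' φ
    positivity
  have h1 : ∀ H : Fin (k+2) → Fin (k+2) → ℝ, ∫ D, gd (Matrix.of H - x • 1 + σ • Matrix.of D) φ * gd (Matrix.of H - y • 1) ψ ∂(matG (k+2))
     = √κ ^ (k+2) * κ * (gd (Matrix.of H - x • 1) (√κ • φ) * gd (Matrix.of H - y • 1) ψ) := by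
    intro H
    rw [integral_mul_const]
    unfold gd
    rw [ED _ _ hσ, Matrix.mulVec_smul, smul_dotProduct, dotProduct_smul, smul_eq_mul, smul_eq_mul, ← mul_assoc (√κ), Real.mul_self_sqrt hκ0]
    ring
  simp_rw [h1]
  rw [integral_const_mul, GG]
  congr 1
  unfold gd
  rw [PhiF, PP]
  simp only [smul_dotProduct, dotProduct_smul, smul_eq_mul, ← mul_assoc (√κ), Real.mul_self_sqrt hκ0, ← hκ]

theorem gd_cont {N : ℕ} (x y σ : ℝ) : Continuous (fun p : ((Fin N → Fin N → ℝ) × (Fin N → Fin N → ℝ)) × ((Fin N → ℝ) × (Fin N → ℝ)) =>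
    gd (Matrix.of p.1.1 - x • 1 + σ • Matrix.of p.1.2) p.2.1 * gd (Matrix.of p.1.1 - y • 1) p.2.2) := by
  unfold gd
  have hA : Continuous (fun p : ((Fin N → Fin N → ℝ) × (Fin N → Fin N → ℝ)) × ((Fin N → ℝ) × (Fin N → ℝ)) =>
    (Matrix.of p.1.1 - x • 1 + σ • Matrix.of p.1.2 : Matrix (Fin N) (Fin N) ℝ)) :=
    ((continuous_fst.fst : Continuous fun p : ((Fin N → Fin N → ℝ) × (Fin N → Fin N → ℝ)) × ((Fin N → ℝ) × (Fin N → ℝ)) => (Matrix.of p.1.1 : Matrix (Fin N) (Fin N) ℝ)).sub continuous_const).add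
      ((continuous_fst.snd : Continuous fun p : ((Fin N → Fin N → ℝ) × (Fin N → Fin N → ℝ)) × ((Fin N → ℝ) × (Fin N → ℝ)) => (Matrix.of p.1.2 : Matrix (Fin N) (Fin N) ℝ)).const_smul σ)
  have hB : Continuous (fun p : ((Fin N → Fin N → ℝ) × (Fin N → Fin N → ℝ)) × ((Fin N → ℝ) × (Fin N → ℝ)) =>
    (Matrix.of p.1.1 - y • 1 : Matrix (Fin N) (Fin N) ℝ)) :=
    ((continuous_fst.fst : Continuous fun p : ((Fin N → Fin N → ℝ) × (Fin N → Fin N → ℝ)) × ((Fin N → ℝ) × (Fin N → ℝ)) => (Matrix.of p.1.1 : Matrix (Fin N) (Fin N) ℝ)).sub continuous_const)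
  have h1 := hA.matrix_mulVec (continuous_snd.fst)
  have h2 := hB.matrix_mulVec (continuous_snd.snd)
  exact (hA.matrix_det.mul (h1.dotProduct h1).neg.rexp).mul (hB.matrix_det.mul (h2.dotProduct h2).neg.rexp)

theorem gd_int {N : ℕ} (A : Matrix (Fin N) (Fin N) ℝ) : Integrable (fun φ => gd A φ) := signdet_int A

theorem gd_abs {N : ℕ} (A : Matrix (Fin N) (Fin N) ℝ) : ∫ φ, ‖gd A φ‖ ≤ √Real.pi ^ N := signdet_abs A

theorem gd_integrable {N : ℕ} (x y σ : ℝ) : Integrable (fun p : ((Fin N → Fin N → ℝ) × (Fin N → Fin N → ℝ)) × ((Fin N → ℝ) × (Fin N → ℝ)) =>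
    gd (Matrix.of p.1.1 - x • 1 + σ • Matrix.of p.1.2) p.2.1 * gd (Matrix.of p.1.1 - y • 1) p.2.2)
     (((matG N).prod (matG N)).prod ((volume : Measure (Fin N → ℝ)).prod (volume : Measure (Fin N → ℝ)))) := by
  have hm := (gd_cont (N := N) x y σ).aestronglyMeasurable (μ := ((matG N).prod (matG N)).prod ((volume : Measure (Fin N → ℝ)).prod (volume : Measure (Fin N → ℝ))))
  rw [integrable_prod_iff hm]
  constructor
  · refine Filter.Eventually.of_forall fun p => ?_
    exact (gd_int (Matrix.of p.1 - x • 1 + σ • Matrix.of p.2)).mul_prod (gd_int (Matrix.of p.1 - y • 1))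
  have hm2 := hm.norm.integral_prod_right'
  refine Integrable.of_bound hm2 ((√Real.pi ^ N) * (√Real.pi ^ N)) (Filter.Eventually.of_forall fun p => ?_)
  rw [Real.norm_of_nonneg (integral_nonneg fun _ => norm_nonneg _)]
  simp only [norm_mul]
  rw [integral_prod_mul (fun φ => ‖gd (Matrix.of p.1 - x • 1 + σ • Matrix.of p.2) φ‖) (fun ψ => ‖gd (Matrix.of p.1 - y • 1) ψ‖)]
  exact mul_le_mul (gd_abs _) (gd_abs _) (integral_nonneg fun _ => norm_nonneg _) (by positivity)

theorem FN_eq {k : ℕ} (x y : ℝ) {σ : ℝ} (hσ : σ ≠ 0) :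
    Integrable (fun p : (Fin (k+2) → ℝ) × (Fin (k+2) → ℝ) => GG x y σ k (p.1 ⬝ᵥ p.1) (p.2 ⬝ᵥ p.2) (p.1 ⬝ᵥ p.2)) (volume.prod volume) ∧
    Real.pi ^ (k+2) * ∫ H, ∫ D, ((SignType.sign (Matrix.of H - x • 1 + σ • Matrix.of D).det : SignType) : ℝ) * ((SignType.sign (Matrix.of H - y • 1).det : SignType) : ℝ)
       ∂(matG (k+2)) ∂(matG (k+2)) =
    ∫ p : (Fin (k+2) → ℝ) × (Fin (k+2) → ℝ), GG x y σ k (p.1 ⬝ᵥ p.1) (p.2 ⬝ᵥ p.2) (p.1 ⬝ᵥ p.2) ∂(volume.prod volume) := by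
  have hi := gd_integrable (N := k+2) x y σ
  have hae : (fun q : (Fin (k+2) → ℝ) × (Fin (k+2) → ℝ) => ∫ p, gd (Matrix.of p.1 - x • 1 + σ • Matrix.of p.2) q.1 * gd (Matrix.of p.1 - y • 1) q.2 ∂((matG (k+2)).prod (matG (k+2))))
     =ᵐ[volume.prod volume] fun p => GG x y σ k (p.1 ⬝ᵥ p.1) (p.2 ⬝ᵥ p.2) (p.1 ⬝ᵥ p.2) := by
    filter_upwards [hi.prod_left_ae] with q hq
    rw [integral_prod _ hq, GG_eq x y hσ]
  refine ⟨hi.integral_prod_right.congr hae, ?_⟩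
  rw [← integral_congr_ae hae]
  have h1 := integral_integral_swap (f := fun (p : (Fin (k+2) → Fin (k+2) → ℝ) × (Fin (k+2) → Fin (k+2) → ℝ)) (q : (Fin (k+2) → ℝ) × (Fin (k+2) → ℝ)) => gd (Matrix.of p.1 - x • 1 + σ • Matrix.of p.2) q.1 * gd (Matrix.of p.1 - y • 1) q.2) hi
  rw [← h1, integral_prod _ hi.integral_prod_left]
  rw [← integral_const_mul]
  congr 1; funext H
  rw [← integral_const_mul]
  congr 1; funext D
  rw [integral_prod_mul (fun φ => gd (Matrix.of H - x • 1 + σ • Matrix.of D) φ) (fun ψ => gd (Matrix.of H - y • 1) ψ)]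
  unfold gd
  rw [signdet, signdet]
  have : Real.pi ^ (k+2) = √Real.pi ^ (k+2) * √Real.pi ^ (k+2) := by
    rw [← mul_pow, Real.mul_self_sqrt Real.pi_pos.le]
  rw [this]; ring

open MeasureTheory Matrix

theorem inner_toLp {n : ℕ} (a b : EuclideanSpace ℝ (Fin n)) : a.ofLp ⬝ᵥ b.ofLp = inner ℝ a b := by
  rw [EuclideanSpace.inner_eq_star_dotProduct, dotProduct_comm]; simp

theorem rot {n : ℕ} (φ : Fin (n+1) → ℝ) : ∃ e : (Fin (n+1) → ℝ) ≃ᵐ (Fin (n+1) → ℝ),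
    MeasurePreserving e volume volume ∧ ∀ ψ, e ψ ⬝ᵥ e ψ = ψ ⬝ᵥ ψ ∧ φ ⬝ᵥ e ψ = √(φ ⬝ᵥ φ) * ψ 0 := by
  let v : EuclideanSpace ℝ (Fin (n+1)) := WithLp.toLp 2 φ
  let w : EuclideanSpace ℝ (Fin (n+1)) := √(φ ⬝ᵥ φ) • EuclideanSpace.single 0 1
  have hv : ‖v‖ = √(φ ⬝ᵥ φ) := by
    rw [norm_eq_sqrt_real_inner, ← inner_toLp]
  have hvw : ‖v‖ = ‖w‖ := by
    rw [hv, norm_smul]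
    simp [abs_of_nonneg (Real.sqrt_nonneg _)]
  let R : EuclideanSpace ℝ (Fin (n+1)) ≃ₗᵢ[ℝ] EuclideanSpace ℝ (Fin (n+1)) := Submodule.reflection (ℝ ∙ (v - w))ᗮ
  have hR : R v = w := Submodule.reflection_sub hvw
  have hRR : ∀ a, R (R a) = a := fun a => Submodule.reflection_reflection _ a
  refine ⟨((MeasurableEquiv.toLp 2 _).trans R.toMeasurableEquiv).trans (MeasurableEquiv.toLp 2 _).symm, ?_, ?_⟩
  · exact (PiLp.volume_preserving_ofLp (Fin (n+1))).comp (R.measurePreserving.comp (PiLp.volume_preserving_toLp (Fin (n+1))))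
  · intro ψ
    show (R (WithLp.toLp 2 ψ)).ofLp ⬝ᵥ (R (WithLp.toLp 2 ψ)).ofLp = ψ ⬝ᵥ ψ ∧ v.ofLp ⬝ᵥ (R (WithLp.toLp 2 ψ)).ofLp = √(φ ⬝ᵥ φ) * ψ 0
    rw [inner_toLp, inner_toLp, R.inner_map_map, ← inner_toLp]
    refine ⟨rfl, ?_⟩
    rw [inner_toLp, ← R.inner_map_map, hR, hRR, ← inner_toLp]
    simp [w, smul_dotProduct]

noncomputable def cc (n : ℕ) : ℝ := n * (√Real.pi ^ n / Real.Gamma ((n:ℝ) / 2 + 1))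

theorem radial {n : ℕ} (f : ℝ → ℝ) : ∫ z : Fin (n+1) → ℝ, f (√(z ⬝ᵥ z)) = cc (n+1) * ∫ r in Set.Ioi (0:ℝ), r ^ n * f r := by
  have h := integral_fun_norm_addHaar (volume : Measure (EuclideanSpace ℝ (Fin (n+1)))) f
  have h1 : ∫ z : Fin (n+1) → ℝ, f (√(z ⬝ᵥ z)) = ∫ z : EuclideanSpace ℝ (Fin (n+1)), f ‖z‖ := by
    rw [← (PiLp.volume_preserving_toLp (Fin (n+1))).integral_comp (MeasurableEquiv.toLp 2 _).measurableEmbedding]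
    congr 1; funext z
    rw [norm_eq_sqrt_real_inner, ← inner_toLp]
  rw [h1, h]
  simp only [finrank_euclideanSpace, Fintype.card_fin, smul_eq_mul, nsmul_eq_mul, Nat.add_sub_cancel]
  rw [Measure.real, EuclideanSpace.volume_ball, cc]
  simp only [ENNReal.ofReal_one, one_pow, one_mul, Fintype.card_fin]
  rw [ENNReal.toReal_ofReal, mul_assoc]
  have : 0 < Real.Gamma (((n+1 : ℕ):ℝ) / 2 + 1) := Real.Gamma_pos_of_pos (by positivity)
  positivity

theorem psi_int {k : ℕ} (g : ℝ → ℝ → ℝ) (φ : Fin (k+2) → ℝ) (hg : Integrable fun ψ : Fin (k+2) → ℝ => g (ψ ⬝ᵥ ψ) (φ ⬝ᵥ ψ)) :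
    ∫ ψ : Fin (k+2) → ℝ, g (ψ ⬝ᵥ ψ) (φ ⬝ᵥ ψ) = cc (k+1) * ∫ ρ in Set.Ioi (0:ℝ), ρ ^ (k+1) * ∫ q : ℝ, g (ρ^2 * (1 + q^2)) (√(φ ⬝ᵥ φ) * ρ * q) := by
  obtain ⟨e, he, he2⟩ := rot φ
  set r := √(φ ⬝ᵥ φ)
  have h1 := he.integral_comp e.measurableEmbedding (fun ψ => g (ψ ⬝ᵥ ψ) (φ ⬝ᵥ ψ))
  have i1 := (he.integrable_comp_emb e.measurableEmbedding).2 hg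
  simp only [Function.comp_def, (he2 _).1, (he2 _).2] at h1 i1
  rw [← h1]
  have hp := (volume_preserving_piFinSuccAbove (fun _ : Fin (k+2) => ℝ) 0).symm
  have h2 := hp.integral_comp (MeasurableEquiv.measurableEmbedding _) (fun ψ : Fin (k+2) → ℝ => g (ψ ⬝ᵥ ψ) (r * ψ 0))
  have i2 := (hp.integrable_comp_emb (MeasurableEquiv.measurableEmbedding _)).2 i1
  have e0 : ∀ z : ℝ × (Fin (k+1) → ℝ), (MeasurableEquiv.piFinSuccAbove (fun _ : Fin (k+2) => ℝ) 0).symm z = Fin.cons z.1 z.2 := by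
    intro z
    funext i
    refine Fin.cases rfl (fun j => rfl) i
  have e1 : ∀ z : ℝ × (Fin (k+1) → ℝ), (Fin.cons z.1 z.2 : Fin (k+2) → ℝ) ⬝ᵥ (Fin.cons z.1 z.2 : Fin (k+2) → ℝ) = z.1^2 + z.2 ⬝ᵥ z.2 := by
    intro z
    simp [dotProduct, Fin.sum_univ_succ, sq]
  simp only [Function.comp_def, e0, e1, Fin.cons_zero] at h2 i2
  rw [← h2]
  rw [Measure.volume_eq_prod] at i2 ⊢
  rw [integral_prod_symm _ i2]
  have h3 := radial (n := k) (fun ρ => ∫ p : ℝ, g (p^2 + ρ^2) (r * p))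
  simp only [Real.sq_sqrt (dot_self_nonneg' _)] at h3
  rw [h3]
  congr 1
  apply setIntegral_congr_fun measurableSet_Ioi
  intro ρ hρ
  have hρ : 0 < ρ := hρ
  simp only
  have h4 := Measure.integral_comp_mul_left (fun p => g (p^2 + ρ^2) (r * p)) ρ
  rw [abs_of_pos (inv_pos.2 hρ), smul_eq_mul] at h4
  have h5 : ∀ q : ℝ, g (ρ^2 * (1 + q^2)) (r * ρ * q) = g ((ρ * q)^2 + ρ^2) (r * (ρ * q)) := by
    intro q; congr 1 <;> ring
  simp_rw [h5]
  rw [h4, pow_succ ρ k, mul_assoc, mul_inv_cancel_left₀ hρ.ne']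

theorem FN_radial {k : ℕ} (G : ℝ → ℝ → ℝ → ℝ) 
    (hi : Integrable (fun p : (Fin (k+2) → ℝ) × (Fin (k+2) → ℝ) => G (p.1 ⬝ᵥ p.1) (p.2 ⬝ᵥ p.2) (p.1 ⬝ᵥ p.2)) (volume.prod volume)) :
    ∫ p : (Fin (k+2) → ℝ) × (Fin (k+2) → ℝ), G (p.1 ⬝ᵥ p.1) (p.2 ⬝ᵥ p.2) (p.1 ⬝ᵥ p.2) ∂(volume.prod volume) =
    cc (k+2) * (cc (k+1) * ∫ r in Set.Ioi (0:ℝ), r ^ (k+1) * ∫ ρ in Set.Ioi (0:ℝ), ρ ^ (k+1) * ∫ q : ℝ, G (r^2) (ρ^2 * (1 + q^2)) (r * ρ * q)) := by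
  rw [integral_prod _ hi]
  have hae : (fun φ : Fin (k+2) → ℝ => ∫ ψ : Fin (k+2) → ℝ, G (φ ⬝ᵥ φ) (ψ ⬝ᵥ ψ) (φ ⬝ᵥ ψ)) =ᵐ[volume]
     fun φ => (fun r => cc (k+1) * ∫ ρ in Set.Ioi (0:ℝ), ρ ^ (k+1) * ∫ q : ℝ, G (r^2) (ρ^2 * (1 + q^2)) (r * ρ * q)) (√(φ ⬝ᵥ φ)) := by
    filter_upwards [hi.prod_right_ae] with φ hφ
    rw [psi_int (G (φ ⬝ᵥ φ)) φ hφ]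
    simp only [Real.sq_sqrt (dot_self_nonneg' _)]
  rw [integral_congr_ae hae, radial (n := k+1) (fun r => cc (k+1) * ∫ ρ in Set.Ioi (0:ℝ), ρ ^ (k+1) * ∫ q : ℝ, G (r^2) (ρ^2 * (1 + q^2)) (r * ρ * q))]
  congr 1
  rw [← integral_const_mul]
  congr 1; funext r; ring

open MeasureTheory Matrix

theorem subst_sqrt {n : ℝ} (hn : 0 < n) (f : ℝ → ℝ) :
    ∫ r in Set.Ioi (0:ℝ), f r = ∫ a in Set.Ioi (0:ℝ), √(n / a) ^ 3 / (2 * n) * f (√(n / a)) := by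
  have h1 := integral_comp_rpow_Ioi (fun y => f (√n * y)) (p := -1/2) (by norm_num)
  have h2 := integral_comp_mul_left_Ioi f 0 (Real.sqrt_pos.2 hn)
  rw [mul_zero] at h2
  have h3 : ∫ r in Set.Ioi (0:ℝ), f r = √n * ∫ y in Set.Ioi (0:ℝ), f (√n * y) := by
    rw [h2, smul_eq_mul, mul_inv_cancel_left₀ (Real.sqrt_pos.2 hn).ne']
  rw [h3, ← h1, ← integral_const_mul]
  apply setIntegral_congr_fun measurableSet_Ioi
  intro a ha
  have ha : 0 < a := ha
  have e1 : a ^ (-1/2 : ℝ) = (√a)⁻¹ := by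
    rw [show (-1/2 : ℝ) = -(1/2) by norm_num, Real.rpow_neg ha.le, Real.sqrt_eq_rpow]
  have e2 : a ^ ((-1/2 : ℝ) - 1) = (√a)⁻¹ * a⁻¹ := by
    rw [Real.rpow_sub ha, e1, Real.rpow_one]; rfl
  have e3 : √n * (√a)⁻¹ = √(n/a) := by rw [Real.sqrt_div hn.le]; rfl
  have e4 : √(n/a)^3 = n/a * (√n * (√a)⁻¹) := by
    rw [pow_succ, Real.sq_sqrt (by positivity), e3]
  simp only [smul_eq_mul]
  rw [e1, e2, e3, e4, show |(-1/2:ℝ)| = 1/2 by norm_num [abs_div]]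
  field_simp

noncomputable def Dh (T n a b q : ℝ) : ℝ := (1 + (a + T) / n) * (1 + b / n) + (a + T) / n * q^2

noncomputable def Eh (x y T n a b q : ℝ) : ℝ :=
  (x^2 * (b / n + 1 + q^2) + y^2 * (1 + q^2) * (1 + (a + T) / n) - 2 * x * y * q^2) / Dh T n a b q

noncomputable def Ih (x y T : ℝ) (k : ℕ) (a b q : ℝ) : ℝ :=
  (√(Dh T (k+2) a b q))⁻¹ ^ (k+4) * Real.exp (-Eh x y T (k+2) a b q) *
    (LL (x*y) (k+2) - Eh x y T (k+2) a b q * LL (x*y) (k+1) + x^2*y^2 / Dh T (k+2) a b q * LL (x*y) k)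

theorem GG_Ih (x y : ℝ) {T σ : ℝ} (hT : 0 < T) (k : ℕ) (hσ : σ^2 = T / (k+2)) {a b : ℝ} (ha : 0 < a) (hb : 0 < b) (q : ℝ) :
    √((k+2) / a) ^ (k+4) * √((k+2) / b) ^ (k+4) * GG x y σ k (√((k+2) / a) ^ 2) (√((k+2) / b)^2 * (1 + q^2)) (√((k+2) / a) * √((k+2) / b) * q)
     = Ih x y T k a b q := by
  have hn : (0:ℝ) < (k:ℝ) + 2 := by positivity
  set n : ℝ := (k:ℝ) + 2 with hnd
  have hA : 0 < a + T := by positivity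
  have hu : √(n/a)^2 = n/a := Real.sq_sqrt (by positivity)
  have hv : √(n/b)^2 = n/b := Real.sq_sqrt (by positivity)
  have hκ : (1 + σ^2 * (√(n/a)^2))⁻¹ = a / (a + T) := by
    rw [hu, hσ]; field_simp
  have hκ2 : √(a/(a+T))^2 = a/(a+T) := Real.sq_sqrt (by positivity)
  unfold GG PP
  rw [hκ, hu, hv]
  have hDh : 0 < Dh T n a b q := by unfold Dh; positivity
  have hw2 : (√(a/(a+T)) * (√(n/a) * √(n/b) * q))^2 = n^2 * q^2 / ((a+T) * b) := by
    rw [mul_pow, mul_pow, mul_pow, hκ2, hu, hv]; field_simp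
  have hDel : Del (a/(a+T) * (n/a)) (n/b * (1 + q^2)) (√(a/(a+T)) * (√(n/a) * √(n/b) * q)) = n^2 / ((a+T) * b) * Dh T n a b q := by
    unfold Del Dh
    rw [hw2]; field_simp; ring
  have hEE : EE x y (a/(a+T) * (n/a)) (n/b * (1 + q^2)) (√(a/(a+T)) * (√(n/a) * √(n/b) * q)) = Eh x y T n a b q := by
    unfold EE Eh
    rw [hDel, hw2]
    field_simp
    ring
  rw [hEE, hDel]
  have hq : (a/(a+T) * (n/a) * (n/b * (1 + q^2)) - (√(a/(a+T)) * (√(n/a) * √(n/b) * q))^2) / (n^2 / ((a+T) * b) * Dh T n a b q) = 1 / Dh T n a b q := by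
    rw [hw2]; field_simp; ring
  rw [hq]
  have hs : √(n^2 / ((a+T) * b) * Dh T n a b q) = √(n/a) * √(n/b) * √(a/(a+T)) * √(Dh T n a b q) := by
    rw [← Real.sqrt_mul (by positivity), ← Real.sqrt_mul (by positivity), ← Real.sqrt_mul (by positivity)]
    congr 1; field_simp
  have hD1 : (n^2 / ((a+T) * b) * Dh T n a b q)⁻¹ = (√(n^2 / ((a+T) * b) * Dh T n a b q))⁻¹^2 := by
    rw [inv_pow, Real.sq_sqrt (by positivity)]
  have hk1 : a / (a+T) * 1 = √(a/(a+T))^2 := by rw [hκ2, mul_one]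
  rw [hD1, hs]
  nth_rewrite 2 [← mul_one (a/(a+T))]
  rw [hk1]
  have p1 : 0 < √(n/a) := Real.sqrt_pos.2 (by positivity)
  have p2 : 0 < √(n/b) := Real.sqrt_pos.2 (by positivity)
  have p3 : 0 < √(a/(a+T)) := Real.sqrt_pos.2 (by positivity)
  have p4 : 0 < √(Dh T n a b q) := Real.sqrt_pos.2 hDh
  unfold Ih
  rw [← hnd]
  have key : √(n/a)^(k+4) * √(n/b)^(k+4) * √(a/(a+T))^(k+2) * √(a/(a+T))^2 * ((√(n/a) * √(n/b) * √(a/(a+T)) * √(Dh T n a b q))⁻¹ ^ (k+2) * (√(n/a) * √(n/b) * √(a/(a+T)) * √(Dh T n a b q))⁻¹ ^ 2)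
    = (√(Dh T n a b q))⁻¹^(k+4) := by
    rw [← pow_add, mul_assoc _ (_ ^ (k+2)) (_ ^ 2), ← pow_add, ← mul_pow, ← mul_pow, ← mul_pow]
    congr 1
    field_simp
  rw [← key]
  ring

noncomputable def Jh (x y T : ℝ) (k : ℕ) : ℝ := ∫ a in Set.Ioi (0:ℝ), ∫ b in Set.Ioi (0:ℝ), ∫ q : ℝ, Ih x y T k a b q

theorem J_eq (x y : ℝ) {T σ : ℝ} (hT : 0 < T) (k : ℕ) (hσ : σ^2 = T / (k+2)) :
    ∫ r in Set.Ioi (0:ℝ), r ^ (k+1) * ∫ ρ in Set.Ioi (0:ℝ), ρ ^ (k+1) * ∫ q : ℝ, GG x y σ k (r^2) (ρ^2 * (1 + q^2)) (r * ρ * q)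
     = (1 / (2 * ((k:ℝ)+2)))^2 * Jh x y T k := by
  have hn : (0:ℝ) < (k:ℝ) + 2 := by positivity
  rw [subst_sqrt hn, Jh, ← integral_const_mul]
  apply setIntegral_congr_fun measurableSet_Ioi
  intro a ha
  have ha : 0 < a := ha
  simp only
  rw [subst_sqrt hn, ← integral_const_mul, ← integral_const_mul, ← integral_const_mul]
  apply setIntegral_congr_fun measurableSet_Ioi
  intro b hb
  have hb : 0 < b := hb
  simp only
  rw [← integral_const_mul, ← integral_const_mul, ← integral_const_mul, ← integral_const_mul, ← integral_const_mul]
  congr 1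
  funext q
  rw [← GG_Ih x y hT k hσ ha hb q]
  field_simp
  ring

theorem cc_mul (k : ℕ) : cc (k+2) * cc (k+1) * (((k+2).factorial : ℝ) / 2^(k+2)) = Real.pi^(k+2) * (((k:ℝ)+2) * ((k:ℝ)+1) / Real.pi) := by
  unfold cc
  have h := Real.Gamma_mul_Gamma_add_half (((k:ℝ)+3)/2)
  have h1 : Real.Gamma (2 * (((k:ℝ)+3)/2)) = ((k+2).factorial : ℝ) := by
    rw [← Real.Gamma_nat_eq_factorial]; congr 1; push_cast; ring
  have h2 : (2:ℝ) ^ (1 - 2 * (((k:ℝ)+3)/2)) = (2^(k+2))⁻¹ := by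
    rw [← Real.rpow_natCast, ← Real.rpow_neg (by norm_num)]
    congr 1; push_cast; ring
  rw [h1, h2] at h
  have e1 : (((k+1:ℕ):ℝ)/2 + 1) = ((k:ℝ)+3)/2 := by push_cast; ring
  have e2 : (((k+2:ℕ):ℝ)/2 + 1) = ((k:ℝ)+3)/2 + 1/2 := by push_cast; ring
  rw [e1, e2]
  have g1 : 0 < Real.Gamma (((k:ℝ)+3)/2) := Real.Gamma_pos_of_pos (by positivity)
  have g2 : 0 < Real.Gamma (((k:ℝ)+3)/2 + 1/2) := Real.Gamma_pos_of_pos (by positivity)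
  have hf : (((k+2).factorial : ℝ) / 2^(k+2)) = Real.Gamma (((k:ℝ)+3)/2) * Real.Gamma (((k:ℝ)+3)/2 + 1/2) / √Real.pi := by
    rw [h]
    have : √Real.pi ≠ 0 := by positivity
    field_simp
  have hp : Real.pi = √Real.pi^2 := (Real.sq_sqrt Real.pi_pos.le).symm
  have hp0 : √Real.pi ≠ 0 := by positivity
  rw [hf]
  generalize √Real.pi = z at *
  rw [hp]
  push_cast
  field_simp
  ring

noncomputable def Bh (x y T : ℝ) (k : ℕ) (a b q : ℝ) : ℝ :=
  ell (x*y) (k+2) - Eh x y T (k+2) a b q * (2 / ((k:ℝ)+2)) * ell (x*y) (k+1) + x^2*y^2 / Dh T (k+2) a b q * (4 / (((k:ℝ)+2) * ((k:ℝ)+1))) * ell (x*y) k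

noncomputable def Kh (x y T : ℝ) (k : ℕ) (a b q : ℝ) : ℝ :=
  (√(Dh T (k+2) a b q))⁻¹ ^ (k+4) * Real.exp (-Eh x y T (k+2) a b q) * Bh x y T k a b q

theorem Ih_Kh (x y T : ℝ) (k : ℕ) (a b q : ℝ) : Ih x y T k a b q = (((k+2).factorial : ℝ) / 2^(k+2)) * Kh x y T k a b q := by
  unfold Ih Kh Bh
  rw [(LL_eq _ _).2, (LL_eq _ _).2, (LL_eq _ _).2]
  have f1 : ((k+2).factorial : ℝ) = ((k:ℝ)+2) * (((k:ℝ)+1) * (k.factorial : ℝ)) := by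
    rw [Nat.factorial_succ, Nat.factorial_succ]; push_cast; ring
  have f2 : ((k+1).factorial : ℝ) = (((k:ℝ)+1) * (k.factorial : ℝ)) := by
    rw [Nat.factorial_succ]; push_cast; ring
  rw [f1, f2, pow_succ 2 (k+1), pow_succ 2 k]
  have : (0:ℝ) < (k:ℝ)+1 := by positivity
  have : (0:ℝ) < (k:ℝ)+2 := by positivity
  field_simp
  ring

theorem FN_final (x y : ℝ) {T σ : ℝ} (hT : 0 < T) (k : ℕ) (hσ0 : σ ≠ 0) (hσ : σ^2 = T / (k+2)) :
    ∫ H, ∫ D, ((SignType.sign (Matrix.of H - x • 1 + σ • Matrix.of D).det : SignType) : ℝ) * ((SignType.sign (Matrix.of H - y • 1).det : SignType) : ℝ)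
       ∂(matG (k+2)) ∂(matG (k+2)) = ((k:ℝ)+1) / (4 * Real.pi * ((k:ℝ)+2)) *
       ∫ a in Set.Ioi (0:ℝ), ∫ b in Set.Ioi (0:ℝ), ∫ q : ℝ, Kh x y T k a b q := by
  have h := (FN_eq (k := k) x y hσ0).2
  rw [FN_radial _ (FN_eq (k := k) x y hσ0).1, J_eq x y hT k hσ] at h
  unfold Jh at h
  simp_rw [Ih_Kh, integral_const_mul] at h
  have hc := cc_mul k
  have hp : Real.pi^(k+2) ≠ 0 := by positivity
  apply mul_left_cancel₀ hp
  rw [h]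
  generalize (∫ a in Set.Ioi (0:ℝ), ∫ b in Set.Ioi (0:ℝ), ∫ q : ℝ, Kh x y T k a b q) = Z
  have : (0:ℝ) < (k:ℝ)+2 := by positivity
  calc _ = (cc (k+2) * cc (k+1) * (((k+2).factorial : ℝ) / 2^(k+2))) * ((1 / (2 * ((k:ℝ)+2)))^2 * Z) := by ring
    _ = _ := by
      rw [hc]; field_simp; ring

open MeasureTheory Matrix

theorem Dh_ge {T n a b q : ℝ} (hT : 0 < T) (hn : 0 < n) (ha : 0 < a) (hb : 0 < b) :
    1 + ((a + T) + b + (a + T) * q^2) / n ≤ Dh T n a b q := by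
  unfold Dh
  have : 0 ≤ (a+T)/n * (b/n) := by positivity
  have e : 1 + ((a + T) + b + (a + T) * q^2) / n = 1 + (a+T)/n + b/n + (a+T)/n * q^2 := by ring
  rw [e]; nlinarith

theorem Dh_one {T n a b q : ℝ} (hT : 0 < T) (hn : 0 < n) (ha : 0 < a) (hb : 0 < b) :
    1 ≤ Dh T n a b q := by
  refine le_trans ?_ (Dh_ge hT hn ha hb)
  have : 0 ≤ ((a + T) + b + (a + T) * q^2) / n := by positivity
  linarith

theorem Eh_nonneg (x y : ℝ) {T n a b q : ℝ} (hT : 0 < T) (hn : 0 < n) (ha : 0 < a) (hb : 0 < b) :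
    0 ≤ Eh x y T n a b q := by
  unfold Eh
  apply div_nonneg _ (zero_le_one.trans (Dh_one hT hn ha hb))
  have e : x^2 * (b / n + 1 + q^2) + y^2 * (1 + q^2) * (1 + (a + T) / n) - 2 * x * y * q^2
    = x^2 * (b/n) + x^2 + y^2 + y^2 * (1+q^2) * ((a+T)/n) + (x-y)^2 * q^2 := by ring
  rw [e]; positivity

theorem ell_bound (c : ℝ) (j : ℕ) : |ell c j| ≤ Real.exp (2 * |c|) := by
  unfold ell
  refine (Finset.abs_sum_le_sum_abs _ _).trans ?_
  refine le_trans (le_of_eq ?_) (Real.sum_le_exp_of_nonneg (by positivity) (j+1))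
  refine Finset.sum_congr rfl fun m _ => ?_
  rw [abs_div, abs_pow, abs_mul, Nat.abs_cast]; simp

theorem Bh_bound (x y : ℝ) {T a b : ℝ} (q : ℝ) (k : ℕ) (hT : 0 < T) (ha : 0 < a) (hb : 0 < b) :
    |Real.exp (-Eh x y T (k+2) a b q) * Bh x y T k a b q| ≤ Real.exp (2 * |x*y|) * (2 + 2 * (x^2 * y^2)) := by
  have hn : (0:ℝ) < (k:ℝ) + 2 := by positivity
  have hE := Eh_nonneg x y (q := q) hT hn ha hb
  have hD := Dh_one (q := q) hT hn ha hb
  unfold Bh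
  set E := Eh x y T ((k:ℝ)+2) a b q
  set D := Dh T ((k:ℝ)+2) a b q
  set M := Real.exp (2 * |x*y|)
  have l0 := ell_bound (x*y) k
  have l1 := ell_bound (x*y) (k+1)
  have l2 := ell_bound (x*y) (k+2)
  have hM : 0 < M := Real.exp_pos _
  have e1 : Real.exp (-E) ≤ 1 := Real.exp_le_one_iff.2 (by linarith)
  have e2 : E * Real.exp (-E) ≤ 1 := by
    rw [Real.exp_neg, ← div_eq_mul_inv, div_le_one (Real.exp_pos _)]
    linarith [Real.add_one_le_exp E]
  have e0 : 0 < Real.exp (-E) := Real.exp_pos _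
  have c1 : 2 / ((k:ℝ)+2) ≤ 1 := by rw [div_le_one hn]; linarith [(Nat.cast_nonneg k : (0:ℝ) ≤ k)]
  have c2 : 4 / (((k:ℝ)+2) * ((k:ℝ)+1)) ≤ 2 := by
    rw [div_le_iff₀ (by positivity)]; nlinarith [(Nat.cast_nonneg k : (0:ℝ) ≤ k)]
  have d1 : x^2 * y^2 / D ≤ x^2 * y^2 := div_le_self (by positivity) hD
  have d0 : 0 ≤ x^2 * y^2 / D := by positivity
  rw [mul_add, mul_sub]
  have t1 : |Real.exp (-E) * ell (x*y) (k+2)| ≤ 1 * M := by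
    rw [abs_mul, abs_of_pos e0]; exact mul_le_mul e1 l2 (abs_nonneg _) zero_le_one
  have t2 : |Real.exp (-E) * (E * (2 / ((k:ℝ)+2)) * ell (x*y) (k+1))| ≤ (1 * 1) * M := by
    have : Real.exp (-E) * (E * (2 / ((k:ℝ)+2)) * ell (x*y) (k+1)) = ((E * Real.exp (-E)) * (2 / ((k:ℝ)+2))) * ell (x*y) (k+1) := by ring
    rw [this, abs_mul, abs_of_nonneg (a := (E * Real.exp (-E)) * (2 / ((k:ℝ)+2))) (by positivity)]
    exact mul_le_mul (mul_le_mul e2 c1 (by positivity) zero_le_one) l1 (abs_nonneg _) (by norm_num)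
  have t3 : |Real.exp (-E) * (x^2*y^2 / D * (4 / (((k:ℝ)+2) * ((k:ℝ)+1))) * ell (x*y) k)| ≤ 1 * ((x^2*y^2 * 2) * M) := by
    rw [abs_mul, abs_of_pos e0, abs_mul, abs_of_nonneg (a := x^2*y^2 / D * (4 / (((k:ℝ)+2) * ((k:ℝ)+1)))) (by positivity)]
    refine mul_le_mul e1 (mul_le_mul (mul_le_mul d1 c2 (by positivity) (by positivity)) l0 (abs_nonneg _) (by positivity)) (by positivity) zero_le_one
  refine (abs_add_le _ _).trans ?_
  have := abs_sub (Real.exp (-E) * ell (x*y) (k+2)) (Real.exp (-E) * (E * (2 / ((k:ℝ)+2)) * ell (x*y) (k+1)))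
  nlinarith

theorem pow_bound {n X : ℝ} (hX : 0 ≤ X) (k : ℕ) (hk : 8 ≤ k) (hn : n = (k:ℝ)+2) :
    (1 + X/10)^10 ≤ (1 + X/n)^(k+2) := by
  have hk' : (8:ℝ) ≤ k := by exact_mod_cast hk
  have hn0 : 0 < n := by rw [hn]; positivity
  have h0 : 0 ≤ X/n := by positivity
  have h := one_add_mul_self_le_rpow_one_add (s := X/n) (by linarith) (p := n/10) (by rw [le_div_iff₀ (by norm_num)]; linarith)
  have e : 1 + n/10 * (X/n) = 1 + X/10 := by field_simp
  rw [e] at h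
  calc (1 + X/10)^10 ≤ ((1 + X/n)^(n/10))^10 := pow_le_pow_left₀ (by positivity) h 10
    _ = (1 + X/n)^(k+2) := by
      rw [← Real.rpow_natCast ((1 + X/n)^(n/10)), ← Real.rpow_mul (by positivity), ← Real.rpow_natCast]
      congr 1; rw [hn]; push_cast; ring

theorem sqD_bound {T a b : ℝ} (q : ℝ) (k : ℕ) (hk : 8 ≤ k) (hT : 0 < T) (ha : 0 < a) (hb : 0 < b) :
    (√(Dh T (k+2) a b q))⁻¹ ^ (k+4) ≤ (1 + (1/10 * a)^2)⁻¹ * ((1 + (1/10 * b)^2)⁻¹ * (1 + (√(T/10) * q)^2)⁻¹) := by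
  have hn : (0:ℝ) < (k:ℝ) + 2 := by positivity
  have hD := Dh_one (q := q) hT hn ha hb
  have hD2 := Dh_ge (q := q) hT hn ha hb
  set D := Dh T ((k:ℝ)+2) a b q
  have hq := mul_nonneg (add_pos ha hT).le (sq_nonneg q)
  have hq2 := mul_nonneg ha.le (sq_nonneg q)
  have aX : a ≤ (a + T) + b + (a + T) * q^2 := by linarith
  have bX : b ≤ (a + T) + b + (a + T) * q^2 := by linarith
  have tX : T * q^2 ≤ (a + T) + b + (a + T) * q^2 := by linarith
  have hX : 0 ≤ (a + T) + b + (a + T) * q^2 := by linarith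
  generalize (a + T) + b + (a + T) * q^2 = X at *
  clear_value D
  have hp := pow_bound hX k hk rfl
  have hs1 : 1 ≤ √D := Real.one_le_sqrt.2 hD
  have h1 : (1 + X/10)^10 ≤ (√D^(k+4))^2 := by
    calc (1 + X/10)^10 ≤ (1 + X/((k:ℝ)+2))^(k+2) := hp
      _ ≤ D^(k+2) := pow_le_pow_left₀ (by positivity) hD2 _
      _ ≤ D^(k+4) := pow_le_pow_right₀ hD (by omega)
      _ = (√D^(k+4))^2 := by rw [← pow_mul, mul_comm, pow_mul, Real.sq_sqrt (by linarith)]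
  have h2 : (1 + X/10)^5 ≤ √D^(k+4) := by
    rw [← pow_le_pow_iff_left₀ (by positivity) (by positivity) two_ne_zero, ← pow_mul]; exact h1
  have f1 : 1 + (1/10 * a)^2 ≤ (1 + X/10)^2 := by
    have := mul_le_mul aX aX ha.le hX
    nlinarith
  have f2 : 1 + (1/10 * b)^2 ≤ (1 + X/10)^2 := by
    have := mul_le_mul bX bX hb.le hX
    nlinarith
  have f3 : 1 + (√(T/10) * q)^2 ≤ 1 + X/10 := by
    rw [mul_pow, Real.sq_sqrt (by positivity)]
    linarith
  rw [← mul_inv, ← mul_inv, inv_pow]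
  apply inv_anti₀ (by positivity)
  calc _ ≤ (1 + X/10)^2 * ((1 + X/10)^2 * (1 + X/10)) := by gcongr
    _ = (1 + X/10)^5 := by ring
    _ ≤ _ := h2

theorem Kh_bound (x y : ℝ) {T a b : ℝ} (q : ℝ) (k : ℕ) (hk : 8 ≤ k) (hT : 0 < T) (ha : 0 < a) (hb : 0 < b) :
    ‖Kh x y T k a b q‖ ≤ ((1 + (1/10 * a)^2)⁻¹ * ((1 + (1/10 * b)^2)⁻¹ * (1 + (√(T/10) * q)^2)⁻¹)) * (Real.exp (2 * |x*y|) * (2 + 2 * (x^2 * y^2))) := by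
  unfold Kh
  rw [Real.norm_eq_abs, mul_assoc, abs_mul, abs_of_nonneg (by positivity)]
  exact mul_le_mul (sqD_bound q k hk hT ha hb) (Bh_bound x y q k hT ha hb) (abs_nonneg _) (by positivity)

theorem ell_lim (c : ℝ) (m : ℕ) : Filter.Tendsto (fun k => ell c (k+m)) Filter.atTop (nhds (Real.exp (2*c))) := by
  have h := (NormedSpace.expSeries_div_hasSum_exp (2*c)).tendsto_sum_nat
  rw [← Real.exp_eq_exp_ℝ] at h
  exact h.comp (Filter.tendsto_add_atTop_nat (m+1))

theorem n_lim (m : ℕ) : Filter.Tendsto (fun k : ℕ => (((k:ℝ)+m))⁻¹) Filter.atTop (nhds 0) :=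
  (Filter.tendsto_atTop_add_const_right _ _ tendsto_natCast_atTop_atTop).inv_tendsto_atTop

theorem Dh_lim (T a b q : ℝ) : Filter.Tendsto (fun k : ℕ => Dh T (k+2) a b q) Filter.atTop (nhds 1) := by
  have h := n_lim 2
  unfold Dh
  simp only [div_eq_mul_inv]
  have := (((h.const_mul (a+T)).const_add 1).mul ((h.const_mul b).const_add 1)).add ((h.const_mul (a+T)).mul_const (q^2))
  simpa using this

theorem Eh_lim (x y T a b q : ℝ) : Filter.Tendsto (fun k : ℕ => Eh x y T (k+2) a b q) Filter.atTop (nhds (x^2 * (1+q^2) + y^2*(1+q^2) - 2*x*y*q^2)) := by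
  have h := n_lim 2
  have hd := Dh_lim T a b q
  unfold Eh
  have h1 : Filter.Tendsto (fun k : ℕ => x^2 * (b / ((k:ℝ)+2) + 1 + q^2) + y^2 * (1 + q^2) * (1 + (a + T) / ((k:ℝ)+2)) - 2 * x * y * q^2) Filter.atTop (nhds (x^2 * (1+q^2) + y^2*(1+q^2) - 2*x*y*q^2)) := by
    simp only [div_eq_mul_inv]
    have := ((((((h.const_mul b).add_const 1).add_const (q^2)).const_mul (x^2)).add (((h.const_mul (a+T)).const_add 1).const_mul (y^2 * (1+q^2)))).sub_const (2*x*y*q^2))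
    simpa using this
  have h3 := h1.div hd one_ne_zero
  rw [div_one] at h3
  exact h3

theorem Bh_lim (x y T a b q : ℝ) : Filter.Tendsto (fun k : ℕ => Bh x y T k a b q) Filter.atTop (nhds (Real.exp (2*(x*y)))) := by
  unfold Bh
  have h1 := n_lim 1
  have h2 := n_lim 2
  have hE := Eh_lim x y T a b q
  have hD := Dh_lim T a b q
  have i2 : Filter.Tendsto (fun k : ℕ => 2 / ((k:ℝ)+2)) Filter.atTop (nhds 0) := by
    simpa [div_eq_mul_inv] using h2.const_mul 2
  have i4 : Filter.Tendsto (fun k : ℕ => 4 / (((k:ℝ)+2) * ((k:ℝ)+1))) Filter.atTop (nhds 0) := by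
    simpa [div_eq_mul_inv, mul_inv, mul_comm, mul_assoc, mul_left_comm] using (h2.mul h1).const_mul 4
  have hD' : Filter.Tendsto (fun k : ℕ => x^2*y^2 / Dh T (k+2) a b q) Filter.atTop (nhds (x^2*y^2/1)) :=
    (tendsto_const_nhds).div hD one_ne_zero
  have := ((ell_lim (x*y) 2).sub ((hE.mul i2).mul (ell_lim (x*y) 1))).add ((hD'.mul i4).mul (ell_lim (x*y) 0))
  simpa using this

theorem sqD_lim {T a b : ℝ} (q : ℝ) (hT : 0 < T) (ha : 0 < a) (hb : 0 < b) :
    Filter.Tendsto (fun k : ℕ => (√(Dh T (k+2) a b q))⁻¹ ^ (k+4)) Filter.atTop (nhds (Real.exp (-(((a + T) + b + (a + T) * q^2)/2)))) := by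
  set X := (a + T) + b + (a + T) * q^2 with hX
  have hD := Dh_lim T a b q
  have h1 : Filter.Tendsto (fun k : ℕ => (1 + (Dh T (k+2) a b q - 1))^k) Filter.atTop (nhds (Real.exp X)) := by
    apply Real.tendsto_one_add_pow_exp_of_tendsto
    have e : ∀ k : ℕ, (k:ℝ) * (Dh T (k+2) a b q - 1) = (1 - 2 * ((k:ℝ)+2)⁻¹) * (X + (a+T) * b * ((k:ℝ)+2)⁻¹) := by
      intro k
      have : (0:ℝ) < (k:ℝ)+2 := by positivity
      unfold Dh; rw [hX]; field_simp; ring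
    simp_rw [e]
    have h := n_lim 2
    have := ((h.const_mul 2).const_sub 1).mul ((h.const_mul ((a+T)*b)).const_add X)
    simpa using this
  have h2 : Filter.Tendsto (fun k : ℕ => (√((1 + (Dh T (k+2) a b q - 1))^k))⁻¹ * (√(Dh T (k+2) a b q))⁻¹ ^ 4) Filter.atTop (nhds ((√(Real.exp X))⁻¹ * (√1)⁻¹^4)) := by
    refine Filter.Tendsto.mul ?_ ?_
    · exact ((Real.continuous_sqrt.tendsto _).comp h1).inv₀ (by positivity)
    · exact (((Real.continuous_sqrt.tendsto _).comp hD).inv₀ (by simp)).pow 4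
  have e3 : (√(Real.exp X))⁻¹ * (√1)⁻¹^4 = Real.exp (-(X/2)) := by
    rw [← Real.exp_half, ← Real.exp_neg]; simp
  rw [e3] at h2
  refine h2.congr fun k => ?_
  have hD1 := Dh_one (q := q) hT (by positivity : (0:ℝ) < (k:ℝ)+2) ha hb
  rw [add_sub_cancel, pow_add]
  congr 1
  rw [inv_pow]
  congr 1
  rw [Real.sqrt_eq_iff_mul_self_eq (by positivity) (by positivity), ← mul_pow, Real.mul_self_sqrt (by linarith)]

noncomputable def Kinf (z T a b q : ℝ) : ℝ := Real.exp (-(b/2)) * (Real.exp (-((a+T)/2 + z^2)) * Real.exp (-((a+T)/2 + z^2) * q^2))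

theorem Kh_lim (x y : ℝ) {T a b : ℝ} (q : ℝ) (hT : 0 < T) (ha : 0 < a) (hb : 0 < b) :
    Filter.Tendsto (fun k : ℕ => Kh x y T k a b q) Filter.atTop (nhds (Kinf (x-y) T a b q)) := by
  have h := ((sqD_lim q hT ha hb).mul ((Real.continuous_exp.tendsto _).comp (Eh_lim x y T a b q).neg)).mul (Bh_lim x y T a b q)
  unfold Kh Kinf
  have e : Real.exp (-(b/2)) * (Real.exp (-((a+T)/2 + (x-y)^2)) * Real.exp (-((a+T)/2 + (x-y)^2) * q^2)) = Real.exp (-((a + T + b + (a + T) * q ^ 2) / 2)) *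
          Real.exp (-(x ^ 2 * (1 + q ^ 2) + y ^ 2 * (1 + q ^ 2) - 2 * x * y * q ^ 2)) *
        Real.exp (2 * (x * y)) := by
    rw [← Real.exp_add, ← Real.exp_add, ← Real.exp_add, ← Real.exp_add]
    congr 1; ring
  rw [e]; exact h

open MeasureTheory Matrix

theorem triple_int {μ ν κ : Measure ℝ} [SFinite μ] [SFinite ν] [SFinite κ] {f : ℝ → ℝ → ℝ → ℝ}
    (h : Integrable (fun p : ℝ × ℝ × ℝ => f p.1 p.2.1 p.2.2) (μ.prod (ν.prod κ))) :
    ∫ p, f p.1 p.2.1 p.2.2 ∂(μ.prod (ν.prod κ)) = ∫ a, ∫ b, ∫ q, f a b q ∂κ ∂ν ∂μ := by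
  rw [integral_prod _ h]
  refine integral_congr_ae ?_
  filter_upwards [h.prod_right_ae] with a ha
  rw [integral_prod _ ha]

noncomputable def mu3 : Measure (ℝ × ℝ × ℝ) :=
  ((volume : Measure ℝ).restrict (Set.Ioi 0)).prod (((volume : Measure ℝ).restrict (Set.Ioi 0)).prod (volume : Measure ℝ))

theorem mu3_pos : ∀ᵐ p ∂mu3, 0 < p.1 ∧ 0 < p.2.1 := by
  have e : mu3 = ((volume : Measure ℝ).prod ((volume : Measure ℝ).prod (volume : Measure ℝ))).restrict
      (Set.Ioi 0 ×ˢ (Set.Ioi 0 ×ˢ Set.univ)) := by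
    rw [← Measure.prod_restrict, ← Measure.prod_restrict, Measure.restrict_univ]; rfl
  rw [e]
  filter_upwards [ae_restrict_mem (measurableSet_Ioi.prod (measurableSet_Ioi.prod MeasurableSet.univ))] with p hp
  exact ⟨hp.1, hp.2.1⟩

theorem Kh_meas (x y T : ℝ) (k : ℕ) : AEStronglyMeasurable (fun p : ℝ × ℝ × ℝ => Kh x y T k p.1 p.2.1 p.2.2) mu3 := by
  apply Measurable.aestronglyMeasurable
  unfold Kh Bh Eh Dh
  fun_prop

theorem bd_int {T : ℝ} (hT : 0 < T) (C : ℝ) : Integrable (fun p : ℝ × ℝ × ℝ =>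
    ((1+(1/10*p.1)^2)⁻¹ * ((1+(1/10*p.2.1)^2)⁻¹ * (1+(√(T/10)*p.2.2)^2)⁻¹)) * C) mu3 := by
  have h1 : Integrable (fun a : ℝ => (1+(1/10*a)^2)⁻¹) :=
    integrable_inv_one_add_sq.comp_mul_left' (by norm_num : (1/10:ℝ) ≠ 0)
  have h2 : Integrable (fun a : ℝ => (1+(√(T/10)*a)^2)⁻¹) :=
    integrable_inv_one_add_sq.comp_mul_left' (by positivity)
  exact ((h1.restrict (s := Set.Ioi 0)).mul_prod ((h1.restrict (s := Set.Ioi 0)).mul_prod h2)).mul_const C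

theorem Kinf_meas (z T : ℝ) : AEStronglyMeasurable (fun p : ℝ × ℝ × ℝ => Kinf z T p.1 p.2.1 p.2.2) mu3 := by
  apply Measurable.aestronglyMeasurable
  unfold Kinf
  fun_prop

theorem Kh_int_lim (x y : ℝ) {T : ℝ} (hT : 0 < T) :
    Filter.Tendsto (fun k : ℕ => ∫ a in Set.Ioi 0, ∫ b in Set.Ioi 0, ∫ q : ℝ, Kh x y T k a b q) Filter.atTop
      (nhds (∫ a in Set.Ioi 0, ∫ b in Set.Ioi 0, ∫ q : ℝ, Kinf (x-y) T a b q)) := by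
  set C := Real.exp (2 * |x*y|) * (2 + 2 * (x^2 * y^2))
  have hb : ∀ k : ℕ, 8 ≤ k → ∀ᵐ p ∂mu3, ‖Kh x y T k p.1 p.2.1 p.2.2‖ ≤
      ((1+(1/10*p.1)^2)⁻¹ * ((1+(1/10*p.2.1)^2)⁻¹ * (1+(√(T/10)*p.2.2)^2)⁻¹)) * C := by
    intro k hk
    filter_upwards [mu3_pos] with p hp
    exact Kh_bound x y p.2.2 k hk hT hp.1 hp.2
  have hl : ∀ᵐ p ∂mu3, Filter.Tendsto (fun k : ℕ => Kh x y T k p.1 p.2.1 p.2.2) Filter.atTop (nhds (Kinf (x-y) T p.1 p.2.1 p.2.2)) := by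
    filter_upwards [mu3_pos] with p hp
    exact Kh_lim x y p.2.2 hT hp.1 hp.2
  have hi : ∀ k : ℕ, 8 ≤ k → Integrable (fun p : ℝ × ℝ × ℝ => Kh x y T k p.1 p.2.1 p.2.2) mu3 :=
    fun k hk => (bd_int hT C).mono' (Kh_meas x y T k) (hb k hk)
  have hinf : Integrable (fun p : ℝ × ℝ × ℝ => Kinf (x-y) T p.1 p.2.1 p.2.2) mu3 := by
    refine (bd_int hT C).mono' (Kinf_meas _ T) ?_
    filter_upwards [mu3_pos, hl] with p hp hlp
    refine le_of_tendsto hlp.norm ?_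
    filter_upwards [Filter.eventually_ge_atTop 8] with k hk
    exact Kh_bound x y p.2.2 k hk hT hp.1 hp.2
  rw [← triple_int hinf]
  have := tendsto_integral_filter_of_dominated_convergence _ (Filter.Eventually.of_forall fun k => Kh_meas x y T k)
    ((Filter.eventually_ge_atTop 8).mono hb) (bd_int hT C) hl
  refine this.congr' ?_
  filter_upwards [Filter.eventually_ge_atTop 8] with k hk
  exact triple_int (hi k hk)

theorem sub_int (z : ℝ) {T : ℝ} (hT : 0 < T) :
    ∫ a in Set.Ioi 0, Real.exp (-((a+T)/2+z^2)) * (√((a+T)/2+z^2))⁻¹ = 4 * ∫ v in Set.Ioi √(z^2+T/2), Real.exp (-v^2) := by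
  set c := √(z^2+T/2) with hc
  have hc0 : 0 < c := by positivity
  have hc2 : c^2 = z^2+T/2 := Real.sq_sqrt (by positivity)
  have him : (fun v : ℝ => 2*(v^2-z^2)-T) '' Set.Ioi c = Set.Ioi 0 := by
    ext a
    simp only [Set.mem_image, Set.mem_Ioi]
    constructor
    · rintro ⟨v, hv, rfl⟩
      nlinarith
    · intro ha
      refine ⟨√((a+T)/2+z^2), ?_, ?_⟩
      · rw [hc]; apply Real.sqrt_lt_sqrt (by positivity); linarith
      · rw [Real.sq_sqrt (by positivity)]; ring
  rw [← him, integral_image_eq_integral_abs_deriv_smul (f' := fun v => 4*v) measurableSet_Ioi, ← integral_const_mul]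
  · refine setIntegral_congr_fun measurableSet_Ioi fun v hv => ?_
    have hv0 : 0 < v := hc0.trans hv
    have e : (2 * (v ^ 2 - z ^ 2) - T + T) / 2 + z ^ 2 = v^2 := by ring
    simp only [e, smul_eq_mul]
    rw [Real.sqrt_sq hv0.le, abs_of_pos (by positivity)]
    field_simp
  · intro v _
    apply HasDerivAt.hasDerivWithinAt
    have := ((((hasDerivAt_pow 2 v).sub_const (z^2)).const_mul 2).sub_const T)
    convert this using 1
    norm_num; ring
  · intro v hv w hw h
    have hv0 : 0 < v := hc0.trans hv
    have hw0 : 0 < w := hc0.trans hw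
    have : v^2 = w^2 := by simp only at h; linarith
    exact (sq_eq_sq₀ hv0.le hw0.le).1 this

theorem Kinf_int (z : ℝ) {T : ℝ} (hT : 0 < T) :
    1 / (4 * Real.pi) * ∫ a in Set.Ioi 0, ∫ b in Set.Ioi 0, ∫ q : ℝ, Kinf z T a b q = erfc √(z^2+T/2) := by
  have hb : ∫ b in Set.Ioi (0:ℝ), Real.exp (-(b/2)) = 2 := by
    have := integral_exp_mul_Ioi (a := -(1/2)) (by norm_num) 0
    norm_num at this
    refine Eq.trans ?_ this
    congr 1; ext b; congr 1; ring
  have h : ∫ a in Set.Ioi 0, ∫ b in Set.Ioi 0, ∫ q : ℝ, Kinf z T a b q =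
      (2 * √Real.pi) * ∫ a in Set.Ioi 0, Real.exp (-((a+T)/2+z^2)) * (√((a+T)/2+z^2))⁻¹ := by
    rw [← integral_const_mul]
    refine setIntegral_congr_fun measurableSet_Ioi fun a ha => ?_
    have ha' : (0:ℝ) < a := ha
    simp only [Kinf, integral_const_mul, integral_mul_const, integral_gaussian, hb]
    rw [Real.sqrt_div Real.pi_pos.le]; ring
  rw [h, sub_int z hT, erfc]
  have : Real.pi = √Real.pi * √Real.pi := (Real.mul_self_sqrt Real.pi_pos.le).symm
  have hp : 0 < √Real.pi := by positivity
  generalize (∫ v in Set.Ioi √(z^2+T/2), Real.exp (-v^2)) = J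
  nth_rewrite 1 [this]
  field_simp

theorem FN_lim (x y : ℝ) {T : ℝ} (hT : 0 < T) :
    Filter.Tendsto (fun k : ℕ => ((k:ℝ)+1)/(4*Real.pi*((k:ℝ)+2)) * ∫ a in Set.Ioi 0, ∫ b in Set.Ioi 0, ∫ q : ℝ, Kh x y T k a b q)
      Filter.atTop (nhds (erfc √((x-y)^2+T/2))) := by
  rw [← Kinf_int (x-y) hT]
  refine Filter.Tendsto.mul ?_ (Kh_int_lim x y hT)
  have h := ((n_lim 2).const_sub 1).mul_const (1/(4*Real.pi))
  rw [sub_zero, one_mul] at h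
  refine h.congr fun k => ?_
  have : (k:ℝ) + 2 ≠ 0 := by positivity
  have := Real.pi_pos
  push_cast
  field_simp
  ring

open MeasureTheory Matrix

theorem scale_int (N : ℕ) {s : ℝ} (hs : 0 < s) (f : Matrix (Fin N) (Fin N) ℝ → ℝ) :
    ∫ M, f M ∂(ginibre N s) = ∫ D, f (√s • Matrix.of D) ∂(matG N) := by
  rw [ginibre_map N hs]
  have hs' : √s ≠ 0 := by positivity
  have he : MeasurableEmbedding (fun D : Fin N → Fin N → ℝ => fun i j => √s * D i j) :=
    (Homeomorph.smulOfNeZero (α := Fin N → Fin N → ℝ) (√s) hs').measurableEmbedding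
  exact he.integral_map f

theorem sign_smul_det {N : ℕ} {c : ℝ} (hc : 0 < c) (A B : Matrix (Fin N) (Fin N) ℝ) (h : A = c • B) :
    SignType.sign A.det = SignType.sign B.det := by
  rw [h, Matrix.det_smul, sign_mul, sign_pos (by positivity), one_mul]

theorem main_step (t T : ℝ) (ht : 0 < t) (hT : 0 < T) (x y : ℝ) (k : ℕ) :
    ∫ H, ∫ D, spin x (H + D) * spin y H ∂(ginibre (k+2) (T / ((k+2 : ℕ):ℝ))) ∂(ginibre (k+2) t)
     = ((k:ℝ)+1)/(4*Real.pi*((k:ℝ)+2)) * ∫ a in Set.Ioi 0, ∫ b in Set.Ioi 0, ∫ q : ℝ, Kh (x/√t) (y/√t) (T/t) k a b q := by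
  have hu : 0 < T / ((k+2 : ℕ):ℝ) := by positivity
  set u := T / ((k+2 : ℕ):ℝ) with hud
  have hst : 0 < √t := by positivity
  have hsu : 0 < √u := by positivity
  have hσ : (√u/√t)^2 = (T/t) / (k+2) := by
    rw [div_pow, Real.sq_sqrt ht.le, Real.sq_sqrt hu.le, hud]; push_cast; field_simp
  rw [← FN_final (x/√t) (y/√t) (T := T/t) (σ := √u/√t) (by positivity) k (by positivity) hσ, scale_int _ ht]
  refine integral_congr_ae ?_
  filter_upwards [matG_det_ne0 (k+2) ((y/√t) • (1 : Matrix (Fin (k+2)) (Fin (k+2)) ℝ))] with H hH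
  rw [scale_int _ hu]
  refine integral_congr_ae ?_
  filter_upwards [matG_det_ne (k+2) (Matrix.of H - (x/√t) • 1) (c := √u/√t) (by positivity)] with D hD
  have e1 : √t • Matrix.of H + √u • Matrix.of D - x • (1 : Matrix (Fin (k+2)) (Fin (k+2)) ℝ)
      = √t • (Matrix.of H - (x/√t) • 1 + (√u/√t) • Matrix.of D) := by
    rw [smul_add, smul_sub, smul_smul, smul_smul, mul_div_cancel₀ _ hst.ne', mul_div_cancel₀ _ hst.ne']
    abel
  have e2 : √t • Matrix.of H - y • (1 : Matrix (Fin (k+2)) (Fin (k+2)) ℝ)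
      = √t • (Matrix.of H - (y/√t) • 1) := by
    rw [smul_sub, smul_smul, mul_div_cancel₀ _ hst.ne']
  have n1 : (√t • Matrix.of H + √u • Matrix.of D - x • (1 : Matrix (Fin (k+2)) (Fin (k+2)) ℝ)).det ≠ 0 := by
    rw [e1, Matrix.det_smul]; exact mul_ne_zero (by positivity) hD
  have n2 : (√t • Matrix.of H - y • (1 : Matrix (Fin (k+2)) (Fin (k+2)) ℝ)).det ≠ 0 := by
    rw [e2, Matrix.det_smul]; exact mul_ne_zero (by positivity) hH
  rw [spin_eq_sign x _ n1, spin_eq_sign y _ n2, sign_smul_det hst _ _ e1, sign_smul_det hst _ _ e2]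

theorem decay_of_temporal_correlations (t T : ℝ) (ht : 0 < t) (hT : 0 < T) (x y : ℝ) :
    Filter.Tendsto
      (fun N : ℕ =>
        ∫ H, ∫ D, spin x (H + D) * spin y H ∂(ginibre N (T / N)) ∂(ginibre N t))
      Filter.atTop
      (nhds (erfc (Real.sqrt ((x - y) ^ 2 / t + T / (2 * t))))) := by
  rw [← Filter.tendsto_add_atTop_iff_nat 2]
  have h := FN_lim (x/√t) (y/√t) (T := T/t) (by positivity)
  have e : (x/√t - y/√t)^2 + T/t/2 = (x - y) ^ 2 / t + T / (2 * t) := by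
    rw [← sub_div, div_pow, Real.sq_sqrt ht.le, div_div, mul_comm t 2]
  rw [e] at h
  exact h.congr fun k => (main_step t T ht hT x y k).symm
end
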